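/- arXiv:0903.3499 — 3 statements merged into one kernel-verified Lean document; each statement's English description precedes it below -/
import Mathlib

section
/- For all σ ∈ (0,1] and all a ∈ Sⁿ, the expectation of ln C(z) for z drawn from ν_{a,σ} is at most 2·ln n + 2·ln d + 2·ln(1/σ) + 5. -/
open MeasureTheory
open scoped RealInnerProductSpace

/-- The spherical cap `{z ∈ Sⁿ : ⟨z,a⟩ > √(1-ρ²)}` in `Sⁿ ⊆ ℝ^{n+1}`. -/
noncomputable def cap (n : ℕ) (a : EuclideanSpace ℝ (Fin (n + 1))) (ρ : ℝ) :
    Set (EuclideanSpace ℝ (Fin (n + 1))) :=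
  {z | z ∈ Metric.sphere (0 : EuclideanSpace ℝ (Fin (n + 1))) 1 ∧
       Real.sqrt (1 - ρ ^ 2) < ⟪z, a⟫}

/-- `ν_{a,σ}`: the uniform probability measure on `cap(a,σ)`, i.e. the normalized
`n`-dimensional Hausdorff (surface) measure restricted to `cap(a,σ)`. -/
noncomputable def nuMeasure (n : ℕ) (a : EuclideanSpace ℝ (Fin (n + 1))) (σ : ℝ) :
    Measure (EuclideanSpace ℝ (Fin (n + 1))) :=
  (μH[(n : ℝ)] (cap n a σ))⁻¹ • (μH[(n : ℝ)]).restrict (cap n a σ)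

lemma lintegral_ofReal_log_div_abs_le {ε : ℝ} (hε : 0 < ε) :
    ∫⁻ t : ℝ, ENNReal.ofReal (Real.log (ε / |t|)) ≤ ENNReal.ofReal (2 * ε) := by
  have hle : ∀ t : ℝ, ENNReal.ofReal (Real.log (ε / |t|)) ≤
      (Set.Ioc (-ε) ε).indicator (fun t => ENNReal.ofReal (Real.log ε - Real.log t)) t := by
    intro t
    by_cases ht : t ∈ Set.Ioc (-ε) ε
    · rw [Set.indicator_of_mem ht]
      rcases eq_or_ne t 0 with rfl | h0
      · simp
      · rw [Real.log_div hε.ne' (abs_pos.2 h0).ne', Real.log_abs]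
    · rw [Set.indicator_of_notMem ht]
      have h1 : ε ≤ |t| := by
        by_contra! h
        exact ht ⟨(abs_lt.1 h).1, (abs_lt.1 h).2.le⟩
      simp only [nonpos_iff_eq_zero, ENNReal.ofReal_eq_zero]
      exact Real.log_nonpos (by positivity) ((div_le_one (hε.trans_le h1)).2 h1)
  have hInt : IntervalIntegrable (fun t => Real.log ε - Real.log t) volume (-ε) ε :=
    intervalIntegrable_const.sub intervalIntegral.intervalIntegrable_log'
  have hInt' : IntegrableOn (fun t => Real.log ε - Real.log t) (Set.Ioc (-ε) ε) volume :=
    (intervalIntegrable_iff_integrableOn_Ioc_of_le (by linarith)).1 hInt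
  calc _ ≤ ∫⁻ t, (Set.Ioc (-ε) ε).indicator
        (fun t => ENNReal.ofReal (Real.log ε - Real.log t)) t := lintegral_mono hle
    _ = ∫⁻ t in Set.Ioc (-ε) ε, ENNReal.ofReal (Real.log ε - Real.log t) :=
        lintegral_indicator measurableSet_Ioc _
    _ = ENNReal.ofReal (∫ t in Set.Ioc (-ε) ε, (Real.log ε - Real.log t)) := by
        rw [ofReal_integral_eq_lintegral_ofReal hInt']
        rw [Filter.EventuallyLE, ae_restrict_iff' measurableSet_Ioc]
        filter_upwards [volume.ae_ne (0 : ℝ)] with t h0 ht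
        rw [Pi.zero_apply, sub_nonneg, ← Real.log_abs t]
        exact Real.log_le_log (abs_pos.2 h0) (abs_le.2 ⟨ht.1.le, ht.2⟩)
    _ = ENNReal.ofReal (2 * ε) := by
        rw [← intervalIntegral.integral_of_le (by linarith),
          intervalIntegral.integral_sub intervalIntegrable_const
            intervalIntegral.intervalIntegrable_log', integral_log]
        congr 1
        simp [Real.log_neg_eq_log]
        ring

lemma lintegral_ofReal_log_div_norm_sub_le {ε : ℝ} (hε : 0 < ε) (τ : ℂ) :
    ∫⁻ t : ℝ, ENNReal.ofReal (Real.log (ε / ‖(t : ℂ) - τ‖)) ≤ ENNReal.ofReal (2 * ε) := by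
  refine le_trans ?_ (lintegral_ofReal_log_div_abs_le hε)
  rw [← lintegral_sub_right_eq_self (fun t => ENNReal.ofReal (Real.log (ε / |t|))) τ.re]
  refine lintegral_mono_ae ?_
  filter_upwards [volume.ae_ne τ.re] with t ht
  have h0 : 0 < |t - τ.re| := abs_pos.2 (sub_ne_zero.2 ht)
  have h1 : |t - τ.re| ≤ ‖(t : ℂ) - τ‖ := by
    simpa using Complex.abs_re_le_norm ((t : ℂ) - τ)
  exact ENNReal.ofReal_le_ofReal (Real.log_le_log (div_pos hε (h0.trans_le h1)) (by gcongr))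

lemma ofReal_multiset_sum_le (s : Multiset ℝ) :
    ENNReal.ofReal s.sum ≤ (s.map ENNReal.ofReal).sum := by
  induction s using Multiset.induction_on with
  | empty => simp
  | cons a s ih =>
    simp only [Multiset.sum_cons, Multiset.map_cons]
    exact ENNReal.ofReal_add_le.trans (by gcongr)

lemma lintegral_multiset_log_le {ε : ℝ} (hε : 0 < ε) (s : Multiset ℂ) :
    ∫⁻ t : ℝ, (s.map fun τ => ENNReal.ofReal (Real.log (ε / ‖(t : ℂ) - τ‖))).sum ≤
      s.card * ENNReal.ofReal (2 * ε) := by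
  induction s using Multiset.induction_on with
  | empty => simp
  | cons a s ih =>
    simp only [Multiset.map_cons, Multiset.sum_cons, Multiset.card_cons, Nat.cast_add, Nat.cast_one]
    rw [lintegral_add_left (by fun_prop), add_mul, one_mul, add_comm]
    exact add_le_add ih (lintegral_ofReal_log_div_norm_sub_le hε a)

lemma eval_map_eq_prod_roots (q : Polynomial ℝ) (t : ℝ) :
    |q.eval t| = |q.leadingCoeff| *
      ((q.map (algebraMap ℝ ℂ)).roots.map fun τ => ‖(t : ℂ) - τ‖).prod := by
  have h := (IsAlgClosed.splits (q.map (algebraMap ℝ ℂ))).eval_eq_prod_roots (t : ℂ)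
  rw [Polynomial.leadingCoeff_map] at h
  have h2 : (q.map (algebraMap ℝ ℂ)).eval (t : ℂ) = ((q.eval t : ℝ) : ℂ) := by
    rw [Polynomial.eval_map]
    exact Polynomial.eval₂_at_apply (algebraMap ℝ ℂ) t
  rw [h2] at h
  have h3 := congrArg norm h
  rw [norm_mul] at h3
  simp only [Complex.norm_real, Real.norm_eq_abs, Complex.coe_algebraMap] at h3
  rw [h3, ← Real.norm_eq_abs]
  congr 1
  have := map_multiset_prod (normHom : ℂ →*₀ ℝ)
    ((q.map (algebraMap ℝ ℂ)).roots.map fun τ => (t : ℂ) - τ)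
  rw [Multiset.map_map] at this
  exact this

lemma lintegral_neg_log_eval_le {ε : ℝ} (hε : 0 < ε) (q : Polynomial ℝ) (j : ℕ)
    (hdeg : q.natDegree ≤ j) (hc : q.coeff j ≠ 0) :
    ∫⁻ t : ℝ, ENNReal.ofReal (j * Real.log ε - Real.log (|q.eval t| / |q.coeff j|)) ≤
      j * ENNReal.ofReal (2 * ε) := by
  have hnd : q.natDegree = j := le_antisymm hdeg (Polynomial.le_natDegree_of_ne_zero hc)
  have hlc : q.leadingCoeff = q.coeff j := by rw [Polynomial.leadingCoeff, hnd]
  have hq0 : q ≠ 0 := by rintro rfl; simp at hc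
  set R := (q.map (algebraMap ℝ ℂ)).roots with hR
  have hcard : R.card = j := by
    rw [← (IsAlgClosed.splits (q.map (algebraMap ℝ ℂ))).natDegree_eq_card_roots,
      Polynomial.natDegree_map, hnd]
  refine le_trans (lintegral_mono_ae ?_) ((lintegral_multiset_log_le hε R).trans_eq (by rw [hcard]))
  have hfin : ∀ᵐ t : ℝ, t ∉ (q.roots.toFinset : Set ℝ) :=
    measure_eq_zero_iff_ae_notMem.1 (q.roots.toFinset.finite_toSet.measure_zero volume)
  filter_upwards [hfin] with t ht
  have ht0 : q.eval t ≠ 0 := by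
    intro h
    apply ht
    simp [hq0, h]
  refine le_trans (ENNReal.ofReal_le_ofReal ?_) ((ofReal_multiset_sum_le
    (R.map fun τ => Real.log (ε / ‖(t : ℂ) - τ‖))).trans_eq (by rw [Multiset.map_map]; rfl))
  have hev := eval_map_eq_prod_roots q t
  rw [hlc, ← hR] at hev
  rw [hev, mul_div_cancel_left₀ _ (abs_pos.2 hc).ne', ← hcard]
  have hne : ∀ τ ∈ R, ‖(t : ℂ) - τ‖ ≠ 0 := by
    intro τ hτ h0
    have : (R.map fun τ => ‖(t : ℂ) - τ‖).prod = 0 :=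
      Multiset.prod_eq_zero (h0 ▸ Multiset.mem_map_of_mem _ hτ)
    rw [this, mul_zero, abs_eq_zero] at hev
    exact ht0 hev
  clear_value R
  clear hR hcard hev
  apply le_of_eq
  induction R using Multiset.induction_on with
  | empty => simp
  | cons a s ih =>
    have ha := hne a (by simp)
    have hs : ∀ τ ∈ s, ‖(t : ℂ) - τ‖ ≠ 0 := fun τ hτ => hne τ (by simp [hτ])
    have hp : (s.map fun τ => ‖(t : ℂ) - τ‖).prod ≠ 0 := by
      refine Multiset.prod_ne_zero fun h => ?_
      obtain ⟨τ, hτ, h0⟩ := Multiset.mem_map.1 h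
      exact hs τ hτ h0
    simp only [Multiset.map_cons, Multiset.sum_cons, Multiset.card_cons, Multiset.prod_cons]
    rw [← ih hs, Real.log_mul ha hp, Real.log_div hε.ne' ha]
    push_cast
    ring

lemma norm_coeff_prod_X_add_C_le {r : ℝ} (hr : 0 < r) (s : Multiset ℂ) (hs : ∀ w ∈ s, r ≤ ‖w‖)
    (j : ℕ) :
    r ^ j * ‖((s.map fun w => Polynomial.X + Polynomial.C w).prod).coeff j‖ ≤
      (s.card.choose j) * (s.map fun w => ‖w‖).prod := by
  induction s using Multiset.induction_on generalizing j with
  | empty =>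
    rcases j with _ | j
    · simp
    · simp [Polynomial.coeff_one]
  | cons a s ih =>
    have ih' := ih fun w hw => hs w (by simp [hw])
    have ha : r ≤ ‖a‖ := hs a (by simp)
    have hprod : 0 ≤ (s.map fun w => ‖w‖).prod :=
      Multiset.prod_nonneg fun x hx => by
        obtain ⟨w, -, rfl⟩ := Multiset.mem_map.1 hx
        exact norm_nonneg w
    simp only [Multiset.map_cons, Multiset.prod_cons, Multiset.card_cons]
    set p := (s.map fun w => Polynomial.X + Polynomial.C w).prod
    set M := (s.map fun w => ‖w‖).prod
    rw [add_mul, Polynomial.coeff_add, Polynomial.coeff_C_mul]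
    rcases j with _ | j
    · have h0 := ih' 0
      simp only [pow_zero, one_mul, Nat.choose_zero_right, Nat.cast_one] at h0 ⊢
      rw [Polynomial.mul_coeff_zero, Polynomial.coeff_X_zero, zero_mul, zero_add, norm_mul]
      gcongr
    · rw [Polynomial.coeff_X_mul, Nat.choose_succ_succ]
      calc r ^ (j + 1) * ‖p.coeff j + a * p.coeff (j + 1)‖
          ≤ r ^ (j + 1) * (‖p.coeff j‖ + ‖a‖ * ‖p.coeff (j + 1)‖) := by
            gcongr
            exact (norm_add_le _ _).trans_eq (by rw [norm_mul])
        _ = r * (r ^ j * ‖p.coeff j‖) + ‖a‖ * (r ^ (j + 1) * ‖p.coeff (j + 1)‖) := by ring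
        _ ≤ ‖a‖ * (s.card.choose j * M) + ‖a‖ * (s.card.choose (j + 1) * M) := by
            exact add_le_add (mul_le_mul ha (ih' j) (by positivity) (norm_nonneg a))
              (mul_le_mul_of_nonneg_left (ih' (j + 1)) (norm_nonneg a))
        _ = _ := by push_cast; ring

/-- The logarithm of a lower bound for `ε / r`, where `r` is the smallest modulus of a complex root
of the polynomial `q` of degree at most `d`, truncated at zero. -/
noncomputable def coeffLog (d : ℕ) (ε : ℝ) (q : Polynomial ℝ) : ENNReal :=
  ⨆ j ∈ Finset.Icc 1 d, ENNReal.ofReal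
    ((j : ℝ)⁻¹ * Real.log (ε ^ j * |q.coeff j| / (d.choose j * |q.coeff 0|)))

lemma coeffLog_taylor_le {ε : ℝ} (hε : 0 < ε) {d : ℕ} (q : Polynomial ℝ) (hq : q.natDegree ≤ d)
    (t : ℝ) :
    coeffLog d ε (Polynomial.taylor t q) ≤
      ((q.map (algebraMap ℝ ℂ)).roots.map
        fun τ => ENNReal.ofReal (Real.log (ε / ‖(t : ℂ) - τ‖))).sum := by
  refine iSup₂_le fun j hj => ?_
  obtain ⟨hj1, hjd⟩ := Finset.mem_Icc.1 hj
  have hev := eval_map_eq_prod_roots q t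
  set R := (q.map (algebraMap ℝ ℂ)).roots with hR
  rw [Polynomial.taylor_coeff_zero]
  by_cases ht0 : q.eval t = 0
  · simp [ht0]
  by_cases hcj : (Polynomial.taylor t q).coeff j = 0
  · simp [hcj]
  have hcardq : R.card = q.natDegree := by
    rw [← (IsAlgClosed.splits (q.map (algebraMap ℝ ℂ))).natDegree_eq_card_roots,
      Polynomial.natDegree_map]
  have hjq : j ≤ q.natDegree := by
    rw [← Polynomial.natDegree_taylor q t]
    exact Polynomial.le_natDegree_of_ne_zero hcj
  have hRne : R.toFinset.Nonempty := by
    rw [Finset.nonempty_iff_ne_empty, Ne, Multiset.toFinset_eq_empty]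
    intro h
    rw [h, Multiset.card_zero] at hcardq
    omega
  obtain ⟨τ, hτ, hmin⟩ := R.toFinset.exists_min_image (fun τ => ‖(t : ℂ) - τ‖) hRne
  rw [Multiset.mem_toFinset] at hτ
  have hr : 0 < ‖(t : ℂ) - τ‖ := by
    refine lt_of_le_of_ne (norm_nonneg _) fun h0 => ht0 ?_
    have : (R.map fun τ => ‖(t : ℂ) - τ‖).prod = 0 :=
      Multiset.prod_eq_zero (h0 ▸ Multiset.mem_map_of_mem _ hτ)
    rwa [this, mul_zero, abs_eq_zero] at hev
  have htay : (Polynomial.taylor t q).map (algebraMap ℝ ℂ) =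
      Polynomial.C ((q.leadingCoeff : ℝ) : ℂ) *
        ((R.map fun τ => (t : ℂ) - τ).map fun w => Polynomial.X + Polynomial.C w).prod := by
    have h1 := (IsAlgClosed.splits (q.map (algebraMap ℝ ℂ))).eq_prod_roots
    rw [Polynomial.leadingCoeff_map, ← hR] at h1
    have h2 : (Polynomial.taylor t q).map (algebraMap ℝ ℂ) =
        (q.map (algebraMap ℝ ℂ)).comp (Polynomial.X + Polynomial.C (t : ℂ)) := by
      rw [Polynomial.taylor_apply, Polynomial.map_comp]
      simp
    rw [h2, h1, Polynomial.mul_comp, Polynomial.C_comp, Polynomial.multiset_prod_comp,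
      Multiset.map_map, Multiset.map_map]
    congr 3
    funext τ
    simp
    ring
  set N := ‖(((R.map fun τ => (t : ℂ) - τ).map
    fun w => Polynomial.X + Polynomial.C w).prod).coeff j‖ with hN
  set V := (R.map fun τ => ‖(t : ℂ) - τ‖).prod with hV
  have hV0 : 0 ≤ V := Multiset.prod_nonneg fun x hx => by
    obtain ⟨w, -, rfl⟩ := Multiset.mem_map.1 hx
    exact norm_nonneg _
  have hcoeff : ‖(t : ℂ) - τ‖ ^ j * N ≤ q.natDegree.choose j * V := by
    have h := norm_coeff_prod_X_add_C_le hr (R.map fun τ => (t : ℂ) - τ) (by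
      intro w hw
      obtain ⟨τ', hτ', rfl⟩ := Multiset.mem_map.1 hw
      exact hmin τ' (Multiset.mem_toFinset.2 hτ')) j
    rw [Multiset.card_map, hcardq, Multiset.map_map (fun w => ‖w‖)] at h
    exact h
  have hnorm : |(Polynomial.taylor t q).coeff j| = |q.leadingCoeff| * N := by
    have h := congrArg (fun p => ‖p.coeff j‖) htay
    simp only [Polynomial.coeff_map, Polynomial.coeff_C_mul, norm_mul, Complex.norm_real,
      Complex.coe_algebraMap, Real.norm_eq_abs] at h
    exact h
  have hbound : ‖(t : ℂ) - τ‖ ^ j * |(Polynomial.taylor t q).coeff j| ≤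
      d.choose j * |q.eval t| := by
    rw [hnorm, hev]
    calc _ = |q.leadingCoeff| * (‖(t : ℂ) - τ‖ ^ j * N) := by ring
      _ ≤ |q.leadingCoeff| * (q.natDegree.choose j * V) := by gcongr
      _ ≤ |q.leadingCoeff| * (d.choose j * V) := by
        gcongr
      _ = _ := by ring
  have hch : (0 : ℝ) < d.choose j := by exact_mod_cast Nat.choose_pos hjd
  have hmain : (j : ℝ)⁻¹ * Real.log (ε ^ j * |(Polynomial.taylor t q).coeff j| /
      (d.choose j * |q.eval t|)) ≤ Real.log (ε / ‖(t : ℂ) - τ‖) := by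
    have hj0 : (0 : ℝ) < j := by exact_mod_cast hj1
    rw [inv_mul_le_iff₀ hj0, ← Real.log_pow]
    have h1 := abs_pos.2 hcj
    have h2 := abs_pos.2 ht0
    apply Real.log_le_log (by positivity)
    rw [div_pow, div_le_div_iff₀ (by positivity) (by positivity)]
    calc _ = ε ^ j * (‖(t : ℂ) - τ‖ ^ j * |(Polynomial.taylor t q).coeff j|) := by ring
      _ ≤ _ := by gcongr
  refine (ENNReal.ofReal_le_ofReal hmain).trans ?_
  exact Multiset.le_sum_of_mem (Multiset.mem_map_of_mem
    (fun τ => ENNReal.ofReal (Real.log (ε / ‖(t : ℂ) - τ‖))) hτ)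

lemma lintegral_coeffLog_taylor_le {ε : ℝ} (hε : 0 < ε) {d : ℕ} (q : Polynomial ℝ)
    (hq : q.natDegree ≤ d) :
    ∫⁻ t : ℝ, coeffLog d ε (Polynomial.taylor t q) ≤ d * ENNReal.ofReal (2 * ε) := by
  refine (lintegral_mono (coeffLog_taylor_le hε q hq)).trans
    ((lintegral_multiset_log_le hε _).trans ?_)
  gcongr
  exact (Polynomial.card_roots' _).trans (by rwa [Polynomial.natDegree_map])

/-- The univariate polynomial `t ↦ P (z + t v)`. -/
noncomputable def lineRestrict {m : ℕ} (P : MvPolynomial (Fin m) ℝ)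
    (z v : EuclideanSpace ℝ (Fin m)) : Polynomial ℝ :=
  MvPolynomial.aeval (fun i => Polynomial.C (z i) + Polynomial.C (v i) * Polynomial.X) P

section lineRestrict

variable {m : ℕ} (P : MvPolynomial (Fin m) ℝ)

lemma eval_lineRestrict (z v : EuclideanSpace ℝ (Fin m)) (t : ℝ) :
    (lineRestrict P z v).eval t = MvPolynomial.eval (fun i => (z + t • v) i) P := by
  unfold lineRestrict
  induction P using MvPolynomial.induction_on with
  | C c => simp
  | add p q hp hq => simp only [map_add, Polynomial.eval_add, hp, hq]
  | mul_X p i hp =>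
    simp only [map_mul, Polynomial.eval_mul, hp, MvPolynomial.aeval_X, MvPolynomial.eval_X]
    simp
    left
    ring

lemma natDegree_lineRestrict_le (z v : EuclideanSpace ℝ (Fin m)) {d : ℕ} (hP : P.totalDegree ≤ d) :
    (lineRestrict P z v).natDegree ≤ d := by
  have := MvPolynomial.aeval_natDegree_le P hP
    (fun i => Polynomial.C (z i) + Polynomial.C (v i) * Polynomial.X) (n := 1) (fun i => by
      compute_degree)
  rwa [mul_one] at this

lemma taylor_lineRestrict (z v : EuclideanSpace ℝ (Fin m)) (s : ℝ) :
    Polynomial.taylor s (lineRestrict P z v) = lineRestrict P (z + s • v) v := by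
  refine Polynomial.funext fun t => ?_
  rw [Polynomial.taylor_eval, eval_lineRestrict, eval_lineRestrict]
  congr 2
  funext i
  simp
  ring

lemma coeff_zero_lineRestrict (z v : EuclideanSpace ℝ (Fin m)) :
    (lineRestrict P z v).coeff 0 = MvPolynomial.eval (fun i => z i) P := by
  rw [Polynomial.coeff_zero_eq_eval_zero, eval_lineRestrict]
  simp

lemma coeff_lineRestrict_smul (z v : EuclideanSpace ℝ (Fin m)) (c : ℝ) (j : ℕ) :
    (lineRestrict P z (c • v)).coeff j = c ^ j * (lineRestrict P z v).coeff j := by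
  have : lineRestrict P z (c • v) = (lineRestrict P z v).comp (Polynomial.C c * Polynomial.X) := by
    refine Polynomial.funext fun t => ?_
    rw [Polynomial.eval_comp, eval_lineRestrict, eval_lineRestrict]
    congr 2
    funext i
    simp
    ring
  rw [this, Polynomial.comp_C_mul_X_coeff, mul_comm]

lemma continuous_coeff_lineRestrict (j : ℕ) :
    Continuous fun p : EuclideanSpace ℝ (Fin m) × EuclideanSpace ℝ (Fin m) =>
      (lineRestrict P p.1 p.2).coeff j := by
  unfold lineRestrict
  induction P using MvPolynomial.induction_on generalizing j with
  | C c => simpa using continuous_const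
  | add p q hp hq =>
    simp only [map_add, Polynomial.coeff_add]
    exact (hp j).add (hq j)
  | mul_X p i hp =>
    simp only [map_mul, MvPolynomial.aeval_X, mul_add, Polynomial.coeff_add,
      Polynomial.coeff_mul_C, ← mul_assoc]
    have h1 : Continuous fun p : EuclideanSpace ℝ (Fin m) × EuclideanSpace ℝ (Fin m) => p.1 i := by
      fun_prop
    have h2 : Continuous fun p : EuclideanSpace ℝ (Fin m) × EuclideanSpace ℝ (Fin m) => p.2 i := by
      fun_prop
    rcases j with _ | j
    · simp only [Polynomial.mul_coeff_zero, Polynomial.coeff_X_zero, mul_zero, add_zero]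
      exact (hp 0).mul h1
    · simp only [Polynomial.coeff_mul_X, Polynomial.coeff_mul_C]
      exact ((hp (j + 1)).mul h1).add ((hp j).mul h2)

lemma exists_polynomial_coeff_lineRestrict_add_smul (z v u : EuclideanSpace ℝ (Fin m)) (j : ℕ) :
    ∃ Q : Polynomial ℝ, Q.natDegree ≤ j ∧ Q.coeff j = (lineRestrict P z u).coeff j ∧
      ∀ s : ℝ, Q.eval s = (lineRestrict P z (v + s • u)).coeff j := by
  unfold lineRestrict
  induction P using MvPolynomial.induction_on generalizing j with
  | C c =>
    rcases j with _ | j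
    · exact ⟨Polynomial.C c, by simp, by simp, by simp⟩
    · exact ⟨0, by simp, by simp, by simp⟩
  | add p q hp hq =>
    obtain ⟨Q₁, h1, h2, h3⟩ := hp j
    obtain ⟨Q₂, h1', h2', h3'⟩ := hq j
    exact ⟨Q₁ + Q₂, Polynomial.natDegree_add_le_of_degree_le h1 h1', by simp [h2, h2'],
      fun s => by simp [h3, h3']⟩
  | mul_X p i hp =>
    obtain ⟨Q₁, h1, h2, h3⟩ := hp j
    simp only [map_mul, MvPolynomial.aeval_X, mul_add, Polynomial.coeff_add,
      Polynomial.coeff_mul_C, ← mul_assoc]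
    rcases j with _ | j
    · refine ⟨Q₁ * Polynomial.C (z i), ?_, by simp [h2], fun s => by simp [h3]⟩
      exact (Polynomial.natDegree_mul_C_le _ _).trans h1
    · obtain ⟨Q₂, h1', h2', h3'⟩ := hp j
      refine ⟨Q₁ * Polynomial.C (z i) +
        Q₂ * (Polynomial.C (v i) + Polynomial.C (u i) * Polynomial.X), ?_, ?_, fun s => ?_⟩
      · refine Polynomial.natDegree_add_le_of_degree_le
          ((Polynomial.natDegree_mul_C_le _ _).trans h1) ?_
        exact Polynomial.natDegree_mul_le_of_le h1' (by compute_degree)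
      · have h4 : Q₂.coeff (j + 1) = 0 := Polynomial.coeff_eq_zero_of_natDegree_lt (by omega)
        simp [mul_add, ← mul_assoc, h2, h2', h4]
      · have hi : (v + s • u) i = v i + s * u i := by simp
        simp only [Polynomial.coeff_mul_X, Polynomial.coeff_mul_C, ← h3, ← h3', hi,
          Polynomial.eval_add, Polynomial.eval_mul, Polynomial.eval_C, Polynomial.eval_X]
        ring

end lineRestrict

section Gaussian

open ProbabilityTheory

variable {m : ℕ}

lemma map_stdGaussian_prod_gaussianReal {u : EuclideanSpace ℝ (Fin m)} (hu : ‖u‖ = 1) :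
    ((stdGaussian (EuclideanSpace ℝ (Fin m))).prod (gaussianReal 0 1)).map
      (fun p => p.1 - ⟪u, p.1⟫ • u + p.2 • u) = stdGaussian (EuclideanSpace ℝ (Fin m)) := by
  have hmeas : Measurable fun p : EuclideanSpace ℝ (Fin m) × ℝ =>
      p.1 - ⟪u, p.1⟫ • u + p.2 • u := by fun_prop
  have := Measure.isProbabilityMeasure_map (μ := (stdGaussian (EuclideanSpace ℝ (Fin m))).prod
    (gaussianReal 0 1)) hmeas.aemeasurable
  apply Measure.ext_of_charFun
  funext y
  rw [charFun_apply, integral_map hmeas.aemeasurable (by fun_prop)]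
  have hsplit : ∀ p : EuclideanSpace ℝ (Fin m) × ℝ,
      Complex.exp ((⟪p.1 - ⟪u, p.1⟫ • u + p.2 • u, y⟫ : ℝ) * Complex.I) =
        Complex.exp ((⟪p.1, y - ⟪u, y⟫ • u⟫ : ℝ) * Complex.I) *
          Complex.exp ((⟪p.2, ⟪u, y⟫⟫ : ℝ) * Complex.I) := by
    intro p
    rw [← Complex.exp_add, ← add_mul, ← Complex.ofReal_add]
    congr 3
    simp only [inner_add_left, inner_sub_left, inner_sub_right, real_inner_smul_left,
      real_inner_smul_right, real_inner_comm u p.1]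
    simp
    ring
  simp_rw [hsplit]
  rw [integral_prod_mul (fun x : EuclideanSpace ℝ (Fin m) =>
    Complex.exp ((⟪x, y - ⟪u, y⟫ • u⟫ : ℝ) * Complex.I))
    (fun t : ℝ => Complex.exp ((⟪t, ⟪u, y⟫⟫ : ℝ) * Complex.I)), ← charFun_apply, ← charFun_apply,
    charFun_stdGaussian, charFun_stdGaussian, charFun_gaussianReal, ← Complex.exp_add]
  congr 1
  have h1 : ‖y - ⟪u, y⟫ • u‖ ^ 2 = ‖y‖ ^ 2 - ⟪u, y⟫ ^ 2 := by
    rw [norm_sub_sq_real, norm_smul, hu, real_inner_smul_right, real_inner_comm]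
    simp
    ring
  rw [← Complex.ofReal_pow, h1]
  push_cast
  ring

lemma lintegral_gaussianReal_le (f : ℝ → ENNReal) :
    ∫⁻ t, f t ∂(gaussianReal 0 1) ≤ ENNReal.ofReal (√(2 * Real.pi))⁻¹ * ∫⁻ t, f t := by
  rw [gaussianReal_of_var_ne_zero 0 one_ne_zero,
    lintegral_withDensity_eq_lintegral_mul_non_measurable₀ _
      (measurable_gaussianPDF 0 1).aemeasurable
      (Filter.Eventually.of_forall fun x => by simp [gaussianPDF]),
    ← lintegral_const_mul' _ _ ENNReal.ofReal_ne_top]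
  refine lintegral_mono fun t => ?_
  simp only [Pi.mul_apply]
  gcongr
  rw [gaussianPDF, gaussianPDFReal]
  apply ENNReal.ofReal_le_ofReal
  have : Real.exp (-(t - 0) ^ 2 / (2 * ((1 : NNReal) : ℝ))) ≤ 1 :=
    Real.exp_le_one_iff.2
      (div_nonpos_of_nonpos_of_nonneg (neg_nonpos.2 (sq_nonneg _)) (by positivity))
  calc _ ≤ (√(2 * Real.pi * ((1 : NNReal) : ℝ)))⁻¹ * 1 := by gcongr
    _ = _ := by simp

lemma lintegral_stdGaussian_le {u : EuclideanSpace ℝ (Fin m)} (hu : ‖u‖ = 1)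
    {h : EuclideanSpace ℝ (Fin m) → ENNReal} (hh : Measurable h) {c : ENNReal}
    (hc : ∀ v, ∫⁻ t : ℝ, h (v + t • u) ≤ c) :
    ∫⁻ v, h v ∂(stdGaussian (EuclideanSpace ℝ (Fin m))) ≤
      ENNReal.ofReal (√(2 * Real.pi))⁻¹ * c := by
  have hmeas : Measurable fun p : EuclideanSpace ℝ (Fin m) × ℝ =>
      p.1 - ⟪u, p.1⟫ • u + p.2 • u := by fun_prop
  nth_rw 1 [← map_stdGaussian_prod_gaussianReal hu]
  rw [lintegral_map hh hmeas]
  refine (lintegral_prod_le _).trans ?_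
  calc _ ≤ ∫⁻ _ : EuclideanSpace ℝ (Fin m), ENNReal.ofReal (√(2 * Real.pi))⁻¹ * c
        ∂(stdGaussian (EuclideanSpace ℝ (Fin m))) := by
        refine lintegral_mono fun v => (lintegral_gaussianReal_le _).trans ?_
        gcongr
        exact hc (v - ⟪u, v⟫ • u)
    _ = _ := by simp

lemma lintegral_norm_stdGaussian_le (hm : 0 < m) :
    ∫⁻ v, ENNReal.ofReal ‖v‖ ∂(stdGaussian (EuclideanSpace ℝ (Fin m))) ≤
      ENNReal.ofReal (√m) := by
  set γ := stdGaussian (EuclideanSpace ℝ (Fin m))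
  have hcoord : ∀ i : Fin m, ∫⁻ v, ENNReal.ofReal (v i ^ 2) ∂γ = 1 := by
    intro i
    set L : StrongDual ℝ (EuclideanSpace ℝ (Fin m)) := EuclideanSpace.proj i with hL
    have hmem : MemLp L 2 γ := IsGaussian.memLp_dual γ L 2 (by simp)
    have h1 := variance_dual_stdGaussian L
    have h2 : ‖L‖ = 1 := by
      have : L = innerSL ℝ (EuclideanSpace.single i (1 : ℝ)) := by
        ext v
        simp [hL, EuclideanSpace.inner_single_left]
      rw [this, innerSL_apply_norm]
      simp
    rw [variance_eq_integral hmem.aestronglyMeasurable.aemeasurable,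
      integral_strongDual_stdGaussian, h2] at h1
    rw [← ofReal_integral_eq_lintegral_ofReal]
    · simp only [sub_zero] at h1
      have h3 : ∫ v, v i ^ 2 ∂γ = 1 := by simpa [hL] using h1
      rw [h3, ENNReal.ofReal_one]
    · exact hmem.integrable_sq
    · exact Filter.Eventually.of_forall fun v => by positivity
  have hm' : (0 : ℝ) < √m := Real.sqrt_pos.2 (by exact_mod_cast hm)
  have hpt : ∀ v : EuclideanSpace ℝ (Fin m), ENNReal.ofReal ‖v‖ ≤
      ENNReal.ofReal (√m / 2) + ENNReal.ofReal (2 * √m)⁻¹ * ∑ i, ENNReal.ofReal (v i ^ 2) := by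
    intro v
    rw [← ENNReal.ofReal_sum_of_nonneg (fun i _ => by positivity),
      ← ENNReal.ofReal_mul (by positivity), ← ENNReal.ofReal_add (by positivity) (by positivity)]
    apply ENNReal.ofReal_le_ofReal
    have h4 : ∑ i, v i ^ 2 = ‖v‖ ^ 2 := by
      rw [EuclideanSpace.norm_sq_eq]
      simp
    rw [h4]
    have h5 : √m / 2 + (2 * √m)⁻¹ * ‖v‖ ^ 2 - ‖v‖ = (√m - ‖v‖) ^ 2 / (2 * √m) := by
      field_simp
      ring
    have : 0 ≤ (√m - ‖v‖) ^ 2 / (2 * √m) := by positivity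
    linarith
  refine (lintegral_mono hpt).trans ?_
  rw [lintegral_add_left (by fun_prop), lintegral_const_mul _ (by fun_prop),
    lintegral_finsetSum _ (fun i _ => by fun_prop)]
  simp only [hcoord]
  simp only [lintegral_const, measure_univ, mul_one, Finset.sum_const, Finset.card_univ,
    Fintype.card_fin, nsmul_eq_mul]
  rw [← ENNReal.ofReal_natCast m, ← ENNReal.ofReal_mul (by positivity),
    ← ENNReal.ofReal_add (by positivity) (by positivity)]
  apply ENNReal.ofReal_le_ofReal
  have h6 : (m : ℝ) = √m * √m := (Real.mul_self_sqrt (by positivity)).symm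
  have h7 : (2 * √m)⁻¹ * (m : ℝ) = √m / 2 := by
    nth_rw 2 [h6]
    field_simp
  rw [h7]
  linarith

end Gaussian

lemma setLIntegral_le_of_convex {E : Type*} [NormedAddCommGroup E] [NormedSpace ℝ E]
    [FiniteDimensional ℝ E] [MeasurableSpace E] [BorelSpace E] (μ : Measure E)
    [μ.IsAddHaarMeasure] {K : Set E} (hK : Convex ℝ K) (hKm : MeasurableSet K) {c : E} {ρ : ℝ}
    (hρ : 0 < ρ) (hball : Metric.ball c ρ ⊆ K) (hE : 0 < Module.finrank ℝ E)
    {v : E} (hv : v ≠ 0) {h : E → ENNReal} (hh : Measurable h) {C : ENNReal}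
    (hC : ∀ z, ∫⁻ t : ℝ, h (z + t • v) ≤ C) :
    ∫⁻ z in K, h z ∂μ ≤
      ENNReal.ofReal (Real.exp 1 * Module.finrank ℝ E * ‖v‖ / (2 * ρ)) * C * μ K := by
  set m := Module.finrank ℝ E
  have hm : (0 : ℝ) < m := by exact_mod_cast hE
  have hv0 : 0 < ‖v‖ := norm_pos_iff.2 hv
  set s : ℝ := ρ / (m * ‖v‖) with hs
  have hs0 : 0 < s := by positivity
  set g := K.indicator h
  have hg : Measurable g := hh.indicator hKm
  set K' := AffineMap.homothety c (1 + (m : ℝ)⁻¹) '' K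
  have hmem : ∀ z : E, ∀ t ∈ Set.Ioo (-s) s, z + t • v ∈ K → z ∈ K' := by
    intro z t ht hz
    have hb : c - (t * m) • v ∈ K := by
      apply hball
      rw [mem_ball_iff_norm, sub_sub_cancel_left, norm_neg, norm_smul, Real.norm_eq_abs, abs_mul,
        abs_of_pos hm, mul_assoc]
      calc |t| * (m * ‖v‖) < s * (m * ‖v‖) := by
            gcongr
            exact abs_lt.2 ht
        _ = ρ := by rw [hs]; field_simp
    refine ⟨_, hK hz hb (a := m / (m + 1)) (b := 1 / (m + 1)) (by positivity) (by positivity)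
      (by field_simp), ?_⟩
    rw [AffineMap.homothety_apply, vsub_eq_sub, vadd_eq_add]
    match_scalars <;> field_simp <;> ring
  have hvol : μ K' ≤ ENNReal.ofReal (Real.exp 1) * μ K := by
    rw [Measure.addHaar_image_homothety]
    gcongr
    rw [abs_of_nonneg (by positivity)]
    calc (1 + (m : ℝ)⁻¹) ^ m ≤ (Real.exp (m : ℝ)⁻¹) ^ m := by
          gcongr
          rw [add_comm]
          exact Real.add_one_le_exp _
      _ = Real.exp 1 := by
          rw [← Real.exp_nat_mul, mul_inv_cancel₀ hm.ne']
  have hmeas2 : Measurable fun p : ℝ × E => g (p.2 + p.1 • v) := hg.comp (by fun_prop)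
  have key : ENNReal.ofReal (2 * s) * ∫⁻ z in K, h z ∂μ ≤
      C * (ENNReal.ofReal (Real.exp 1) * μ K) := by
    calc ENNReal.ofReal (2 * s) * ∫⁻ z in K, h z ∂μ
        = ∫⁻ (_ : ℝ) in Set.Ioo (-s) s, ∫⁻ z, g z ∂μ := by
          rw [lintegral_const, lintegral_indicator hKm, mul_comm, Measure.restrict_apply_univ,
            Real.volume_Ioo]
          congr 2
          ring
      _ = ∫⁻ (t : ℝ) in Set.Ioo (-s) s, ∫⁻ z, g (z + t • v) ∂μ := by
          refine lintegral_congr fun t => ?_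
          exact (lintegral_add_right_eq_self g (t • v)).symm
      _ = ∫⁻ z, (∫⁻ (t : ℝ) in Set.Ioo (-s) s, g (z + t • v)) ∂μ :=
          lintegral_lintegral_swap hmeas2.aemeasurable
      _ ≤ ∫⁻ z, K'.indicator (fun _ => C) z ∂μ := by
          refine lintegral_mono fun z => ?_
          by_cases hz : z ∈ K'
          · rw [Set.indicator_of_mem hz]
            refine (setLIntegral_le_lintegral _ _).trans ((lintegral_mono fun t => ?_).trans (hC z))
            exact Set.indicator_le_self _ _ _
          · rw [Set.indicator_of_notMem hz]
            refine le_of_eq (setLIntegral_eq_zero measurableSet_Ioo fun t ht => ?_)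
            exact Set.indicator_of_notMem (fun hzt => hz (hmem z t ht hzt)) _
      _ ≤ C * μ K' := lintegral_indicator_const_le _ _
      _ ≤ _ := by gcongr
  have h2s : ENNReal.ofReal (2 * s) ≠ 0 := by simpa using hs0
  calc ∫⁻ z in K, h z ∂μ
      = (ENNReal.ofReal (2 * s))⁻¹ * (ENNReal.ofReal (2 * s) * ∫⁻ z in K, h z ∂μ) := by
        rw [← mul_assoc, ENNReal.inv_mul_cancel h2s ENNReal.ofReal_ne_top, one_mul]
    _ ≤ (ENNReal.ofReal (2 * s))⁻¹ * (C * (ENNReal.ofReal (Real.exp 1) * μ K)) := by gcongr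
    _ = (ENNReal.ofReal (2 * s))⁻¹ * ENNReal.ofReal (Real.exp 1) * C * μ K := by ring
    _ = _ := by
        rw [← ENNReal.ofReal_inv_of_pos (by positivity), ← ENNReal.ofReal_mul (by positivity)]
        congr 3
        rw [hs]
        field_simp

/-- Two finite measures on the unit sphere which are invariant under linear isometries agree up to
normalization. -/
lemma smul_eq_smul_of_isometry_invariant {E : Type*} [NormedAddCommGroup E]
    [InnerProductSpace ℝ E] [CompleteSpace E] [SecondCountableTopology E] [MeasurableSpace E]
    [BorelSpace E] (μ ν : Measure E) [IsFiniteMeasure μ] [IsFiniteMeasure ν]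
    (hμs : ∀ᵐ x ∂μ, ‖x‖ = 1) (hνs : ∀ᵐ x ∂ν, ‖x‖ = 1)
    (hμ : ∀ g : E ≃ₗᵢ[ℝ] E, μ.map g = μ) (hν : ∀ g : E ≃ₗᵢ[ℝ] E, ν.map g = ν) :
    ν Set.univ • μ = μ Set.univ • ν := by
  have hinv : ∀ (η : Measure E), (∀ g : E ≃ₗᵢ[ℝ] E, η.map g = η) → ∀ s t : E, ‖s‖ = ‖t‖ →
      charFun η s = charFun η t := by
    intro η hη s t hst
    set g : E ≃ₗᵢ[ℝ] E := (Submodule.span ℝ {s - t})ᗮ.reflection with hg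
    have hgs : g s = t := Submodule.reflection_sub hst
    nth_rw 2 [← hη g]
    rw [charFun_apply, charFun_apply, integral_map g.continuous.aemeasurable (by fun_prop), ← hgs]
    simp only [LinearIsometryEquiv.inner_map_map]
  have hInt : ∀ (η κ : Measure E) [IsFiniteMeasure η] [IsFiniteMeasure κ],
      (∀ᵐ x ∂κ, ‖x‖ = 1) → (∀ g : E ≃ₗᵢ[ℝ] E, η.map g = η) → ∀ t : E,
      ∫ θ, ∫ x, Complex.exp ((‖t‖ * ⟪x, θ⟫ : ℝ) * Complex.I) ∂η ∂κ =
        (κ.real Set.univ : ℂ) * charFun η t := by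
    intro η κ _ _ hκ hη t
    rw [integral_congr_ae (g := fun _ => charFun η t)]
    · simp
    · filter_upwards [hκ] with θ hθ
      rw [hinv η hη t (‖t‖ • θ) (by rw [norm_smul, hθ]; simp), charFun_apply]
      simp only [real_inner_smul_right]
  have hswap : ∀ t : E, (ν.real Set.univ : ℂ) * charFun μ t =
      (μ.real Set.univ : ℂ) * charFun ν t := by
    intro t
    rw [← hInt μ ν hνs hμ t, ← hInt ν μ hμs hν t, integral_integral_swap]
    · simp only [real_inner_comm]
    · refine Integrable.of_bound (C := 1) (by fun_prop) (Filter.Eventually.of_forall fun p => ?_)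
      rw [Function.uncurry, Complex.norm_exp_ofReal_mul_I]
  have hfin : ∀ (η κ : Measure E) [IsFiniteMeasure η] [IsFiniteMeasure κ],
      IsFiniteMeasure (κ Set.univ • η) := by
    intro η κ _ _
    exact Measure.smul_finite _ (measure_ne_top _ _)
  have := hfin μ ν
  have := hfin ν μ
  apply Measure.ext_of_charFun
  funext t
  have := hswap t
  rw [charFun_apply, charFun_apply] at this ⊢
  rw [integral_smul_measure, integral_smul_measure]
  simpa [Measure.real] using this

lemma volume_setOf_eval_eq_zero {Q : Polynomial ℝ} (hQ : Q ≠ 0) :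
    volume {t : ℝ | Q.eval t = 0} = 0 := by
  refine Set.Finite.measure_zero (Q.roots.toFinset.finite_toSet.subset fun t ht => ?_) _
  simpa [hQ] using ht

lemma exists_le_abs_coeff {d : ℕ} (hd : 1 ≤ d) {q : Polynomial ℝ} (hq : q.natDegree ≤ d)
    (h1 : q.eval 1 = 0) (h0 : q.coeff 0 ≠ 0) :
    ∃ j ∈ Finset.Icc 1 d,
      d.choose j * (Real.log 2 / d) ^ j * |q.coeff 0| ≤ |q.coeff j| := by
  by_contra! hlt
  set x := Real.log 2 / d with hx
  have hd0 : (0 : ℝ) < d := by exact_mod_cast hd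
  have hsum : q.coeff 0 = -∑ j ∈ Finset.range d, q.coeff (j + 1) := by
    rw [Polynomial.eval_eq_sum_range' (Nat.lt_succ_of_le hq), Finset.sum_range_succ'] at h1
    simp only [one_pow, mul_one] at h1
    linarith
  have hbin : ∑ j ∈ Finset.range d, (d.choose (j + 1) : ℝ) * x ^ (j + 1) ≤ 1 := by
    have h2 := add_pow x 1 d
    rw [Finset.sum_range_succ'] at h2
    simp only [one_pow, mul_one, pow_zero, Nat.choose_zero_right, Nat.cast_one] at h2
    have h3 : (x + 1) ^ d ≤ 2 := by
      calc (x + 1) ^ d ≤ (Real.exp x) ^ d := by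
            have : 0 ≤ x := div_nonneg (Real.log_nonneg (by norm_num)) hd0.le
            gcongr
            exact Real.add_one_le_exp x
        _ = 2 := by
            rw [← Real.exp_nat_mul, hx, mul_div_cancel₀ _ hd0.ne', Real.exp_log (by norm_num)]
    have h4 : ∑ j ∈ Finset.range d, (d.choose (j + 1) : ℝ) * x ^ (j + 1) =
        ∑ j ∈ Finset.range d, x ^ (j + 1) * (d.choose (j + 1) : ℝ) :=
      Finset.sum_congr rfl fun j _ => mul_comm _ _
    linarith
  have habs : |q.coeff 0| < |q.coeff 0| := by
    calc |q.coeff 0| ≤ ∑ j ∈ Finset.range d, |q.coeff (j + 1)| := by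
          nth_rw 1 [hsum]
          rw [abs_neg]
          exact Finset.abs_sum_le_sum_abs _ _
      _ < ∑ j ∈ Finset.range d, (d.choose (j + 1) : ℝ) * x ^ (j + 1) * |q.coeff 0| := by
          refine Finset.sum_lt_sum_of_nonempty (by simpa using by omega) fun j hj => hlt _ ?_
          have := Finset.mem_range.1 hj
          exact Finset.mem_Icc.2 ⟨by omega, by omega⟩
      _ ≤ 1 * |q.coeff 0| := by
          rw [← Finset.sum_mul]
          gcongr
      _ = _ := one_mul _
  exact habs.false

lemma mul_log_add_log_div_le {ε x δ A B c b : ℝ} {j : ℕ} (hε : 0 < ε) (hx : 0 < x) (hδ : 0 < δ)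
    (hA : 0 < A) (hB : 0 < B) (hc : 0 < c) (hb : 0 < b) (h : c * x ^ j * b ≤ δ ^ j * B) :
    j * (Real.log ε + Real.log x - Real.log δ) + Real.log (A / B) ≤
      Real.log (ε ^ j * A / (c * b)) := by
  rw [← Real.log_mul hε.ne' hx.ne', ← Real.log_div (by positivity) hδ.ne', ← Real.log_pow,
    ← Real.log_mul (by positivity) (by positivity)]
  apply Real.log_le_log (by positivity)
  rw [div_pow, mul_pow, div_mul_div_comm, div_le_div_iff₀ (by positivity) (by positivity)]
  calc _ = ε ^ j * A * (c * x ^ j * b) := by ring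
    _ ≤ ε ^ j * A * (δ ^ j * B) := by gcongr
    _ = _ := by ring

section GaussianDirection

open ProbabilityTheory

variable {m : ℕ} (P : MvPolynomial (Fin m) ℝ)

lemma measurable_coeffLog_lineRestrict (d : ℕ) (ε : ℝ) :
    Measurable fun p : EuclideanSpace ℝ (Fin m) × EuclideanSpace ℝ (Fin m) =>
      coeffLog d ε (lineRestrict P p.1 p.2) := by
  unfold coeffLog
  have h : ∀ j, Measurable fun p : EuclideanSpace ℝ (Fin m) × EuclideanSpace ℝ (Fin m) =>
      (lineRestrict P p.1 p.2).coeff j := fun j => (continuous_coeff_lineRestrict P j).measurable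
  have habs : ∀ j, Measurable fun p : EuclideanSpace ℝ (Fin m) × EuclideanSpace ℝ (Fin m) =>
      |(lineRestrict P p.1 p.2).coeff j| := fun j => measurable_norm.comp (h j)
  refine Measurable.iSup fun j => Measurable.iSup fun _ => ?_
  exact ((Real.measurable_log.comp (((habs j).const_mul _).div
    ((habs 0).const_mul _))).const_mul _).ennreal_ofReal

lemma measurable_coeff_lineRestrict (z : EuclideanSpace ℝ (Fin m)) (j : ℕ) :
    Measurable fun v => (lineRestrict P z v).coeff j :=
  ((continuous_coeff_lineRestrict P j).comp (by fun_prop : Continuous fun v => (z, v))).measurable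

variable {P} {z u : EuclideanSpace ℝ (Fin m)} {j : ℕ}

lemma ae_coeff_lineRestrict_ne_zero (hu : ‖u‖ = 1) (hc : (lineRestrict P z u).coeff j ≠ 0) :
    ∀ᵐ v ∂(stdGaussian (EuclideanSpace ℝ (Fin m))), (lineRestrict P z v).coeff j ≠ 0 := by
  have hs : MeasurableSet {v : EuclideanSpace ℝ (Fin m) | (lineRestrict P z v).coeff j = 0} :=
    measurable_coeff_lineRestrict P z j (measurableSet_singleton 0)
  have h := lintegral_stdGaussian_le hu (measurable_const.indicator hs (f := fun _ => 1)) (c := 0)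
    fun v => ?_
  · rw [lintegral_indicator_const hs, one_mul, mul_zero] at h
    rw [ae_iff]
    simpa using h
  · obtain ⟨Q, -, h2, h3⟩ := exists_polynomial_coeff_lineRestrict_add_smul P z v u j
    have hQ : Q ≠ 0 := by
      rintro rfl
      exact hc (by simpa using h2.symm)
    rw [nonpos_iff_eq_zero]
    refine lintegral_eq_zero_of_ae_eq_zero ?_
    filter_upwards [measure_eq_zero_iff_ae_notMem.1 (volume_setOf_eval_eq_zero hQ)] with t ht
    refine Set.indicator_of_notMem (fun h => ht ?_) _
    rw [h3]
    exact h

lemma lintegral_stdGaussian_log_coeff_le (hu : ‖u‖ = 1) (hj : 1 ≤ j)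
    (hc : (lineRestrict P z u).coeff j ≠ 0) :
    ∫⁻ v, ENNReal.ofReal (Real.log √(Real.pi / 2) - (j : ℝ)⁻¹ *
      Real.log (|(lineRestrict P z v).coeff j| / |(lineRestrict P z u).coeff j|))
        ∂(stdGaussian (EuclideanSpace ℝ (Fin m))) ≤ 1 := by
  have hj0 : (0 : ℝ) < j := by exact_mod_cast hj
  have hε : 0 < √(Real.pi / 2) := Real.sqrt_pos.2 (by positivity)
  have hmeas : Measurable fun v => ENNReal.ofReal (Real.log √(Real.pi / 2) - (j : ℝ)⁻¹ *
      Real.log (|(lineRestrict P z v).coeff j| / |(lineRestrict P z u).coeff j|)) := by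
    have := measurable_norm.comp (measurable_coeff_lineRestrict P z j)
    exact ((Real.measurable_log.comp (this.div_const _)).const_mul _).const_sub _ |>.ennreal_ofReal
  refine (lintegral_stdGaussian_le hu hmeas (c := ENNReal.ofReal (2 * √(Real.pi / 2)))
    fun v => ?_).trans ?_
  · obtain ⟨Q, h1, h2, h3⟩ := exists_polynomial_coeff_lineRestrict_add_smul P z v u j
    have h := lintegral_neg_log_eval_le hε Q j h1 (h2 ▸ hc)
    have hpt : ∀ t : ℝ, ENNReal.ofReal (Real.log √(Real.pi / 2) - (j : ℝ)⁻¹ *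
        Real.log (|(lineRestrict P z (v + t • u)).coeff j| / |(lineRestrict P z u).coeff j|)) =
        ENNReal.ofReal (j : ℝ)⁻¹ * ENNReal.ofReal (j * Real.log √(Real.pi / 2) -
          Real.log (|Q.eval t| / |Q.coeff j|)) := by
      intro t
      rw [← ENNReal.ofReal_mul (by positivity), h2, h3, mul_sub, inv_mul_cancel_left₀ hj0.ne']
    simp_rw [hpt]
    rw [lintegral_const_mul' _ _ ENNReal.ofReal_ne_top]
    calc _ ≤ ENNReal.ofReal (j : ℝ)⁻¹ * (j * ENNReal.ofReal (2 * √(Real.pi / 2))) := by gcongr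
      _ = _ := by
        rw [← ENNReal.ofReal_natCast j, ← mul_assoc, ← ENNReal.ofReal_mul (by positivity),
          inv_mul_cancel₀ hj0.ne', ENNReal.ofReal_one, one_mul]
  · rw [← ENNReal.ofReal_mul (by positivity), ← ENNReal.ofReal_one]
    apply ENNReal.ofReal_le_ofReal
    have h4 : √(2 * Real.pi) = 2 * √(Real.pi / 2) := by
      rw [show 2 * Real.pi = 2 ^ 2 * (Real.pi / 2) by ring, Real.sqrt_mul (by positivity),
        Real.sqrt_sq (by norm_num)]
    rw [h4, inv_mul_cancel₀ (by positivity)]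

lemma exists_direction_le_abs_coeff {d : ℕ} (hd : 1 ≤ d) (hP : P.totalDegree ≤ d)
    {S : Set (EuclideanSpace ℝ (Fin m))} (hSne : S.Nonempty) (hScl : IsClosed S)
    (hSP : ∀ x ∈ S, MvPolynomial.eval (fun i => x i) P = 0)
    (hz : MvPolynomial.eval (fun i => z i) P ≠ 0) :
    0 < Metric.infDist z S ∧ ∃ w : EuclideanSpace ℝ (Fin m), ‖w‖ = 1 ∧ ∃ j ∈ Finset.Icc 1 d,
      d.choose j * (Real.log 2 / d) ^ j * |MvPolynomial.eval (fun i => z i) P| ≤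
        Metric.infDist z S ^ j * |(lineRestrict P z w).coeff j| := by
  obtain ⟨x, hxS, hx⟩ := hScl.exists_infDist_eq_dist hSne z
  have hδ : Metric.infDist z S = ‖x - z‖ := by rw [hx, dist_comm, dist_eq_norm]
  rw [hδ]
  have hδ0 : 0 < ‖x - z‖ := by
    rw [norm_pos_iff, sub_ne_zero]
    rintro rfl
    exact hz (hSP x hxS)
  have hz0 : (lineRestrict P z (x - z)).coeff 0 ≠ 0 := by rwa [coeff_zero_lineRestrict]
  obtain ⟨j, hj, hle⟩ := exists_le_abs_coeff hd
    (natDegree_lineRestrict_le P z (x - z) hP)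
    (by rw [eval_lineRestrict, one_smul, add_sub_cancel]; exact hSP x hxS) hz0
  refine ⟨hδ0, ‖x - z‖⁻¹ • (x - z), ?_, j, hj, ?_⟩
  · rw [norm_smul, norm_inv, norm_norm, inv_mul_cancel₀ hδ0.ne']
  · rw [coeff_zero_lineRestrict] at hle
    rwa [coeff_lineRestrict_smul, abs_mul, abs_of_nonneg (a := ‖x - z‖⁻¹ ^ j) (by positivity),
      ← mul_assoc, ← mul_pow, mul_inv_cancel₀ hδ0.ne', one_pow, one_mul]

lemma ofReal_neg_log_le_coeffLog_add {d : ℕ} {q : Polynomial ℝ} {j : ℕ} (hj : j ∈ Finset.Icc 1 d)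
    {ε x δ B b e : ℝ} (hε : 0 < ε) (hx : 0 < x) (hδ : 0 < δ) (hB : 0 < B) (hb : 0 < b)
    (hq0 : |q.coeff 0| = b) (hq : q.coeff j ≠ 0)
    (h : d.choose j * x ^ j * b ≤ δ ^ j * B) :
    ENNReal.ofReal (-Real.log δ) ≤ coeffLog d ε q +
      ENNReal.ofReal (e - (j : ℝ)⁻¹ * Real.log (|q.coeff j| / B)) +
      ENNReal.ofReal (-Real.log ε - Real.log x - e) := by
  obtain ⟨hj1, hjd⟩ := Finset.mem_Icc.1 hj
  have hj0 : (0 : ℝ) < j := by exact_mod_cast hj1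
  have hch : (0 : ℝ) < d.choose j := by exact_mod_cast Nat.choose_pos hjd
  have h1 : ENNReal.ofReal ((j : ℝ)⁻¹ * Real.log (ε ^ j * |q.coeff j| /
      (d.choose j * |q.coeff 0|))) ≤ coeffLog d ε q :=
    le_iSup₂_of_le j hj le_rfl
  rw [hq0] at h1
  have h2 := mul_log_add_log_div_le hε hx hδ (abs_pos.2 hq) hB hch hb h
  have h3 := mul_le_mul_of_nonneg_left h2 (inv_nonneg.2 hj0.le)
  rw [mul_add, inv_mul_cancel_left₀ hj0.ne'] at h3
  refine le_trans ?_ (add_le_add_left (add_le_add_left h1 _) _)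
  refine le_trans (ENNReal.ofReal_le_ofReal ?_)
    (ENNReal.ofReal_add_le.trans (add_le_add_left ENNReal.ofReal_add_le _))
  linarith

lemma neg_log_infDist_le {d : ℕ} (hd : 1 ≤ d) (hP : P.totalDegree ≤ d)
    {S : Set (EuclideanSpace ℝ (Fin m))} (hSne : S.Nonempty) (hScl : IsClosed S)
    (hSP : ∀ x ∈ S, MvPolynomial.eval (fun i => x i) P = 0) {ε : ℝ} (hε : 0 < ε)
    (hz : MvPolynomial.eval (fun i => z i) P ≠ 0) :
    ENNReal.ofReal (-Real.log (Metric.infDist z S)) ≤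
      ∫⁻ v, coeffLog d ε (lineRestrict P z v) ∂(stdGaussian (EuclideanSpace ℝ (Fin m))) + 1 +
        ENNReal.ofReal (-Real.log ε - Real.log (Real.log 2 / d) - Real.log √(Real.pi / 2)) := by
  obtain ⟨hδ, w, hw, j, hj, hle⟩ := exists_direction_le_abs_coeff hd hP hSne hScl hSP hz
  generalize Metric.infDist z S = δ at *
  obtain ⟨hj1, hjd⟩ := Finset.mem_Icc.1 hj
  have hd0 : (0 : ℝ) < d := by exact_mod_cast hd
  have hch : (0 : ℝ) < d.choose j := by exact_mod_cast Nat.choose_pos hjd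
  have hx : 0 < Real.log 2 / d := div_pos (Real.log_pos (by norm_num)) hd0
  have hb := abs_pos.2 hz
  have hwj : (lineRestrict P z w).coeff j ≠ 0 := by
    intro h
    rw [h, abs_zero, mul_zero] at hle
    exact hle.not_gt (by positivity)
  have hmeas : Measurable fun v => coeffLog d ε (lineRestrict P z v) :=
    Measurable.of_uncurry_left (f := fun z v => coeffLog d ε (lineRestrict P z v))
      (measurable_coeffLog_lineRestrict P d ε)
  have hT := lintegral_stdGaussian_log_coeff_le hw hj1 hwj
  have hpt := (ae_coeff_lineRestrict_ne_zero hw hwj).mono fun v hv =>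
    ofReal_neg_log_le_coeffLog_add (e := Real.log √(Real.pi / 2)) hj hε hx hδ (abs_pos.2 hwj) hb
      (by rw [coeff_zero_lineRestrict]) hv hle
  have h := lintegral_mono_ae hpt
  rw [lintegral_add_right _ measurable_const, lintegral_add_left hmeas, lintegral_const,
    lintegral_const, measure_univ, mul_one, mul_one] at h
  refine h.trans ?_
  gcongr

end GaussianDirection

section ConvexBody

open ProbabilityTheory

variable {m : ℕ} {P : MvPolynomial (Fin m) ℝ}

lemma eval_smul_of_isHomogeneous {k : ℕ} (hP : P.IsHomogeneous k) (t : ℝ) (x : Fin m → ℝ) :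
    MvPolynomial.eval (t • x) P = t ^ k * MvPolynomial.eval x P := by
  rw [MvPolynomial.eval_eq, MvPolynomial.eval_eq, Finset.mul_sum]
  refine Finset.sum_congr rfl fun e he => ?_
  have hdeg : ∑ i ∈ e.support, e i = k := by
    rw [← hP.degree_eq_sum_deg_support he]
  simp only [Pi.smul_apply, smul_eq_mul, mul_pow, Finset.prod_mul_distrib]
  rw [Finset.prod_pow_eq_pow_sum, hdeg]
  ring

lemma coeff_lineRestrict_zero_of_isHomogeneous {k : ℕ} (hP : P.IsHomogeneous k)
    (v : EuclideanSpace ℝ (Fin m)) :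
    (lineRestrict P 0 v).coeff k = MvPolynomial.eval (fun i => v i) P := by
  have h : lineRestrict P 0 v =
      Polynomial.C (MvPolynomial.eval (fun i => v i) P) * Polynomial.X ^ k := by
    refine Polynomial.funext fun t => ?_
    rw [eval_lineRestrict]
    have h1 : (fun i => (0 + t • v) i) = t • fun i => v i := by
      funext i
      simp
    rw [h1, eval_smul_of_isHomogeneous hP]
    rw [Polynomial.eval_mul, Polynomial.eval_C, Polynomial.eval_pow, Polynomial.eval_X, mul_comm]
  rw [h, Polynomial.coeff_C_mul, Polynomial.coeff_X_pow_self, mul_one]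

variable {K : Set (EuclideanSpace ℝ (Fin m))} {c : EuclideanSpace ℝ (Fin m)} {ρ : ℝ}

lemma ae_restrict_eval_ne_zero (hm : 0 < m) {k : ℕ} (hP : P.IsHomogeneous k) (hP0 : P ≠ 0)
    (hK : Convex ℝ K) (hKm : MeasurableSet K) (hρ : 0 < ρ) (hball : Metric.ball c ρ ⊆ K) :
    ∀ᵐ z ∂(volume.restrict K), MvPolynomial.eval (fun i => z i) P ≠ 0 := by
  obtain ⟨x, hx⟩ : ∃ x : Fin m → ℝ, MvPolynomial.eval x (MvPolynomial.X ⟨0, hm⟩ * P) ≠ 0 := by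
    by_contra! h
    exact mul_ne_zero (MvPolynomial.X_ne_zero _) hP0 (MvPolynomial.funext (by simpa using h))
  rw [map_mul, MvPolynomial.eval_X, mul_ne_zero_iff] at hx
  set u : EuclideanSpace ℝ (Fin m) := WithLp.toLp 2 x with hu
  have hu0 : u ≠ 0 := by
    intro h
    exact hx.1 (by simpa [hu] using congrFun (congrArg WithLp.ofLp h) ⟨0, hm⟩)
  have hPu : MvPolynomial.eval (fun i => u i) P ≠ 0 := hx.2
  have hs : MeasurableSet {z : EuclideanSpace ℝ (Fin m) |
      MvPolynomial.eval (fun i => z i) P = 0} := by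
    have h := measurable_coeff_lineRestrict P 0 k (measurableSet_singleton 0)
    simp only [coeff_lineRestrict_zero_of_isHomogeneous hP] at h
    exact h
  have h := setLIntegral_le_of_convex volume hK hKm hρ hball (by simpa using hm) hu0
    (measurable_const.indicator hs (f := fun _ => (1 : ENNReal))) (C := 0) fun z => ?_
  · rw [lintegral_indicator_const hs, one_mul, mul_zero, zero_mul] at h
    rw [ae_iff]
    simpa using h
  · obtain ⟨Q, -, h2, h3⟩ := exists_polynomial_coeff_lineRestrict_add_smul P 0 z u k
    rw [coeff_lineRestrict_zero_of_isHomogeneous hP] at h2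
    have hQ : Q ≠ 0 := by
      rintro rfl
      exact hPu (by simpa using h2.symm)
    rw [nonpos_iff_eq_zero]
    refine lintegral_eq_zero_of_ae_eq_zero ?_
    filter_upwards [measure_eq_zero_iff_ae_notMem.1 (volume_setOf_eval_eq_zero hQ)] with t ht
    refine Set.indicator_of_notMem (fun h => ht ?_) _
    rw [h3, coeff_lineRestrict_zero_of_isHomogeneous hP]
    exact h

lemma setLIntegral_coeffLog_lineRestrict_le (hm : 0 < m) {d : ℕ} (hd : 1 ≤ d)
    (hP : P.totalDegree ≤ d) (hK : Convex ℝ K) (hKm : MeasurableSet K) (hρ : 0 < ρ)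
    (hball : Metric.ball c ρ ⊆ K) (v : EuclideanSpace ℝ (Fin m)) :
    ∫⁻ z in K, coeffLog d (ρ / (d * Real.exp 1 * m * √m)) (lineRestrict P z v) ≤
      ENNReal.ofReal (√m)⁻¹ * ENNReal.ofReal ‖v‖ * volume K := by
  have hm0 : (0 : ℝ) < m := by exact_mod_cast hm
  have hd0 : (0 : ℝ) < d := by exact_mod_cast hd
  have hsm : 0 < √(m : ℝ) := Real.sqrt_pos.2 hm0
  set ε := ρ / (d * Real.exp 1 * m * √m) with hε
  have hε0 : 0 < ε := by positivity
  rcases eq_or_ne v 0 with rfl | hv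
  · have h0 : ∀ z, coeffLog d ε (lineRestrict P z 0) = 0 := by
      intro z
      refine le_antisymm (iSup₂_le fun j hj => ?_) zero_le
      have hj0 : j ≠ 0 := by
        have := (Finset.mem_Icc.1 hj).1
        omega
      have := coeff_lineRestrict_smul P z 0 0 j
      rw [smul_zero, zero_pow hj0, zero_mul] at this
      simp [this]
    simp [h0]
  · refine (setLIntegral_le_of_convex volume hK hKm hρ hball (by simpa using hm) hv
      (Measurable.of_uncurry_right (f := fun z v => coeffLog d ε (lineRestrict P z v))
        (measurable_coeffLog_lineRestrict P d ε)) (C := d * ENNReal.ofReal (2 * ε))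
      fun z => ?_).trans (le_of_eq ?_)
    · simp_rw [← taylor_lineRestrict]
      exact lintegral_coeffLog_taylor_le hε0 _ (natDegree_lineRestrict_le P z v hP)
    · rw [finrank_euclideanSpace_fin, ← ENNReal.ofReal_natCast d,
        ← ENNReal.ofReal_mul (by positivity), ← ENNReal.ofReal_mul (by positivity),
        ← ENNReal.ofReal_mul (by positivity)]
      congr 2
      rw [hε]
      field_simp

/-- The logarithmic distance to `S`, averaged over a convex body containing a ball of radius `ρ`. -/
lemma setLIntegral_neg_log_infDist_le (hm : 0 < m) {d k : ℕ} (hd : 1 ≤ d)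
    (hhom : P.IsHomogeneous k) (hk : k ≤ d) (hP0 : P ≠ 0)
    {S : Set (EuclideanSpace ℝ (Fin m))} (hSne : S.Nonempty) (hScl : IsClosed S)
    (hSP : ∀ x ∈ S, MvPolynomial.eval (fun i => x i) P = 0)
    (hK : Convex ℝ K) (hKm : MeasurableSet K) (hρ : 0 < ρ) (hball : Metric.ball c ρ ⊆ K) :
    ∫⁻ z in K, ENNReal.ofReal (-Real.log (Metric.infDist z S)) ≤
      (2 + ENNReal.ofReal (-Real.log (ρ / (d * Real.exp 1 * m * √m)) -
        Real.log (Real.log 2 / d) - Real.log √(Real.pi / 2))) * volume K := by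
  have hm0 : (0 : ℝ) < m := by exact_mod_cast hm
  have hd0 : (0 : ℝ) < d := by exact_mod_cast hd
  have hsm : 0 < √(m : ℝ) := Real.sqrt_pos.2 hm0
  have hP : P.totalDegree ≤ d := hhom.totalDegree_le.trans hk
  have hA := setLIntegral_coeffLog_lineRestrict_le hm hd hP hK hKm hρ hball
  have hε0 : 0 < ρ / (d * Real.exp 1 * m * √m) := by positivity
  generalize ρ / (d * Real.exp 1 * m * √m) = ε at *
  have hmeas := measurable_coeffLog_lineRestrict P d ε
  have hswap : ∫⁻ z in K, ∫⁻ v, coeffLog d ε (lineRestrict P z v)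
      ∂(stdGaussian (EuclideanSpace ℝ (Fin m))) ≤ volume K := by
    rw [lintegral_lintegral_swap hmeas.aemeasurable]
    refine (lintegral_mono hA).trans ?_
    rw [lintegral_mul_const _ (by fun_prop), lintegral_const_mul _ (by fun_prop)]
    calc _ ≤ ENNReal.ofReal (√m)⁻¹ * ENNReal.ofReal √m * volume K := by
          gcongr
          exact lintegral_norm_stdGaussian_le hm
      _ = volume K := by
          rw [← ENNReal.ofReal_mul (by positivity), inv_mul_cancel₀ hsm.ne', ENNReal.ofReal_one,
            one_mul]
  have hpt := (ae_restrict_eval_ne_zero hm hhom hP0 hK hKm hρ hball).mono fun z hz =>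
    neg_log_infDist_le hd hP hSne hScl hSP hε0 hz
  refine (lintegral_mono_ae hpt).trans ?_
  rw [lintegral_add_right _ measurable_const, lintegral_add_right _ measurable_const,
    lintegral_const, lintegral_const, Measure.restrict_apply_univ]
  refine (add_le_add_left (add_le_add_left hswap _) _).trans (le_of_eq ?_)
  ring

end ConvexBody

lemma two_add_ofReal_le {n d : ℕ} (hn : 1 ≤ n) (hd : 1 ≤ d) {σ : ℝ} (hσ : σ ∈ Set.Ioc (0 : ℝ) 1) :
    2 + ENNReal.ofReal
      (-Real.log (σ / 2 / (d * Real.exp 1 * (n + 1 : ℕ) * √(n + 1 : ℕ))) -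
        Real.log (Real.log 2 / d) - Real.log √(Real.pi / 2)) ≤
      ENNReal.ofReal (2 * Real.log n + 2 * Real.log d + 2 * Real.log (1 / σ) + 5) := by
  obtain ⟨hσ0, hσ1⟩ := hσ
  have hn1 : (1 : ℝ) ≤ n := by exact_mod_cast hn
  have hd1 : (1 : ℝ) ≤ d := by exact_mod_cast hd
  have hn0 : (0 : ℝ) < n := by linarith
  have hd0 : (0 : ℝ) < d := by linarith
  have hm0 : (0 : ℝ) < (n + 1 : ℕ) := by positivity
  have hsm : 0 < √((n + 1 : ℕ) : ℝ) := Real.sqrt_pos.2 hm0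
  have hlog2 : 0 < Real.log 2 := Real.log_pos (by norm_num)
  have hln : 0 ≤ Real.log n := Real.log_nonneg hn1
  have hld : 0 ≤ Real.log d := Real.log_nonneg hd1
  have hlσ : Real.log σ ≤ 0 := Real.log_nonpos hσ0.le hσ1
  have hmn : Real.log (n + 1 : ℕ) ≤ Real.log 2 + Real.log n := by
    rw [← Real.log_mul (by norm_num) hn0.ne']
    apply Real.log_le_log hm0
    push_cast
    linarith
  have hloglog : -Real.log (Real.log 2) ≤ Real.log (3 / 2) := by
    rw [← Real.log_inv]
    apply Real.log_le_log (by positivity)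
    rw [inv_le_comm₀ hlog2 (by norm_num)]
    have := Real.log_two_gt_d9
    norm_num at this ⊢
    linarith
  have hpi : Real.log (3 / 2) ≤ Real.log (Real.pi / 2) := by
    apply Real.log_le_log (by norm_num)
    have := Real.pi_gt_three
    linarith
  have h32 : Real.log (3 / 2) ≤ 1 / 2 := by
    have := Real.log_le_sub_one_of_pos (x := 3 / 2) (by norm_num)
    linarith
  have hl2 := Real.log_two_lt_d9
  norm_num at hl2
  rw [Real.log_div (by positivity) (by positivity), Real.log_div hσ0.ne' (by norm_num),
    Real.log_mul (by positivity) hsm.ne', Real.log_mul (by positivity) hm0.ne',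
    Real.log_mul hd0.ne' (Real.exp_pos 1).ne', Real.log_exp, Real.log_sqrt hm0.le,
    Real.log_div hlog2.ne' hd0.ne', Real.log_sqrt (by positivity), one_div, Real.log_inv]
  calc _ ≤ ENNReal.ofReal 2 + ENNReal.ofReal
        (2 * Real.log n + 2 * Real.log d + 2 * -Real.log σ + 3) := by
        gcongr
        · norm_num
        · linarith
    _ = _ := by
        rw [← ENNReal.ofReal_add (by norm_num) (by linarith)]
        congr 1
        ring

section Sphere

variable {n : ℕ}

/-- The part of the unit ball in the convex cone spanned by `cap n a σ`. -/
def capCone (n : ℕ) (a : EuclideanSpace ℝ (Fin (n + 1))) (σ : ℝ) :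
    Set (EuclideanSpace ℝ (Fin (n + 1))) :=
  {x | x ∈ Metric.ball (0 : EuclideanSpace ℝ (Fin (n + 1))) 1 ∧ √(1 - σ ^ 2) * ‖x‖ < ⟪x, a⟫}

lemma convex_capCone (a : EuclideanSpace ℝ (Fin (n + 1))) (σ : ℝ) :
    Convex ℝ (capCone n a σ) := by
  refine (convex_ball 0 1).inter fun x hx y hy s t hs ht hst => ?_
  have h1 : ‖s • x + t • y‖ ≤ s * ‖x‖ + t * ‖y‖ := by
    refine (norm_add_le _ _).trans_eq ?_
    rw [norm_smul, norm_smul, Real.norm_of_nonneg hs, Real.norm_of_nonneg ht]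
  change √(1 - σ ^ 2) * ‖s • x + t • y‖ < ⟪s • x + t • y, a⟫
  rw [inner_add_left, real_inner_smul_left, real_inner_smul_left]
  have h2 : √(1 - σ ^ 2) * ‖x‖ < ⟪x, a⟫ := hx
  have h3 : √(1 - σ ^ 2) * ‖y‖ < ⟪y, a⟫ := hy
  have h4 := mul_le_mul_of_nonneg_left h1 (Real.sqrt_nonneg (1 - σ ^ 2))
  rcases hs.eq_or_lt with rfl | hs0
  · have : t = 1 := by linarith
    subst this
    linarith
  · nlinarith [mul_lt_mul_of_pos_left h2 hs0, mul_le_mul_of_nonneg_left h3.le ht]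

lemma measurableSet_capCone (a : EuclideanSpace ℝ (Fin (n + 1))) (σ : ℝ) :
    MeasurableSet (capCone n a σ) :=
  Metric.isOpen_ball.measurableSet.inter <|
    measurableSet_lt (f := fun x => √(1 - σ ^ 2) * ‖x‖) (g := fun x => ⟪x, a⟫)
      (by fun_prop) (by fun_prop)

lemma ball_subset_capCone {a : EuclideanSpace ℝ (Fin (n + 1))} (ha : ‖a‖ = 1) {σ : ℝ}
    (hσ : σ ∈ Set.Ioc (0 : ℝ) 1) :
    Metric.ball ((2 : ℝ)⁻¹ • a) (σ / 2) ⊆ capCone n a σ := by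
  obtain ⟨hσ0, hσ1⟩ := hσ
  intro x hx
  rw [mem_ball_iff_norm] at hx
  have hnorm : ‖(2 : ℝ)⁻¹ • a‖ = 1 / 2 := by
    rw [norm_smul, ha]
    norm_num
  constructor
  · rw [mem_ball_zero_iff]
    have := norm_sub_norm_le x ((2 : ℝ)⁻¹ • a)
    linarith
  · have h1 : ‖x - (2 : ℝ)⁻¹ • a‖ ^ 2 < (σ / 2) ^ 2 := by gcongr
    rw [norm_sub_sq_real, hnorm, real_inner_smul_right] at h1
    have h2 := Real.sq_sqrt (show 0 ≤ 1 - σ ^ 2 by nlinarith)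
    nlinarith [sq_nonneg (2 * ‖x‖ - √(1 - σ ^ 2))]

lemma measurableSet_cap (a : EuclideanSpace ℝ (Fin (n + 1))) (σ : ℝ) :
    MeasurableSet (cap n a σ) :=
  Metric.isClosed_sphere.measurableSet.inter <|
    measurableSet_lt (f := fun _ => √(1 - σ ^ 2)) (g := fun x => ⟪x, a⟫)
      (by fun_prop) (by fun_prop)

lemma image_cap (g : EuclideanSpace ℝ (Fin (n + 1)) ≃ₗᵢ[ℝ] EuclideanSpace ℝ (Fin (n + 1)))
    (a : EuclideanSpace ℝ (Fin (n + 1))) (σ : ℝ) : g '' cap n a σ = cap n (g a) σ := by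
  ext z
  constructor
  · rintro ⟨x, ⟨hx1, hx2⟩, rfl⟩
    refine ⟨by simpa using hx1, ?_⟩
    rwa [LinearIsometryEquiv.inner_map_map]
  · rintro ⟨hz1, hz2⟩
    refine ⟨g.symm z, ⟨by simpa using hz1, ?_⟩, g.apply_symm_apply z⟩
    rwa [← LinearIsometryEquiv.inner_map_map g, g.apply_symm_apply]

lemma hausdorffMeasure_sphere_lt_top {a : EuclideanSpace ℝ (Fin (n + 1))} (ha : ‖a‖ = 1) {σ : ℝ}
    (hσ : σ ∈ Set.Ioc (0 : ℝ) 1) (hcap : μH[(n : ℝ)] (cap n a σ) ≠ ⊤) :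
    μH[(n : ℝ)] (Metric.sphere (0 : EuclideanSpace ℝ (Fin (n + 1))) 1) < ⊤ := by
  refine (isCompact_sphere _ _).measure_lt_top_of_nhdsWithin fun x hx => ?_
  have hx1 : ‖x‖ = 1 := by simpa using hx
  set g : EuclideanSpace ℝ (Fin (n + 1)) ≃ₗᵢ[ℝ] EuclideanSpace ℝ (Fin (n + 1)) :=
    (Submodule.span ℝ {a - x})ᗮ.reflection
  have hgx : g a = x := Submodule.reflection_sub (by rw [ha, hx1])
  refine ⟨cap n x σ, ?_, ?_⟩
  · refine Filter.inter_mem self_mem_nhdsWithin (mem_nhdsWithin_of_mem_nhds ?_)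
    refine IsOpen.mem_nhds (isOpen_lt (f := fun _ => √(1 - σ ^ 2)) (g := fun z => ⟪z, x⟫)
      (by fun_prop) (by fun_prop)) ?_
    change √(1 - σ ^ 2) < ⟪x, x⟫
    rw [real_inner_self_eq_norm_sq, hx1, one_pow, Real.sqrt_lt' one_pos]
    have := hσ.1
    nlinarith
  · rw [← hgx, ← image_cap]
    exact ((g.toIsometryEquiv.hausdorffMeasure_image _ _).trans_lt hcap.lt_top)

lemma map_restrict_of_isometry {μ : Measure (EuclideanSpace ℝ (Fin (n + 1)))}
    {s : Set (EuclideanSpace ℝ (Fin (n + 1)))}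
    {g : EuclideanSpace ℝ (Fin (n + 1)) ≃ₗᵢ[ℝ] EuclideanSpace ℝ (Fin (n + 1))}
    (hμ : MeasurePreserving g μ μ) (hs : MeasurableSet s) (hgs : g ⁻¹' s = s) :
    (μ.restrict s).map g = μ.restrict s := by
  have := (hμ.restrict_preimage hs).map_eq
  rwa [hgs] at this

/-- The radial projection of Lebesgue measure on the unit ball to the unit sphere. -/
noncomputable def radialMeasure (n : ℕ) : Measure (EuclideanSpace ℝ (Fin (n + 1))) :=
  (volume.restrict (Metric.ball 0 1)).map fun x => ‖x‖⁻¹ • x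

lemma measurable_radial :
    Measurable fun x : EuclideanSpace ℝ (Fin (n + 1)) => ‖x‖⁻¹ • x := by fun_prop

lemma ae_radialMeasure_norm_eq_one : ∀ᵐ x ∂(radialMeasure n), ‖x‖ = 1 := by
  rw [radialMeasure, ae_map_iff measurable_radial.aemeasurable
    (measurableSet_eq_fun (by fun_prop) (by fun_prop))]
  filter_upwards [ae_restrict_of_ae (volume.ae_ne (0 : EuclideanSpace ℝ (Fin (n + 1))))] with x hx
  rw [norm_smul, norm_inv, norm_norm, inv_mul_cancel₀ (norm_ne_zero_iff.2 hx)]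

lemma map_radialMeasure
    (g : EuclideanSpace ℝ (Fin (n + 1)) ≃ₗᵢ[ℝ] EuclideanSpace ℝ (Fin (n + 1))) :
    (radialMeasure n).map g = radialMeasure n := by
  have h := map_restrict_of_isometry g.measurePreserving
    (Metric.isOpen_ball (x := 0) (ε := 1)).measurableSet (by rw [g.preimage_ball, map_zero])
  unfold radialMeasure
  nth_rw 2 [← h]
  rw [Measure.map_map g.continuous.measurable measurable_radial,
    Measure.map_map measurable_radial g.continuous.measurable]
  congr 1
  funext x
  simp

instance : IsFiniteMeasure (radialMeasure n) :=
  have : IsFiniteMeasure ((volume : Measure (EuclideanSpace ℝ (Fin (n + 1)))).restrict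
    (Metric.ball 0 1)) := isFiniteMeasure_restrict.2 Metric.isBounded_ball.measure_lt_top.ne
  Measure.isFiniteMeasure_map _ _

lemma radialMeasure_univ_ne_zero : radialMeasure n Set.univ ≠ 0 := by
  rw [radialMeasure, Measure.map_apply measurable_radial MeasurableSet.univ, Set.preimage_univ,
    Measure.restrict_apply_univ]
  exact (Metric.measure_ball_pos _ _ one_pos).ne'

lemma setLIntegral_radialMeasure_cap (a : EuclideanSpace ℝ (Fin (n + 1))) (σ : ℝ)
    {f : EuclideanSpace ℝ (Fin (n + 1)) → ENNReal} (hf : Measurable f) :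
    ∫⁻ z in cap n a σ, f z ∂(radialMeasure n) = ∫⁻ x in capCone n a σ, f (‖x‖⁻¹ • x) := by
  rw [radialMeasure, setLIntegral_map (measurableSet_cap a σ) hf measurable_radial,
    Measure.restrict_restrict (measurable_radial (measurableSet_cap a σ))]
  congr 2
  ext x
  rw [Set.inter_comm]
  refine and_congr_right fun _ => ?_
  change (_ ∈ Metric.sphere _ _ ∧ _ < _) ↔ _
  rw [mem_sphere_zero_iff_norm, norm_smul, norm_inv, norm_norm, real_inner_smul_left]
  rcases eq_or_ne x 0 with rfl | hx
  · simp
  · have hx0 := norm_pos_iff.2 hx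
    rw [inv_mul_cancel₀ hx0.ne', lt_inv_mul_iff₀ hx0, mul_comm ‖x‖]
    simp

/-- An integral over a spherical cap with respect to normalized Hausdorff measure is bounded by an
average over the corresponding solid cone. -/
lemma lintegral_nuMeasure_le {a : EuclideanSpace ℝ (Fin (n + 1))} (ha : ‖a‖ = 1) {σ : ℝ}
    (hσ : σ ∈ Set.Ioc (0 : ℝ) 1) {f : EuclideanSpace ℝ (Fin (n + 1)) → ENNReal}
    (hf : Measurable f) {R : ENNReal}
    (hR : ∫⁻ x in capCone n a σ, f (‖x‖⁻¹ • x) ≤ R * volume (capCone n a σ)) :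
    ∫⁻ z, f z ∂(nuMeasure n a σ) ≤ R := by
  rw [nuMeasure, lintegral_smul_measure, smul_eq_mul]
  by_cases hcap : μH[(n : ℝ)] (cap n a σ) = ⊤
  · simp [hcap]
  set μ : Measure (EuclideanSpace ℝ (Fin (n + 1))) :=
    (μH[(n : ℝ)]).restrict (Metric.sphere 0 1) with hμ
  have hfin : IsFiniteMeasure μ :=
    isFiniteMeasure_restrict.2 (hausdorffMeasure_sphere_lt_top ha hσ hcap).ne
  have hsub : cap n a σ ⊆ Metric.sphere 0 1 := fun z hz => hz.1
  have hres : μ.restrict (cap n a σ) = (μH[(n : ℝ)]).restrict (cap n a σ) :=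
    Measure.restrict_restrict_of_subset hsub
  have hcapμ : μH[(n : ℝ)] (cap n a σ) = μ (cap n a σ) := by
    rw [← Measure.restrict_apply_univ, ← hres, Measure.restrict_apply_univ]
  have heq := smul_eq_smul_of_isometry_invariant μ (radialMeasure n)
    ((ae_restrict_mem Metric.isClosed_sphere.measurableSet).mono fun x hx => by simpa using hx)
    ae_radialMeasure_norm_eq_one
    (fun g => map_restrict_of_isometry
      (g.toIsometryEquiv.measurePreserving_hausdorffMeasure _)
      Metric.isClosed_sphere.measurableSet (by rw [g.preimage_sphere, map_zero]))
    map_radialMeasure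
  have hInt : radialMeasure n Set.univ * ∫⁻ z in cap n a σ, f z ∂μ =
      μ Set.univ * ∫⁻ x in capCone n a σ, f (‖x‖⁻¹ • x) := by
    rw [← setLIntegral_radialMeasure_cap a σ hf, ← smul_eq_mul, ← smul_eq_mul,
      ← lintegral_smul_measure, ← lintegral_smul_measure, ← Measure.restrict_smul, heq,
      Measure.restrict_smul]
  have hvol : radialMeasure n Set.univ * μ (cap n a σ) =
      μ Set.univ * volume (capCone n a σ) := by
    have h1 := congrArg (fun ν : Measure (EuclideanSpace ℝ (Fin (n + 1))) => ν (cap n a σ)) heq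
    have h2 := setLIntegral_radialMeasure_cap a σ (measurable_const (a := (1 : ENNReal)))
    simp only [lintegral_const, Measure.restrict_apply_univ, one_mul] at h2
    simpa [h2] using h1
  have hle : ∫⁻ z in cap n a σ, f z ∂μ ≤ R * μ (cap n a σ) := by
    rw [← ENNReal.mul_le_mul_iff_right radialMeasure_univ_ne_zero
      (measure_ne_top (radialMeasure n) _), hInt, mul_left_comm, hvol, mul_left_comm]
    gcongr
  rw [← hres, hcapμ]
  calc _ ≤ (μ (cap n a σ))⁻¹ * (R * μ (cap n a σ)) := by gcongr
    _ = R * ((μ (cap n a σ))⁻¹ * μ (cap n a σ)) := by ring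
    _ ≤ R * 1 := by
        gcongr
        exact ENNReal.inv_mul_le_one _
    _ = R := mul_one R

end Sphere

open scoped Pointwise in
lemma ofReal_neg_log_infDist_normalize_le {E : Type*} [NormedAddCommGroup E] [NormedSpace ℝ E]
    {S : Set E} (hS : ∀ x ∈ S, ∀ c : ℝ, c • x ∈ S) {x : E} (hx0 : x ≠ 0) (hx1 : ‖x‖ ≤ 1) :
    ENNReal.ofReal (-Real.log (Metric.infDist (‖x‖⁻¹ • x) S)) ≤
      ENNReal.ofReal (-Real.log (Metric.infDist x S)) := by
  have hx : 0 < ‖x‖ := norm_pos_iff.2 hx0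
  have hSx : ‖x‖ • S = S := by
    ext y
    rw [Set.mem_smul_set_iff_inv_smul_mem₀ hx.ne']
    exact ⟨fun h => by simpa [hx.ne'] using hS _ h ‖x‖, fun h => hS _ h _⟩
  have h := infDist_smul₀ hx.ne' S (‖x‖⁻¹ • x)
  rw [hSx, smul_inv_smul₀ hx.ne', norm_norm] at h
  rw [h]
  rcases (Metric.infDist_nonneg (s := S) (x := ‖x‖⁻¹ • x)).eq_or_lt with h0 | h0
  · simp [← h0]
  · apply ENNReal.ofReal_le_ofReal
    rw [Real.log_mul hx.ne' h0.ne']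
    have := Real.log_nonpos hx.le hx1
    linarith

/-- Uniform smoothed analysis of the expectation: for `z ∈ Sⁿ` one has
`ln C(z) = -ln dist(z,S)` (nonnegative, since `C(z) ≥ 1`), and its expectation
with respect to `ν_{a,σ}` (as a lower Lebesgue integral, covering the value `∞`
on `S` itself) is at most `2 ln n + 2 ln d + 2 ln(1/σ) + 5`. -/
theorem stmt5 (n d : ℕ) (hn : 1 ≤ n) (hd : 1 ≤ d)
    (S : Set (EuclideanSpace ℝ (Fin (n + 1)))) (hSne : S.Nonempty) (hScl : IsClosed S)
    (hScone : ∀ x ∈ S, ∀ lam : ℝ, lam • x ∈ S)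
    (P : MvPolynomial (Fin (n + 1)) ℝ) (hP : P ≠ 0)
    (k : ℕ) (hk : k ≤ d) (hhom : P.IsHomogeneous k)
    (hSP : ∀ x ∈ S, MvPolynomial.eval (fun i => x i) P = 0)
    (σ : ℝ) (hσ : σ ∈ Set.Ioc (0:ℝ) 1)
    (a : EuclideanSpace ℝ (Fin (n + 1)))
    (ha : a ∈ Metric.sphere (0 : EuclideanSpace ℝ (Fin (n + 1))) 1) :
    ∫⁻ z, ENNReal.ofReal (-Real.log (Metric.infDist z S)) ∂(nuMeasure n a σ) ≤
      ENNReal.ofReal (2 * Real.log n + 2 * Real.log d + 2 * Real.log (1 / σ) + 5) := by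

  have ha1 : ‖a‖ = 1 := by simpa using ha
  have hmain := setLIntegral_neg_log_infDist_le (Nat.succ_pos n) hd hhom hk hP hSne hScl hSP
    (convex_capCone a σ) (measurableSet_capCone a σ) (half_pos hσ.1) (ball_subset_capCone ha1 hσ)
  refine (lintegral_nuMeasure_le ha1 hσ (by fun_prop) (le_trans ?_ hmain)).trans
    (two_add_ofReal_le hn hd hσ)
  refine setLIntegral_mono' (measurableSet_capCone a σ) fun x hx => ?_
  refine ofReal_neg_log_infDist_normalize_le hScone ?_ (mem_ball_zero_iff.1 hx.1).le
  rintro rfl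
  simpa using hx.2
end

section
/- The smoothness parameter of the adversarial measure μ with respect to ν_{a,σ} equals α_{ν_{a,σ}}(μ) = 1 - β/n. -/
open MeasureTheory Filter
open scoped RealInnerProductSpace ENNReal

/-- `I_m(σ) := ∫₀^σ r^{m-1} / √(1 - r²) dr`. -/
noncomputable def Ifun (m σ : ℝ) : ℝ :=
  ∫ r in (0:ℝ)..σ, r ^ (m - 1) / Real.sqrt (1 - r ^ 2)

/-- `g(r) = C_{β,σ} · r^{-β} · h(r)` with `C_{β,σ} = I_n(σ)/I_{n-β}(σ)`. -/
noncomputable def gFun (n : ℕ) (σ β : ℝ) (h : ℝ → ℝ) (r : ℝ) : ℝ :=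
  (Ifun n σ / Ifun ((n : ℝ) - β) σ) * r ^ (-β) * h r

/-- The adversarial measure: the density of `μ` with respect to `ν_{a,σ}` at `z` is
`f(z) = g(sin θ(z,a))`, where `sin θ(z,a) = √(1 - ⟨z,a⟩²)` for unit vectors `z, a`. -/
noncomputable def advMeasure (n : ℕ) (a : EuclideanSpace ℝ (Fin (n + 1))) (σ β : ℝ)
    (h : ℝ → ℝ) : Measure (EuclideanSpace ℝ (Fin (n + 1))) :=
  (nuMeasure n a σ).withDensity
    (fun z => ENNReal.ofReal (gFun n σ β h (Real.sqrt (1 - ⟪z, a⟫ ^ 2))))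

/-- The quotient `ln μ(B) / ln ν(B)`, valued in `[0,∞]`, with the conventions
`ln 0 := -∞` and `(-∞)/x := +∞` for `x < 0` (for `0 < ν(B) < 1 ≤ μ` the ratio is
nonnegative, and equals `+∞` exactly when `μ(B) = 0`). -/
noncomputable def logRatio {E : Type*} [MeasurableSpace E]
    (ν μ : Measure E) (B : Set E) : ℝ≥0∞ :=
  if μ B = 0 then ⊤
  else ENNReal.ofReal (Real.log (μ B).toReal / Real.log (ν B).toReal)

/-- `inf(δ) := inf { ln μ(B) / ln ν(B) : B Borel, 0 < ν(B) ≤ δ }`. -/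
noncomputable def infFn {E : Type*} [MeasurableSpace E]
    (ν μ : Measure E) (δ : ℝ) : ℝ≥0∞ :=
  ⨅ (B : Set E) (_ : MeasurableSet B) (_ : 0 < ν B) (_ : ν B ≤ ENNReal.ofReal δ),
    logRatio ν μ B

/-- If `μ` is bounded by a power `ν ^ γ` up to a constant, and this bound is attained up to a
constant on sets of arbitrarily small `ν`-measure, then `infFn ν μ` tends to `γ`. -/
theorem tendsto_infFn_of_rpow_bounds {E : Type*} [MeasurableSpace E] (ν μ : Measure E)
    (γ C c : ℝ) (hC : 1 ≤ C) (hc : 0 < c) (hc1 : c ≤ 1)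
    (hle : ∀ B, MeasurableSet B → 0 < ν B → ν B ≠ ∞ →
      μ B ≤ ENNReal.ofReal (C * (ν B).toReal ^ γ))
    (hge : ∀ δ : ℝ, 0 < δ → ∃ B, MeasurableSet B ∧ 0 < ν B ∧ ν B ≤ ENNReal.ofReal δ ∧
      ENNReal.ofReal (c * (ν B).toReal ^ γ) ≤ μ B) :
    Tendsto (infFn ν μ) (nhdsWithin 0 (Set.Ioi (0 : ℝ))) (nhds (ENNReal.ofReal γ)) := by
  have hlim (K : ℝ) : Tendsto (fun δ : ℝ => ENNReal.ofReal (γ + K / Real.log δ))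
      (nhdsWithin 0 (Set.Ioi (0 : ℝ))) (nhds (ENNReal.ofReal γ)) := by
    refine ENNReal.tendsto_ofReal ?_
    simpa using (Real.tendsto_log_nhdsGT_zero.const_div_atBot K).const_add γ
  have hev : ∀ᶠ δ : ℝ in nhdsWithin 0 (Set.Ioi (0 : ℝ)), 0 < δ ∧ δ < 1 :=
    Ioo_mem_nhdsGT zero_lt_one
  have hreal (B : Set E) (δ : ℝ) (hδ : 0 < δ) (hB : 0 < ν B) (hBδ : ν B ≤ ENNReal.ofReal δ) :
      0 < (ν B).toReal ∧ (ν B).toReal ≤ δ :=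
    ⟨ENNReal.toReal_pos hB.ne' (ne_top_of_le_ne_top ENNReal.ofReal_ne_top hBδ),
      ENNReal.toReal_le_of_le_ofReal hδ.le hBδ⟩
  refine tendsto_of_tendsto_of_tendsto_of_le_of_le' (hlim (Real.log C)) (hlim (Real.log c)) ?_ ?_
  · filter_upwards [hev] with δ ⟨hδ0, hδ1⟩
    refine le_iInf fun B => le_iInf fun hBm => le_iInf fun hB => le_iInf fun hBδ => ?_
    obtain ⟨ht0, htδ⟩ := hreal B δ hδ0 hB hBδ
    unfold logRatio
    split_ifs with h0
    · exact le_top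
    have hup := hle B hBm hB (ne_top_of_le_ne_top ENNReal.ofReal_ne_top hBδ)
    have hμpos : 0 < (μ B).toReal :=
      ENNReal.toReal_pos h0 (ne_top_of_le_ne_top ENNReal.ofReal_ne_top hup)
    have hμle : (μ B).toReal ≤ C * (ν B).toReal ^ γ :=
      ENNReal.toReal_le_of_le_ofReal (by positivity) hup
    set t := (ν B).toReal
    have hlog : Real.log (μ B).toReal ≤ Real.log C + γ * Real.log t := by
      rw [← Real.log_rpow ht0, ← Real.log_mul (by positivity) (by positivity)]
      exact Real.log_le_log hμpos hμle
    have hlt : Real.log t ≤ Real.log δ := Real.log_le_log ht0 htδ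
    have hlδ : Real.log δ < 0 := Real.log_neg hδ0 hδ1
    apply ENNReal.ofReal_le_ofReal
    have h1 : Real.log C / Real.log δ ≤ Real.log C / Real.log t := by
      rw [div_eq_mul_inv, div_eq_mul_inv]
      exact mul_le_mul_of_nonneg_left
        ((inv_le_inv_of_neg hlδ (hlt.trans_lt hlδ)).2 hlt) (Real.log_nonneg hC)
    refine (add_le_add_right h1 γ).trans ?_
    rw [le_div_iff_of_neg (hlt.trans_lt hlδ), add_mul,
      div_mul_cancel₀ _ (hlt.trans_lt hlδ).ne]
    linarith
  · filter_upwards [hev] with δ ⟨hδ0, hδ1⟩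
    obtain ⟨B, hBm, hB, hBδ, hBμ⟩ := hge δ hδ0
    obtain ⟨ht0, htδ⟩ := hreal B δ hδ0 hB hBδ
    have hinf : infFn ν μ δ ≤ logRatio ν μ B :=
      (iInf₂_le B hBm).trans (iInf₂_le hB hBδ)
    refine hinf.trans ?_
    have hup := hle B hBm hB (ne_top_of_le_ne_top ENNReal.ofReal_ne_top hBδ)
    have htop := ne_top_of_le_ne_top ENNReal.ofReal_ne_top hup
    set t := (ν B).toReal
    have hct : 0 < c * t ^ γ := by positivity
    have h0 : μ B ≠ 0 := ((ENNReal.ofReal_pos.2 hct).trans_le hBμ).ne'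
    rw [logRatio, if_neg h0]
    have hμge : c * t ^ γ ≤ (μ B).toReal := (ENNReal.ofReal_le_iff_le_toReal htop).1 hBμ
    have hlog : Real.log c + γ * Real.log t ≤ Real.log (μ B).toReal := by
      rw [← Real.log_rpow ht0, ← Real.log_mul (by positivity) (by positivity)]
      exact Real.log_le_log hct hμge
    have hlt : Real.log t ≤ Real.log δ := Real.log_le_log ht0 htδ
    have hlδ : Real.log δ < 0 := Real.log_neg hδ0 hδ1
    apply ENNReal.ofReal_le_ofReal
    have h1 : Real.log c / Real.log t ≤ Real.log c / Real.log δ := by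
      rw [div_eq_mul_inv, div_eq_mul_inv]
      exact mul_le_mul_of_nonpos_left
        ((inv_le_inv_of_neg hlδ (hlt.trans_lt hlδ)).2 hlt) (Real.log_nonpos hc.le hc1)
    refine le_trans ?_ (add_le_add_right h1 γ)
    rw [div_le_iff_of_neg (hlt.trans_lt hlδ), add_mul,
      div_mul_cancel₀ _ (hlt.trans_lt hlδ).ne]
    linarith

/-- If sublevel sets of `ρ` satisfy `ν {ρ < s} ≤ A s ^ d`, then `ρ ^ (-β)` with `β < d` has
integral at most a constant times `s ^ (d - β)` over `{ρ < s}`. -/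
theorem lintegral_rpow_neg_sublevel_le {E : Type*} [MeasurableSpace E] (ν : Measure E)
    (ρ : E → ℝ) (hρ : Measurable ρ) (hρpos : ∀ᵐ x ∂ν, 0 < ρ x) (d β A : ℝ) (hβ0 : 0 ≤ β)
    (hβd : β < d) (hA0 : 0 ≤ A)
    (hA : ∀ s : ℝ, 0 < s → ν {x | ρ x < s} ≤ ENNReal.ofReal (A * s ^ d))
    (s : ℝ) (hs : 0 < s) :
    ∫⁻ x in {x | ρ x < s}, ENNReal.ofReal (ρ x ^ (-β)) ∂ν ≤
      ENNReal.ofReal (A * 2 ^ β * (1 - (1 / 2) ^ (d - β))⁻¹ * s ^ (d - β)) := by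
  set q : ℝ := (1 / 2) ^ (d - β) with hq
  have hq0 : 0 ≤ q := by positivity
  have hq1 : q < 1 := Real.rpow_lt_one (by norm_num) (by norm_num) (by linarith)
  have hmeas (r : ℝ) : MeasurableSet {x | ρ x < r} := measurableSet_lt hρ measurable_const
  set F : ℕ → E → ℝ≥0∞ := fun k =>
    {x | ρ x < s * (1 / 2) ^ k}.indicator
      fun _ => ENNReal.ofReal ((s * (1 / 2) ^ (k + 1)) ^ (-β)) with hF
  have hpt : ∀ᵐ x ∂ν.restrict {x | ρ x < s}, ENNReal.ofReal (ρ x ^ (-β)) ≤ ∑' k, F k x := by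
    filter_upwards [ae_restrict_mem (hmeas s), ae_restrict_of_ae hρpos] with x hx hx0
    have hxs : ρ x < s := hx
    obtain ⟨k, hk1, hk2⟩ : ∃ k : ℕ, s * (1 / 2) ^ (k + 1) ≤ ρ x ∧ ρ x < s * (1 / 2) ^ k := by
      have hex : ∃ k : ℕ, s * (1 / 2) ^ (k + 1) ≤ ρ x := by
        obtain ⟨k, hk⟩ := exists_pow_lt_of_lt_one (div_pos hx0 hs) (by norm_num : (1 / 2 : ℝ) < 1)
        refine ⟨k, ?_⟩
        rw [lt_div_iff₀ hs] at hk
        have : (1 / 2 : ℝ) ^ (k + 1) ≤ (1 / 2) ^ k :=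
          pow_le_pow_of_le_one (by norm_num) (by norm_num) k.le_succ
        nlinarith
      classical
      refine ⟨Nat.find hex, Nat.find_spec hex, ?_⟩
      rcases h0 : Nat.find hex with _ | m
      · simpa using hxs
      · exact not_le.1 (Nat.find_min hex (m := m) (by omega))
    refine le_trans ?_ (ENNReal.le_tsum k)
    simp only [hF]
    rw [Set.indicator_of_mem (show x ∈ {x | ρ x < s * (1 / 2) ^ k} from hk2)]
    exact ENNReal.ofReal_le_ofReal
      (Real.rpow_le_rpow_of_nonpos (by positivity) hk1 (by linarith))
  refine (lintegral_mono_ae hpt).trans ?_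
  rw [lintegral_tsum fun k => (measurable_const.indicator (hmeas _)).aemeasurable]
  have hterm (k : ℕ) : ∫⁻ x in {x | ρ x < s}, F k x ∂ν ≤
      ENNReal.ofReal (A * 2 ^ β * s ^ (d - β) * q ^ k) := by
    refine (setLIntegral_le_lintegral _ _).trans ?_
    rw [lintegral_indicator_const (hmeas _)]
    refine (mul_le_mul_right (hA _ (by positivity)) _).trans ?_
    rw [← ENNReal.ofReal_mul (by positivity)]
    apply le_of_eq
    congr 1
    have h2 : ((1 / 2 : ℝ) ^ k) ^ (d - β) = q ^ k := by
      rw [hq, ← Real.rpow_natCast, ← Real.rpow_natCast, ← Real.rpow_mul (by norm_num),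
        ← Real.rpow_mul (by norm_num), mul_comm]
    have h3 : (s * (1 / 2) ^ (k + 1)) ^ (-β) = 2 ^ β * (s * (1 / 2) ^ k) ^ (-β) := by
      rw [pow_succ, ← mul_assoc, Real.mul_rpow (by positivity) (by norm_num), mul_comm]
      congr 1
      rw [one_div, Real.inv_rpow (by norm_num), Real.rpow_neg (by norm_num), inv_inv]
    rw [h3, ← h2]
    have h4 : (s * (1 / 2) ^ k) ^ (-β) * (s * (1 / 2) ^ k) ^ d =
        s ^ (d - β) * ((1 / 2) ^ k) ^ (d - β) := by
      rw [← Real.rpow_add (by positivity), ← Real.mul_rpow (by positivity) (by positivity)]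
      congr 1
      ring
    linear_combination A * 2 ^ β * h4
  refine (ENNReal.tsum_le_tsum hterm).trans ?_
  rw [← ENNReal.ofReal_tsum_of_nonneg (fun k => by positivity)
    ((summable_geometric_of_lt_one hq0 hq1).mul_left _), tsum_mul_left,
    tsum_geometric_of_lt_one hq0 hq1]
  apply le_of_eq
  congr 1
  ring

/-- If `ν {ρ < s} ≤ A s ^ d` for all `s > 0`, then the measure with density `ρ ^ (-β)`, `β < d`,
is bounded by a constant times `ν ^ (1 - β / d)`. -/
theorem exists_setLIntegral_rpow_neg_le {E : Type*} [MeasurableSpace E] (ν : Measure E)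
    (ρ : E → ℝ) (hρ : Measurable ρ) (hρpos : ∀ᵐ x ∂ν, 0 < ρ x) (d β A : ℝ) (hβ0 : 0 ≤ β)
    (hβd : β < d) (hA0 : 0 ≤ A)
    (hA : ∀ s : ℝ, 0 < s → ν {x | ρ x < s} ≤ ENNReal.ofReal (A * s ^ d)) :
    ∃ D : ℝ, 0 ≤ D ∧ ∀ B, MeasurableSet B → 0 < ν B → ν B ≠ ∞ →
      ∫⁻ x in B, ENNReal.ofReal (ρ x ^ (-β)) ∂ν ≤
        ENNReal.ofReal (D * (ν B).toReal ^ (1 - β / d)) := by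
  have hq1 : (1 / 2 : ℝ) ^ (d - β) < 1 :=
    Real.rpow_lt_one (by norm_num) (by norm_num) (by linarith)
  have hd : 0 < d := by linarith
  set D₀ : ℝ := A * 2 ^ β * (1 - (1 / 2) ^ (d - β))⁻¹ with hD₀
  have hD₀0 : 0 ≤ D₀ := mul_nonneg (by positivity) (inv_nonneg.2 (by linarith))
  refine ⟨1 + D₀, by linarith, fun B hB hB0 hBtop => ?_⟩
  have ht0 : 0 < (ν B).toReal := ENNReal.toReal_pos hB0.ne' hBtop
  set t := (ν B).toReal with ht
  set s : ℝ := t ^ (1 / d) with hs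
  have hs0 : 0 < s := by positivity
  have hm : MeasurableSet {x | ρ x < s} := measurableSet_lt hρ measurable_const
  rw [← lintegral_inter_add_sdiff _ B hm]
  have h1 : ∫⁻ x in B ∩ {x | ρ x < s}, ENNReal.ofReal (ρ x ^ (-β)) ∂ν ≤
      ENNReal.ofReal (D₀ * s ^ (d - β)) :=
    (lintegral_mono_set Set.inter_subset_right).trans
      (lintegral_rpow_neg_sublevel_le ν ρ hρ hρpos d β A hβ0 hβd hA0 hA s hs0)
  have h2 : ∫⁻ x in B \ {x | ρ x < s}, ENNReal.ofReal (ρ x ^ (-β)) ∂ν ≤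
      ENNReal.ofReal (s ^ (-β) * t) := by
    calc _ ≤ ∫⁻ _ in B \ {x | ρ x < s}, ENNReal.ofReal (s ^ (-β)) ∂ν := by
          refine setLIntegral_mono_ae' (hB.diff hm) (.of_forall fun x hx => ?_)
          exact ENNReal.ofReal_le_ofReal
            (Real.rpow_le_rpow_of_nonpos hs0 (not_lt.1 hx.2) (by linarith))
      _ ≤ ENNReal.ofReal (s ^ (-β)) * ν B := by
          rw [setLIntegral_const]
          exact mul_le_mul_right (measure_mono Set.sdiff_subset) _
      _ = _ := by
          rw [ENNReal.ofReal_mul (by positivity), ht, ENNReal.ofReal_toReal hBtop]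
  refine (add_le_add h1 h2).trans ?_
  rw [← ENNReal.ofReal_add (by positivity) (by positivity)]
  apply le_of_eq
  congr 1
  have e1 : s ^ (d - β) = t ^ (1 - β / d) := by
    rw [hs, ← Real.rpow_mul ht0.le]
    congr 1
    field_simp
  have e2 : s ^ (-β) * t = t ^ (1 - β / d) := by
    rw [hs, ← Real.rpow_mul ht0.le]
    nth_rewrite 2 [← Real.rpow_one t]
    rw [← Real.rpow_add ht0]
    congr 1
    field_simp
    ring
  rw [e1, e2]
  ring

/-- The integral defining `Ifun` converges and is positive for `m > 0`. -/
theorem Ifun_pos {m σ : ℝ} (hm : 0 < m) (hσ : σ ∈ Set.Ioc (0 : ℝ) 1) : 0 < Ifun m σ := by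
  have hbeta : IntervalIntegrable
      (fun r : ℝ => r ^ (m - 1) * (1 - r) ^ ((1 / 2 : ℝ) - 1)) volume 0 1 := by
    have h := (Complex.betaIntegral_convergent (u := (m : ℂ)) (v := ((1 / 2 : ℝ) : ℂ))
      (by simpa using hm) (by rw [Complex.ofReal_re]; norm_num)).norm
    rw [intervalIntegrable_iff_integrableOn_Ioo_of_le zero_le_one] at h ⊢
    refine h.congr_fun (fun r hr => ?_) measurableSet_Ioo
    have h0 : (0 : ℝ) < r := hr.1
    have h1 : (0 : ℝ) < 1 - r := by linarith [hr.2]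
    have e1 : (1 : ℂ) - r = ((1 - r : ℝ) : ℂ) := by push_cast; rfl
    simp only [norm_mul]
    rw [e1, Complex.norm_cpow_eq_rpow_re_of_pos h0, Complex.norm_cpow_eq_rpow_re_of_pos h1]
    simp
  have hint : IntervalIntegrable
      (fun r : ℝ => r ^ (m - 1) / Real.sqrt (1 - r ^ 2)) volume 0 1 := by
    refine hbeta.mono_fun' ((measurable_id.pow_const _).div (by fun_prop)).aestronglyMeasurable ?_
    rw [Set.uIoc_of_le zero_le_one]
    filter_upwards [ae_restrict_mem measurableSet_Ioc] with r hr
    have h0 : (0 : ℝ) < r := hr.1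
    rw [Real.norm_of_nonneg (by positivity), div_eq_mul_inv]
    rcases hr.2.eq_or_lt with rfl | h1
    · rw [sub_self, one_pow, sub_self, Real.sqrt_zero, inv_zero]
      exact mul_le_mul_of_nonneg_left (Real.rpow_nonneg le_rfl _) (by positivity)
    · refine mul_le_mul_of_nonneg_left ?_ (by positivity)
      have h2 : 0 < 1 - r := by linarith
      rw [show (1 / 2 : ℝ) - 1 = -(1 / 2) by norm_num, Real.rpow_neg h2.le, ← Real.sqrt_eq_rpow]
      exact inv_anti₀ (Real.sqrt_pos.2 h2) (Real.sqrt_le_sqrt (by nlinarith))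
  refine intervalIntegral.intervalIntegral_pos_of_pos_on
    (hint.mono_set (Set.uIcc_subset_uIcc_left ?_)) (fun r hr => ?_) hσ.1
  · rw [Set.uIcc_of_le zero_le_one]
    exact ⟨hσ.1.le, hσ.2⟩
  · have h0 : 0 < r := hr.1
    have h1 : r < 1 := hr.2.trans_le hσ.2
    have : 0 < 1 - r ^ 2 := by nlinarith
    positivity

/-- A cap consists of the unit vectors in the open hemisphere around `a` whose angle to `a`
has sine less than `s`. -/
theorem mem_cap_iff {n : ℕ} {a z : EuclideanSpace ℝ (Fin (n + 1))} {s : ℝ} (hs0 : 0 < s) :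
    z ∈ cap n a s ↔ ‖z‖ = 1 ∧ 0 < ⟪z, a⟫ ∧ Real.sqrt (1 - ⟪z, a⟫ ^ 2) < s := by
  rw [cap, Set.mem_ofPred_eq, mem_sphere_zero_iff_norm]
  refine and_congr_right fun _ => ⟨fun hz => ?_, fun ⟨hz, hzs⟩ => ?_⟩
  · have hz0 := (Real.sqrt_nonneg _).trans_lt hz
    refine ⟨hz0, ?_⟩
    rw [Real.sqrt_lt' hz0] at hz
    rw [Real.sqrt_lt' hs0]
    linarith
  · rw [Real.sqrt_lt' hs0] at hzs
    rw [Real.sqrt_lt' hz]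
    linarith

theorem finrank_orthogonal_singleton_of_norm_eq_one {n : ℕ}
    {a : EuclideanSpace ℝ (Fin (n + 1))} (ha : ‖a‖ = 1) :
    Module.finrank ℝ (ℝ ∙ a)ᗮ = n := by
  have : Fact (Module.finrank ℝ (EuclideanSpace ℝ (Fin (n + 1))) = n + 1) := ⟨by simp⟩
  exact Submodule.finrank_orthogonal_span_singleton (by rintro rfl; simp at ha)

theorem isAddHaarMeasure_hausdorffMeasure_orthogonal_singleton {n : ℕ}
    {a : EuclideanSpace ℝ (Fin (n + 1))} (ha : ‖a‖ = 1) :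
    (μH[(n : ℝ)] : Measure (ℝ ∙ a)ᗮ).IsAddHaarMeasure := by
  have h : ((Module.finrank ℝ (ℝ ∙ a)ᗮ : ℕ) : ℝ) = n :=
    congrArg _ (finrank_orthogonal_singleton_of_norm_eq_one ha)
  rw [← h]
  infer_instance

theorem exists_le_hausdorffMeasure_cap {n : ℕ} {a : EuclideanSpace ℝ (Fin (n + 1))}
    (ha : ‖a‖ = 1) : ∃ A : ℝ, 0 < A ∧ ∀ s : ℝ, 0 < s → s ≤ 1 →
      ENNReal.ofReal (A * s ^ (n : ℝ)) ≤ μH[(n : ℝ)] (cap n a s) := by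
  have hHaar := isAddHaarMeasure_hausdorffMeasure_orthogonal_singleton ha
  set V := μH[(n : ℝ)] (Metric.ball (0 : (ℝ ∙ a)ᗮ) 1) with hV
  have hVtop : V ≠ ∞ := measure_ball_lt_top.ne
  have hV0 : V ≠ 0 := (Metric.measure_ball_pos _ _ one_pos).ne'
  refine ⟨V.toReal, ENNReal.toReal_pos hV0 hVtop, fun s hs0 hs1 => ?_⟩
  have hsub : Metric.ball (0 : (ℝ ∙ a)ᗮ) s ⊆
      (ℝ ∙ a)ᗮ.orthogonalProjectionOnto '' cap n a s := by
    intro y hy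
    have hys : ‖(y : EuclideanSpace ℝ (Fin (n + 1)))‖ < s := by simpa using hy
    have hya : ⟪(y : EuclideanSpace ℝ (Fin (n + 1))), a⟫ = 0 :=
      Submodule.mem_orthogonal_singleton_iff_inner_left.1 y.2
    have hy2 : ‖(y : EuclideanSpace ℝ (Fin (n + 1)))‖ ^ 2 < s ^ 2 := by
      gcongr
    have hnn : 0 < 1 - ‖(y : EuclideanSpace ℝ (Fin (n + 1)))‖ ^ 2 := by nlinarith
    set w : ℝ := Real.sqrt (1 - ‖(y : EuclideanSpace ℝ (Fin (n + 1)))‖ ^ 2) with hw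
    have hin : ⟪(y : EuclideanSpace ℝ (Fin (n + 1))) + w • a, a⟫ = w := by
      rw [inner_add_left, hya, real_inner_smul_left, real_inner_self_eq_norm_sq, ha]
      ring
    refine ⟨y + w • a, ⟨?_, ?_⟩, ?_⟩
    · rw [mem_sphere_zero_iff_norm, ← sq_eq_sq₀ (norm_nonneg _) zero_le_one,
        norm_add_sq_real, real_inner_smul_right, hya, norm_smul, ha, mul_one, Real.norm_eq_abs,
        sq_abs, hw, Real.sq_sqrt hnn.le]
      ring
    · rw [hin]
      exact Real.sqrt_lt_sqrt (by nlinarith) (by linarith)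
    · rw [map_add, map_smul, Submodule.orthogonalProjectionOnto_mem_subspace_eq_self,
        Submodule.orthogonalProjectionOnto_orthogonal_apply_eq_zero
          (Submodule.mem_span_singleton_self a)]
      simp
  calc ENNReal.ofReal (V.toReal * s ^ (n : ℝ))
      = μH[(n : ℝ)] (Metric.ball (0 : (ℝ ∙ a)ᗮ) s) := by
        rw [Measure.addHaar_ball_of_pos _ _ hs0, finrank_orthogonal_singleton_of_norm_eq_one ha, ← hV,
          ENNReal.ofReal_mul ENNReal.toReal_nonneg, ENNReal.ofReal_toReal hVtop,
          Real.rpow_natCast, mul_comm]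
    _ ≤ _ := (measure_mono hsub).trans
        (hausdorffMeasure_orthogonalProjectionOnto_le _ _ _ (Nat.cast_nonneg n))

theorem exists_hausdorffMeasure_cap_le {n : ℕ} {a : EuclideanSpace ℝ (Fin (n + 1))}
    (ha : ‖a‖ = 1) : ∃ A : ℝ, 0 ≤ A ∧ ∀ s : ℝ, 0 < s → s ≤ 1 →
      μH[(n : ℝ)] (cap n a s) ≤ ENNReal.ofReal (A * s ^ (n : ℝ)) := by
  have hfin : Module.finrank ℝ (ℝ ∙ (-a))ᗮ = n :=
    finrank_orthogonal_singleton_of_norm_eq_one (by rwa [norm_neg])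
  have hna : ‖-a‖ = 1 := by rwa [norm_neg]
  set T : (ℝ ∙ (-a))ᗮ → EuclideanSpace ℝ (Fin (n + 1)) := fun v => stereoInvFunAux (-a) v with hT
  have hTdiff : ContDiff ℝ 1 T :=
    contDiff_stereoInvFunAux.comp (ℝ ∙ (-a))ᗮ.subtypeL.contDiff
  obtain ⟨K, hK⟩ := (hTdiff.locallyLipschitz.locallyLipschitzOn).exists_lipschitzOnWith_of_compact
    (isCompact_closedBall (0 : (ℝ ∙ (-a))ᗮ) 2)
  have hsub (s : ℝ) (hs0 : 0 < s) (hs1 : s ≤ 1) :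
      cap n a s ⊆ T '' Metric.closedBall (0 : (ℝ ∙ (-a))ᗮ) (2 * s) := by
    intro z hz
    obtain ⟨hz1, hz0, hzs⟩ := (mem_cap_iff hs0).1 hz
    have hzna : z ≠ -a := by
      rintro rfl
      rw [inner_neg_left, real_inner_self_eq_norm_sq, ha] at hz0
      norm_num at hz0
    refine ⟨stereoToFun (-a) z, ?_, ?_⟩
    · have hproj : ‖(ℝ ∙ (-a))ᗮ.orthogonalProjectionOnto z‖ ^ 2 = 1 - ⟪z, a⟫ ^ 2 := by
        have h := Submodule.norm_sq_eq_add_norm_sq_starProjection z (ℝ ∙ (-a))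
        rw [Submodule.starProjection_unit_singleton ℝ hna, norm_smul, hna, inner_neg_left,
          real_inner_comm, hz1, mul_one, norm_neg, Real.norm_eq_abs, sq_abs,
          Submodule.starProjection_apply] at h
        rw [Submodule.coe_norm]
        linarith
      rw [mem_closedBall_zero_iff, stereoToFun_apply, norm_smul, innerSL_apply_apply,
        inner_neg_left, sub_neg_eq_add, real_inner_comm]
      have h2 : ‖(ℝ ∙ (-a))ᗮ.orthogonalProjectionOnto z‖ ≤ s := by
        rw [← hproj, Real.sqrt_sq (norm_nonneg _)] at hzs
        exact hzs.le
      have h3 : ‖(2 : ℝ) / (1 + ⟪z, a⟫)‖ ≤ 2 := by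
        rw [Real.norm_of_nonneg (by positivity)]
        exact div_le_self zero_le_two (by linarith)
      exact mul_le_mul h3 h2 (norm_nonneg _) zero_le_two
    · exact congrArg Subtype.val
        (stereo_left_inv hna (x := ⟨z, mem_sphere_zero_iff_norm.2 hz1⟩) hzna)
  set V := μH[(n : ℝ)] (Metric.ball (0 : (ℝ ∙ (-a))ᗮ) 1) with hV
  have hHaar : (μH[(n : ℝ)] : Measure (ℝ ∙ (-a))ᗮ).IsAddHaarMeasure :=
    isAddHaarMeasure_hausdorffMeasure_orthogonal_singleton hna
  have hVtop : V ≠ ∞ := measure_ball_lt_top.ne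
  refine ⟨(K : ℝ) ^ (n : ℝ) * 2 ^ (n : ℝ) * V.toReal, by positivity, fun s hs0 hs1 => ?_⟩
  calc μH[(n : ℝ)] (cap n a s)
      ≤ μH[(n : ℝ)] (T '' Metric.closedBall (0 : (ℝ ∙ (-a))ᗮ) (2 * s)) :=
        measure_mono (hsub s hs0 hs1)
    _ ≤ (K : ℝ≥0∞) ^ (n : ℝ) * μH[(n : ℝ)] (Metric.closedBall (0 : (ℝ ∙ (-a))ᗮ) (2 * s)) :=
        (hK.mono (Metric.closedBall_subset_closedBall (by linarith))).hausdorffMeasure_image_le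
          (Nat.cast_nonneg n)
    _ = ENNReal.ofReal ((K : ℝ) ^ (n : ℝ) * 2 ^ (n : ℝ) * V.toReal * s ^ (n : ℝ)) := by
        rw [Measure.addHaar_closedBall _ _ (by positivity), hfin, ← hV]
        nth_rewrite 1 [← ENNReal.ofReal_toReal hVtop]
        rw [← ENNReal.ofReal_coe_nnreal,
          ENNReal.ofReal_rpow_of_nonneg (by positivity) (by positivity),
          ← ENNReal.ofReal_mul (by positivity), ← ENNReal.ofReal_mul (by positivity)]
        congr 1
        simp only [Real.rpow_natCast]
        ring

/-- If `ν {ρ < s}` is comparable to `s ^ d` and `f` is comparable to `ρ ^ (-β)` with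
`0 ≤ β < d`, then the smoothness parameter of `ν.withDensity f` relative to `ν` is `1 - β / d`. -/
theorem tendsto_infFn_withDensity {E : Type*} [MeasurableSpace E] (ν : Measure E)
    (ρ f : E → ℝ) (hρ : Measurable ρ) (hρpos : ∀ᵐ x ∂ν, 0 < ρ x)
    (d β A A' c c' σ : ℝ) (hβ0 : 0 ≤ β) (hβd : β < d) (hA0 : 0 < A) (hA'0 : 0 ≤ A')
    (hc0 : 0 < c) (hc'0 : 0 ≤ c') (hσ : 0 < σ)
    (hA : ∀ s : ℝ, 0 < s → s ≤ σ → ENNReal.ofReal (A * s ^ d) ≤ ν {x | ρ x < s})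
    (hA' : ∀ s : ℝ, 0 < s → ν {x | ρ x < s} ≤ ENNReal.ofReal (A' * s ^ d))
    (hc : ∀ᵐ x ∂ν, c * ρ x ^ (-β) ≤ f x) (hc' : ∀ᵐ x ∂ν, f x ≤ c' * ρ x ^ (-β)) :
    Tendsto (infFn ν (ν.withDensity fun x => ENNReal.ofReal (f x)))
      (nhdsWithin 0 (Set.Ioi (0 : ℝ))) (nhds (ENNReal.ofReal (1 - β / d))) := by
  have hd : 0 < d := by linarith
  obtain ⟨D, hD0, hD⟩ :=
    exists_setLIntegral_rpow_neg_le ν ρ hρ hρpos d β A' hβ0 hβd hA'0 hA'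
  refine tendsto_infFn_of_rpow_bounds _ _ _ (max 1 (c' * D)) (min 1 (c * A ^ (β / d)))
    (le_max_left _ _) (by positivity) (min_le_left _ _) (fun B hB hB0 hBtop => ?_) fun δ hδ => ?_
  · rw [withDensity_apply _ hB]
    calc ∫⁻ x in B, ENNReal.ofReal (f x) ∂ν
        ≤ ∫⁻ x in B, ENNReal.ofReal c' * ENNReal.ofReal (ρ x ^ (-β)) ∂ν := by
          refine lintegral_mono_ae (ae_restrict_of_ae ?_)
          filter_upwards [hc'] with x hx
          rw [← ENNReal.ofReal_mul hc'0]
          exact ENNReal.ofReal_le_ofReal hx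
      _ = ENNReal.ofReal c' * ∫⁻ x in B, ENNReal.ofReal (ρ x ^ (-β)) ∂ν :=
          lintegral_const_mul _ (hρ.pow_const _).ennreal_ofReal
      _ ≤ ENNReal.ofReal c' * ENNReal.ofReal (D * (ν B).toReal ^ (1 - β / d)) :=
          mul_le_mul_right (hD B hB hB0 hBtop) _
      _ ≤ _ := by
          rw [← ENNReal.ofReal_mul hc'0, ← mul_assoc]
          exact ENNReal.ofReal_le_ofReal
            (mul_le_mul_of_nonneg_right (le_max_right _ _) (by positivity))
  · set s : ℝ := min σ ((δ / (A' + 1)) ^ (1 / d)) with hs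
    have hs0 : 0 < s := lt_min hσ (by positivity)
    have hsδ : A' * s ^ d ≤ δ := by
      have h1 : s ^ d ≤ δ / (A' + 1) := by
        calc s ^ d ≤ ((δ / (A' + 1)) ^ (1 / d)) ^ d :=
              Real.rpow_le_rpow hs0.le (min_le_right _ _) hd.le
          _ = δ / (A' + 1) := by
              rw [← Real.rpow_mul (by positivity), one_div_mul_cancel hd.ne', Real.rpow_one]
      rw [le_div_iff₀ (by positivity)] at h1
      nlinarith [Real.rpow_pos_of_pos hs0 d]
    have hm : MeasurableSet {x | ρ x < s} := measurableSet_lt hρ measurable_const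
    have hlow := hA s hs0 (min_le_left _ _)
    have hup := hA' s hs0
    have htop : ν {x | ρ x < s} ≠ ∞ := ne_top_of_le_ne_top ENNReal.ofReal_ne_top hup
    have hAs : 0 < A * s ^ d := by positivity
    refine ⟨{x | ρ x < s}, hm, (ENNReal.ofReal_pos.2 hAs).trans_le hlow,
      hup.trans (ENNReal.ofReal_le_ofReal hsδ), ?_⟩
    rw [withDensity_apply _ hm]
    have ht : A * s ^ d ≤ (ν {x | ρ x < s}).toReal :=
      (ENNReal.ofReal_le_iff_le_toReal htop).1 hlow
    have ht0 := hAs.trans_le ht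
    calc ENNReal.ofReal (min 1 (c * A ^ (β / d)) * (ν {x | ρ x < s}).toReal ^ (1 - β / d))
        ≤ ENNReal.ofReal (c * s ^ (-β) * (ν {x | ρ x < s}).toReal) := by
          apply ENNReal.ofReal_le_ofReal
          set t := (ν {x | ρ x < s}).toReal
          have h1 : A ^ (β / d) * t ^ (-(β / d)) ≤ s ^ (-β) := by
            calc A ^ (β / d) * t ^ (-(β / d)) ≤ A ^ (β / d) * (A * s ^ d) ^ (-(β / d)) :=
                  mul_le_mul_of_nonneg_left
                    (Real.rpow_le_rpow_of_nonpos hAs ht (by simp only [neg_nonpos]; positivity))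
                    (by positivity)
              _ = s ^ (-β) := by
                  rw [Real.mul_rpow hA0.le (by positivity), ← mul_assoc, ← Real.rpow_add hA0,
                    add_neg_cancel, Real.rpow_zero, one_mul, ← Real.rpow_mul hs0.le]
                  congr 1
                  field_simp
          have h2 : t ^ (1 - β / d) = t ^ (-(β / d)) * t := by
            rw [sub_eq_neg_add, Real.rpow_add ht0, Real.rpow_one]
          rw [h2]
          calc min 1 (c * A ^ (β / d)) * (t ^ (-(β / d)) * t)
              ≤ c * A ^ (β / d) * (t ^ (-(β / d)) * t) :=
                mul_le_mul_of_nonneg_right (min_le_right _ _) (by positivity)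
            _ = c * (A ^ (β / d) * t ^ (-(β / d))) * t := by ring
            _ ≤ c * s ^ (-β) * t := by gcongr
      _ = ∫⁻ _ in {x | ρ x < s}, ENNReal.ofReal (c * s ^ (-β)) ∂ν := by
          rw [setLIntegral_const, ENNReal.ofReal_mul (by positivity), ENNReal.ofReal_toReal htop]
      _ ≤ _ := by
          refine lintegral_mono_ae ?_
          filter_upwards [ae_restrict_mem hm, ae_restrict_of_ae hρpos, ae_restrict_of_ae hc]
            with x hxs hx0 hxc
          refine ENNReal.ofReal_le_ofReal (le_trans ?_ hxc)
          exact mul_le_mul_of_nonneg_left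
            (Real.rpow_le_rpow_of_nonpos hx0 (le_of_lt hxs) (by linarith)) hc0.le

/-- The smoothness parameter of the adversarial measure `μ` with respect to
`ν_{a,σ}` equals `α_{ν_{a,σ}}(μ) = lim_{δ→0⁺} inf(δ) = 1 - β/n`. -/
theorem stmt12 (n : ℕ) (hn : 1 ≤ n)
    (a : EuclideanSpace ℝ (Fin (n + 1)))
    (ha : a ∈ Metric.sphere (0 : EuclideanSpace ℝ (Fin (n + 1))) 1)
    (σ : ℝ) (hσ : σ ∈ Set.Ioc (0:ℝ) 1)
    (β : ℝ) (hβ0 : 0 ≤ β) (hβn : β < n)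
    (h : ℝ → ℝ) (hcont : ContinuousOn h (Set.Icc 0 σ))
    (hpos : ∀ r ∈ Set.Icc (0:ℝ) σ, 0 < h r)
    (hint : (∫ r in (0:ℝ)..σ, h r * (r ^ ((n : ℝ) - β - 1) / Real.sqrt (1 - r ^ 2)))
      = Ifun ((n : ℝ) - β) σ)
    (hmono : AntitoneOn (gFun n σ β h) (Set.Ioc 0 σ)) :
    Tendsto (infFn (nuMeasure n a σ) (advMeasure n a σ β h))
      (nhdsWithin 0 (Set.Ioi (0:ℝ))) (nhds (ENNReal.ofReal (1 - β / n))) := by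
  have ha1 : ‖a‖ = 1 := mem_sphere_zero_iff_norm.1 ha
  obtain ⟨hσ0, hσ1⟩ := hσ
  have hn0 : (0 : ℝ) < n := by exact_mod_cast hn
  obtain ⟨A, hA0, hA⟩ := exists_le_hausdorffMeasure_cap ha1
  obtain ⟨A', hA'0, hA'⟩ := exists_hausdorffMeasure_cap_le ha1
  set M := μH[(n : ℝ)] (cap n a σ) with hM
  have hM0 : M ≠ 0 :=
    ((ENNReal.ofReal_pos.2 (by positivity)).trans_le (hA σ hσ0 hσ1)).ne'
  have hMtop : M ≠ ∞ := ne_top_of_le_ne_top ENNReal.ofReal_ne_top (hA' σ hσ0 hσ1)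
  have hMinv : M⁻¹ = ENNReal.ofReal M.toReal⁻¹ := by
    rw [← ENNReal.toReal_inv, ENNReal.ofReal_toReal (ENNReal.inv_ne_top.2 hM0)]
  have hMpos : 0 < M.toReal := ENNReal.toReal_pos hM0 hMtop
  set ρ : EuclideanSpace ℝ (Fin (n + 1)) → ℝ := fun z => Real.sqrt (1 - ⟪z, a⟫ ^ 2) with hρdef
  have hρ : Measurable ρ := by fun_prop
  have hcapm : MeasurableSet (cap n a σ) :=
    Metric.isClosed_sphere.measurableSet.inter
      (measurableSet_lt measurable_const
        (measurable_id.inner_const (𝕜 := ℝ) (c := a)))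
  have hνle {p : EuclideanSpace ℝ (Fin (n + 1)) → Prop}
      (hp : ∀ᵐ z ∂(μH[(n : ℝ)]).restrict (cap n a σ), p z) : ∀ᵐ z ∂nuMeasure n a σ, p z :=
    Measure.ae_smul_measure hp _
  have hνcap : ∀ᵐ z ∂nuMeasure n a σ, z ∈ cap n a σ := hνle (ae_restrict_mem hcapm)
  have hρpos : ∀ᵐ z ∂nuMeasure n a σ, 0 < ρ z := by
    have hne : ∀ᵐ z ∂nuMeasure n a σ, z ≠ a := by
      have := Measure.nullSingletonClass_hausdorff (EuclideanSpace ℝ (Fin (n + 1))) hn0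
      exact hνle (ae_restrict_of_ae (Measure.ae_ne _ a))
    filter_upwards [hνcap, hne] with z hz hza
    obtain ⟨hz1, hz0, -⟩ := (mem_cap_iff hσ0).1 hz
    have hlt : ⟪z, a⟫ < 1 := (inner_lt_one_iff_real_of_norm_eq_one hz1 ha1).2 hza
    exact Real.sqrt_pos.2 (by nlinarith)
  have hνs (s : ℝ) (hs0 : 0 < s) :
      nuMeasure n a σ {z | ρ z < s} = M⁻¹ * μH[(n : ℝ)] (cap n a (min s σ)) := by
    rw [nuMeasure, Measure.smul_apply, smul_eq_mul, ← hM,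
      Measure.restrict_apply (measurableSet_lt hρ measurable_const)]
    congr 2
    ext z
    rw [Set.mem_inter_iff, mem_cap_iff hσ0, mem_cap_iff (lt_min hs0 hσ0), lt_min_iff]
    exact ⟨fun ⟨h1, h2, h3, h4⟩ => ⟨h2, h3, h1, h4⟩, fun ⟨h2, h3, h1, h4⟩ => ⟨h1, h2, h3, h4⟩⟩
  set I := Ifun n σ / Ifun ((n : ℝ) - β) σ with hI
  have hI0 : 0 < I := div_pos (Ifun_pos hn0 ⟨hσ0, hσ1⟩) (Ifun_pos (by linarith) ⟨hσ0, hσ1⟩)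
  have hne : (Set.Icc 0 σ).Nonempty := ⟨0, le_rfl, hσ0.le⟩
  obtain ⟨r₀, hr₀, hmin⟩ := isCompact_Icc.exists_isMinOn hne hcont
  obtain ⟨r₁, hr₁, hmax⟩ := isCompact_Icc.exists_isMaxOn hne hcont
  have hρIcc : ∀ᵐ z ∂nuMeasure n a σ, ρ z ∈ Set.Icc 0 σ := by
    filter_upwards [hνcap] with z hz
    exact ⟨Real.sqrt_nonneg _, ((mem_cap_iff hσ0).1 hz).2.2.le⟩
  have hrpow (z : EuclideanSpace ℝ (Fin (n + 1))) : 0 ≤ ρ z ^ (-β) :=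
    Real.rpow_nonneg (Real.sqrt_nonneg _) _
  refine tendsto_infFn_withDensity (nuMeasure n a σ) ρ (fun z => gFun n σ β h (ρ z)) hρ hρpos
    n β (M.toReal⁻¹ * A) (M.toReal⁻¹ * A') (I * h r₀) (I * h r₁) σ hβ0 hβn (by positivity)
    (by positivity) (mul_pos hI0 (hpos _ hr₀)) (mul_pos hI0 (hpos _ hr₁)).le hσ0 ?_ ?_ ?_ ?_
  · intro s hs0 hsσ
    rw [hνs s hs0, min_eq_left hsσ, mul_assoc, ENNReal.ofReal_mul (by positivity), ← hMinv]
    exact mul_le_mul_right (hA s hs0 (hsσ.trans hσ1)) _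
  · intro s hs0
    rw [hνs s hs0, mul_assoc, ENNReal.ofReal_mul (by positivity), ← hMinv]
    refine mul_le_mul_right ((hA' _ (lt_min hs0 hσ0) ((min_le_right _ _).trans hσ1)).trans ?_) _
    gcongr
    exact min_le_left _ _
  · filter_upwards [hρIcc] with z hz
    rw [gFun, ← hI, mul_right_comm]
    exact mul_le_mul_of_nonneg_left (hmin hz) (mul_nonneg hI0.le (hrpow z))
  · filter_upwards [hρIcc] with z hz
    rw [gFun, ← hI, mul_right_comm I (h r₁)]
    exact mul_le_mul_of_nonneg_left (hmax hz) (mul_nonneg hI0.le (hrpow z))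
end

section
/- Let ε ∈ (0, 1 - β/n). Then every Borel set B ⊆ Sⁿ with ν_{a,σ}(B) ≤ δ_ε satisfies μ(B) ≤ (ν_{a,σ}(B))^{1 - β/n - ε}. -/
open MeasureTheory Filter
open scoped RealInnerProductSpace ENNReal

lemma one_sub_sq_pos {r : ℝ} (h0 : 0 ≤ r) (h1 : r < 1) : 0 < 1 - r ^ 2 := by nlinarith

lemma intervalIntegrable_rpow_div_sqrt {m : ℝ} (hm : 0 < m) :
    IntervalIntegrable (fun r : ℝ => r ^ (m - 1) / Real.sqrt (1 - r ^ 2)) volume 0 1 := by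
  have h1 : IntervalIntegrable (fun r : ℝ => r ^ (m - 1)) volume 0 1 :=
    intervalIntegral.intervalIntegrable_rpow' (by linarith)
  have h2 : IntervalIntegrable (fun r : ℝ => (1 - r) ^ (-(1 / 2) : ℝ)) volume 0 1 := by
    have := (intervalIntegral.intervalIntegrable_rpow' (a := 0) (b := 1)
      (r := (-(1 / 2) : ℝ)) (by norm_num)).comp_sub_left 1
    simpa using this.symm
  refine ((h1.const_mul 2).add (h2.const_mul 2)).mono_fun'
    (Measurable.aestronglyMeasurable (by fun_prop)) ?_
  rw [Set.uIoc_of_le zero_le_one, ← restrict_Ioo_eq_restrict_Ioc]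
  filter_upwards [ae_restrict_mem measurableSet_Ioo] with r ⟨hr0, hr1⟩
  have hw := one_sub_sq_pos hr0.le hr1
  have hs := Real.sqrt_pos.2 hw
  have hp : 0 < r ^ (m - 1) := Real.rpow_pos_of_pos hr0 _
  have hq : 0 < (1 - r) ^ (-(1 / 2) : ℝ) := Real.rpow_pos_of_pos (by linarith) _
  rw [Real.norm_of_nonneg (by positivity)]
  rcases le_total r (1 / 2) with hr | hr
  · have : 1 / 2 ≤ Real.sqrt (1 - r ^ 2) := Real.le_sqrt_of_sq_le (by nlinarith)
    have : r ^ (m - 1) / Real.sqrt (1 - r ^ 2) ≤ 2 * r ^ (m - 1) := by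
      rw [div_le_iff₀ hs]; nlinarith
    linarith
  · have h2 : r ^ (m - 1) ≤ 2 := by
      rcases le_total 1 m with h | h
      · exact (Real.rpow_le_one hr0.le hr1.le (by linarith)).trans one_le_two
      · calc r ^ (m - 1) ≤ (1 / 2 : ℝ) ^ (m - 1) :=
              Real.rpow_le_rpow_of_nonpos (by norm_num) hr (by linarith)
          _ ≤ (1 / 2 : ℝ) ^ (-1 : ℝ) :=
              Real.rpow_le_rpow_of_exponent_ge (by norm_num) (by norm_num) (by linarith)
          _ = 2 := by rw [Real.rpow_neg_one]; norm_num
    have h3 : (Real.sqrt (1 - r ^ 2))⁻¹ ≤ (1 - r) ^ (-(1 / 2) : ℝ) := by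
      rw [Real.rpow_neg (by linarith), ← Real.sqrt_eq_rpow]
      exact inv_anti₀ (Real.sqrt_pos.2 (by linarith)) (Real.sqrt_le_sqrt (by nlinarith))
    have h4 : r ^ (m - 1) / Real.sqrt (1 - r ^ 2) ≤ 2 * (1 - r) ^ (-(1 / 2) : ℝ) := by
      rw [div_eq_mul_inv]; gcongr
    linarith

lemma intervalIntegrable_rpow_div_sqrt_of_le {m a b : ℝ} (hm : 0 < m) (ha : 0 ≤ a) (hab : a ≤ b)
    (hb : b ≤ 1) :
    IntervalIntegrable (fun r : ℝ => r ^ (m - 1) / Real.sqrt (1 - r ^ 2)) volume a b :=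
  (intervalIntegrable_rpow_div_sqrt hm).mono_set (by
    rw [Set.uIcc_of_le hab, Set.uIcc_of_le zero_le_one]; exact Set.Icc_subset_Icc ha hb)

lemma Ifun_zero (m : ℝ) : Ifun m 0 = 0 := by simp [Ifun]

lemma continuousOn_Ifun {m : ℝ} (hm : 0 < m) : ContinuousOn (Ifun m) (Set.Icc 0 1) := by
  have := intervalIntegral.continuousOn_primitive_interval'
    (intervalIntegrable_rpow_div_sqrt hm) Set.left_mem_uIcc
  rwa [Set.uIcc_of_le zero_le_one] at this

lemma hasDerivAt_Ifun {m ρ : ℝ} (hm : 0 < m) (h0 : 0 < ρ) (h1 : ρ < 1) :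
    HasDerivAt (Ifun m) (ρ ^ (m - 1) / Real.sqrt (1 - ρ ^ 2)) ρ := by
  have hs := Real.sqrt_pos.2 (one_sub_sq_pos h0.le h1)
  refine intervalIntegral.integral_hasDerivAt_right
    (intervalIntegrable_rpow_div_sqrt_of_le hm le_rfl h0.le h1.le)
    (Measurable.stronglyMeasurable (by fun_prop)).stronglyMeasurableAtFilter ?_
  exact (Real.continuousAt_rpow_const _ _ (Or.inl h0.ne')).div (by fun_prop) hs.ne'

lemma Ifun_pos_s13 {m ρ : ℝ} (hm : 0 < m) (h0 : 0 < ρ) (h1 : ρ ≤ 1) : 0 < Ifun m ρ := by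
  refine intervalIntegral.intervalIntegral_pos_of_pos_on
    (intervalIntegrable_rpow_div_sqrt_of_le hm le_rfl h0.le h1) (fun r hr => ?_) h0
  have hs := Real.sqrt_pos.2 (one_sub_sq_pos hr.1.le (hr.2.trans_le h1))
  have hp : 0 < r ^ (m - 1) := Real.rpow_pos_of_pos hr.1 _
  positivity

lemma Ifun_mul_le {m c σ : ℝ} (hm : 0 < m) (hc0 : 0 ≤ c) (hc1 : c ≤ 1) (hσ0 : 0 ≤ σ)
    (hσ1 : σ ≤ 1) : Ifun m (σ * c) ≤ c ^ m * Ifun m σ := by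
  rcases hc0.eq_or_lt with rfl | hc0
  · simp [Ifun_zero, Real.zero_rpow hm.ne']
  have hI := intervalIntegrable_rpow_div_sqrt_of_le hm le_rfl
    (mul_nonneg hc0.le hσ0) (by nlinarith : c * σ ≤ 1)
  have h := intervalIntegral.integral_comp_mul_left (a := 0) (b := σ)
    (fun r : ℝ => r ^ (m - 1) / Real.sqrt (1 - r ^ 2)) hc0.ne'
  have hle : (∫ x in (0 : ℝ)..σ, (c * x) ^ (m - 1) / Real.sqrt (1 - (c * x) ^ 2)) ≤
      ∫ x in (0 : ℝ)..σ, c ^ (m - 1) * (x ^ (m - 1) / Real.sqrt (1 - x ^ 2)) := by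
    refine intervalIntegral.integral_mono_on_of_le_Ioo hσ0 ?_
      ((intervalIntegrable_rpow_div_sqrt_of_le hm le_rfl hσ0 hσ1).const_mul _) ?_
    · have := hI.comp_mul_left (c := c)
      simpa [hc0.ne'] using this
    · intro x hx
      have hs := Real.sqrt_pos.2 (one_sub_sq_pos hx.1.le (hx.2.trans_le hσ1))
      have hp : 0 < x ^ (m - 1) := Real.rpow_pos_of_pos hx.1 _
      have hp' : 0 < c ^ (m - 1) := Real.rpow_pos_of_pos hc0 _
      rw [Real.mul_rpow hc0.le hx.1.le, mul_div_assoc]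
      gcongr
      all_goals nlinarith [hx.1]
  rw [intervalIntegral.integral_const_mul] at hle
  simp only [mul_zero, smul_eq_mul] at h
  rw [h, inv_mul_le_iff₀ hc0, ← mul_assoc] at hle
  have hcm : c * c ^ (m - 1) = c ^ m := by
    rw [mul_comm, Real.rpow_sub_one hc0.ne']; field_simp
  rw [hcm, mul_comm c σ] at hle
  exact hle

lemma mul_Ifun_le {m ρ : ℝ} (hm : 0 < m) (h0 : 0 ≤ ρ) (h1 : ρ < 1) :
    m * Ifun m ρ ≤ ρ ^ m / Real.sqrt (1 - ρ ^ 2) := by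
  have hs := Real.sqrt_pos.2 (one_sub_sq_pos h0 h1)
  have hle : Ifun m ρ ≤ ∫ x in (0 : ℝ)..ρ, x ^ (m - 1) / Real.sqrt (1 - ρ ^ 2) := by
    refine intervalIntegral.integral_mono_on_of_le_Ioo h0
      (intervalIntegrable_rpow_div_sqrt_of_le hm le_rfl h0 h1.le)
      ((intervalIntegral.intervalIntegrable_rpow' (by linarith)).div_const _) ?_
    intro x hx
    have hp : 0 < x ^ (m - 1) := Real.rpow_pos_of_pos hx.1 _
    gcongr
    · exact hx.1.le
    · exact hx.2.le
  rw [intervalIntegral.integral_div, integral_rpow (Or.inl (by linarith)),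
    sub_add_cancel, Real.zero_rpow hm.ne', sub_zero] at hle
  calc m * Ifun m ρ ≤ m * (ρ ^ m / m / Real.sqrt (1 - ρ ^ 2)) := by gcongr
    _ = _ := by field_simp

lemma rpow_mul_Ifun_le {m n ρ : ℝ} (hm : 0 < m) (hmn : m ≤ n) (h0 : 0 ≤ ρ) (h1 : ρ < 1) :
    ρ ^ (n - m) * (m * Ifun m ρ) ≤ n * Ifun n ρ := by
  rcases hmn.eq_or_lt with rfl | hlt
  · simp
  have hn := hm.trans hlt
  have hcont : ContinuousOn (fun x => n * Ifun n x - x ^ (n - m) * (m * Ifun m x))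
      (Set.Icc 0 ρ) := by
    have hsub : Set.Icc 0 ρ ⊆ Set.Icc 0 1 := Set.Icc_subset_Icc_right h1.le
    refine (continuousOn_const.mul ((continuousOn_Ifun hn).mono hsub)).sub
      (ContinuousOn.mul ?_ (continuousOn_const.mul ((continuousOn_Ifun hm).mono hsub)))
    exact (Real.continuous_rpow_const (by linarith)).continuousOn
  have hder : ∀ x ∈ interior (Set.Icc 0 ρ),
      HasDerivAt (fun x => n * Ifun n x - x ^ (n - m) * (m * Ifun m x))
        (n * (x ^ (n - 1) / Real.sqrt (1 - x ^ 2)) - ((n - m) * x ^ (n - m - 1) * (m * Ifun m x)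
          + x ^ (n - m) * (m * (x ^ (m - 1) / Real.sqrt (1 - x ^ 2))))) x := by
    intro x hx
    rw [interior_Icc] at hx
    have hx1 := hx.2.trans h1
    exact ((hasDerivAt_Ifun hn hx.1 hx1).const_mul n).sub
      ((Real.hasDerivAt_rpow_const (Or.inl hx.1.ne')).mul
        ((hasDerivAt_Ifun hm hx.1 hx1).const_mul m))
  have hmono := monotoneOn_of_deriv_nonneg (convex_Icc 0 ρ) hcont
    (fun x hx => (hder x hx).differentiableAt.differentiableWithinAt) (fun x hx => by
      rw [(hder x hx).deriv]
      rw [interior_Icc] at hx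
      have hx1 := hx.2.trans h1
      have e1 : x ^ (n - m) * x ^ (m - 1) = x ^ (n - 1) := by
        rw [← Real.rpow_add hx.1]; ring_nf
      have e2 : x ^ (n - m - 1) * x ^ m = x ^ (n - 1) := by
        rw [← Real.rpow_add hx.1]; ring_nf
      have hp : 0 < x ^ (n - m - 1) := Real.rpow_pos_of_pos hx.1 _
      have hle := mul_le_mul_of_nonneg_left (mul_Ifun_le hm hx.1.le hx1)
        (mul_nonneg (sub_nonneg.2 hlt.le) hp.le)
      have e3 : (n - m) * x ^ (n - m - 1) * (x ^ m / Real.sqrt (1 - x ^ 2)) =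
          (n - m) * (x ^ (n - 1) / Real.sqrt (1 - x ^ 2)) := by rw [← e2]; ring
      have e4 : x ^ (n - m) * (m * (x ^ (m - 1) / Real.sqrt (1 - x ^ 2))) =
          m * (x ^ (n - 1) / Real.sqrt (1 - x ^ 2)) := by rw [← e1]; ring
      rw [e3] at hle
      rw [e4]
      linarith)
  have := hmono (Set.left_mem_Icc.2 h0) (Set.right_mem_Icc.2 h0) h0
  simp only [Ifun_zero] at this
  linarith

lemma Ifun_div_le_rpow {m n ρ σ : ℝ} (hm : 0 < m) (hmn : m ≤ n) (h0 : 0 < ρ) (hρσ : ρ ≤ σ)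
    (hσ : σ ≤ 1) : Ifun m ρ / Ifun m σ ≤ (Ifun n ρ / Ifun n σ) ^ (m / n) := by
  have hn := hm.trans_le hmn
  have hσ0 := h0.trans_le hρσ
  have hsub : Set.Ioc 0 σ ⊆ Set.Icc 0 1 := fun x hx => ⟨hx.1.le, hx.2.trans hσ⟩
  have hder : ∀ x ∈ interior (Set.Ioc 0 σ),
      HasDerivAt (fun x => n * Real.log (Ifun m x) - m * Real.log (Ifun n x))
        (n * ((x ^ (m - 1) / Real.sqrt (1 - x ^ 2)) / Ifun m x) -
          m * ((x ^ (n - 1) / Real.sqrt (1 - x ^ 2)) / Ifun n x)) x := by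
    intro x hx
    rw [interior_Ioc] at hx
    have hx1 := hx.2.trans_le hσ
    exact (((hasDerivAt_Ifun hm hx.1 hx1).log (Ifun_pos_s13 hm hx.1 hx1.le).ne').const_mul n).sub
      (((hasDerivAt_Ifun hn hx.1 hx1).log (Ifun_pos_s13 hn hx.1 hx1.le).ne').const_mul m)
  have hmono := monotoneOn_of_deriv_nonneg (convex_Ioc 0 σ)
    (f := fun x => n * Real.log (Ifun m x) - m * Real.log (Ifun n x))
    ((continuousOn_const.mul (((continuousOn_Ifun hm).mono hsub).log
        fun x hx => (Ifun_pos_s13 hm hx.1 (hx.2.trans hσ)).ne')).sub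
      (continuousOn_const.mul (((continuousOn_Ifun hn).mono hsub).log
        fun x hx => (Ifun_pos_s13 hn hx.1 (hx.2.trans hσ)).ne')))
    (fun x hx => (hder x hx).differentiableAt.differentiableWithinAt) (fun x hx => by
      rw [(hder x hx).deriv]
      rw [interior_Ioc] at hx
      have hx1 := hx.2.trans_le hσ
      have hs := Real.sqrt_pos.2 (one_sub_sq_pos hx.1.le hx1)
      have pm := Ifun_pos_s13 hm hx.1 hx1.le
      have pn := Ifun_pos_s13 hn hx.1 hx1.le
      have hp : 0 < x ^ (m - 1) := Real.rpow_pos_of_pos hx.1 _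
      have e1 : x ^ (n - m) * x ^ (m - 1) = x ^ (n - 1) := by
        rw [← Real.rpow_add hx.1]; ring_nf
      have hle := rpow_mul_Ifun_le hm hmn hx.1.le hx1
      have : n * ((x ^ (m - 1) / Real.sqrt (1 - x ^ 2)) / Ifun m x) -
          m * ((x ^ (n - 1) / Real.sqrt (1 - x ^ 2)) / Ifun n x) =
          x ^ (m - 1) / Real.sqrt (1 - x ^ 2) / (Ifun m x * Ifun n x) *
            (n * Ifun n x - x ^ (n - m) * (m * Ifun m x)) := by
        rw [← e1]; field_simp
      rw [this]
      exact mul_nonneg (by positivity) (sub_nonneg.2 hle))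
  have hle := hmono ⟨h0, hρσ⟩ ⟨hσ0, le_rfl⟩ hρσ
  have p1 := Ifun_pos_s13 hm h0 (hρσ.trans hσ)
  have p2 := Ifun_pos_s13 hm hσ0 hσ
  have p3 := Ifun_pos_s13 hn h0 (hρσ.trans hσ)
  have p4 := Ifun_pos_s13 hn hσ0 hσ
  rw [← Real.log_le_log_iff (by positivity) (by positivity), Real.log_rpow (by positivity),
    Real.log_div p1.ne' p2.ne', Real.log_div p3.ne' p4.ne', div_mul_eq_mul_div, le_div_iff₀ hn]
  simp only at hle
  linarith

section SphereMeasure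

open Metric Measure

variable {X : Type*} [MetricSpace X] [MeasurableSpace X] [BorelSpace X]

lemma measure_mul_le_of_forall_ball [SecondCountableTopology X] {μ ν : Measure X}
    [IsFiniteMeasure μ] [IsFiniteMeasure ν] {S : Set X} (hμS : ∀ᵐ x ∂μ, x ∈ S)
    (hνS : ∀ᵐ x ∂ν, x ∈ S) {r : ℝ} {p q : ℝ≥0∞} (hμ : ∀ x ∈ S, μ (ball x r) = p)
    (hν : ∀ x ∈ S, ν (ball x r) = q) {U V : Set X} (hU : MeasurableSet U) (hV : MeasurableSet V)
    (hVU : ∀ x ∈ V, ball x r ⊆ U) : ν V * p ≤ q * μ U := by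
  have hT : MeasurableSet {z : X × X | z.1 ∈ V ∧ dist z.2 z.1 < r} :=
    (measurable_fst hV).inter (measurableSet_lt (measurable_snd.dist measurable_fst) measurable_const)
  calc ν V * p = ∫⁻ x in V, μ (ball x r) ∂ν := by
        rw [lintegral_congr_ae (g := fun _ => p) (ae_restrict_of_ae (hνS.mono hμ)),
          setLIntegral_const, mul_comm]
    _ ≤ ∫⁻ x, μ (Prod.mk x ⁻¹' {z : X × X | z.1 ∈ V ∧ dist z.2 z.1 < r}) ∂ν := by
        rw [← lintegral_indicator hV]
        refine lintegral_mono fun x => ?_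
        by_cases hx : x ∈ V
        · rw [Set.indicator_of_mem hx]
          exact measure_mono fun y hy => ⟨hx, hy⟩
        · simp [hx]
    _ = ∫⁻ y, ν ((fun x => (x, y)) ⁻¹' {z : X × X | z.1 ∈ V ∧ dist z.2 z.1 < r}) ∂μ := by
        rw [← Measure.prod_apply hT, Measure.prod_apply_symm hT]
    _ ≤ ∫⁻ y in U, ν (ball y r) ∂μ := by
        rw [← lintegral_indicator hU]
        refine lintegral_mono fun y => ?_
        by_cases hy : y ∈ U
        · rw [Set.indicator_of_mem hy]
          exact measure_mono fun x hx => by simpa [dist_comm] using hx.2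
        · have : (fun x => (x, y)) ⁻¹' {z : X × X | z.1 ∈ V ∧ dist z.2 z.1 < r} = ∅ :=
            Set.eq_empty_of_forall_notMem fun x hx => hy (hVU x hx.1 hx.2)
          simp [this]
    _ = q * μ U := by
        rw [lintegral_congr_ae (g := fun _ => q) (ae_restrict_of_ae (hμS.mono hν)),
          setLIntegral_const]

omit [BorelSpace X] in
lemma measure_ball_ne_zero_of_homogeneous {μ : Measure X} (hμ0 : μ ≠ 0) {S : Set X}
    (hS : IsCompact S) (hμS : ∀ᵐ x ∂μ, x ∈ S)
    (hμ : ∀ x ∈ S, ∀ y ∈ S, ∀ r, μ (ball x r) = μ (ball y r))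
    {x : X} (hx : x ∈ S) {r : ℝ} (hr : 0 < r) : μ (ball x r) ≠ 0 := by
  intro h
  have hS0 : μ S = 0 := hS.measure_zero_of_nhdsWithin fun y hy =>
    ⟨ball y r, mem_nhdsWithin_of_mem_nhds (ball_mem_nhds y hr), by rw [hμ y hy x hx, h]⟩
  refine hμ0 (Measure.measure_univ_eq_zero.1 ?_)
  rw [← Set.union_compl_self S]
  exact measure_union_null hS0 hμS

lemma mul_measure_le_of_homogeneous [SecondCountableTopology X] {μ ν : Measure X}
    [IsFiniteMeasure μ] [IsFiniteMeasure ν] {S : Set X} (hS : IsCompact S)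
    (hμS : ∀ᵐ x ∂μ, x ∈ S) (hνS : ∀ᵐ x ∂ν, x ∈ S)
    (hμ : ∀ x ∈ S, ∀ y ∈ S, ∀ r, μ (ball x r) = μ (ball y r))
    (hν : ∀ x ∈ S, ∀ y ∈ S, ∀ r, ν (ball x r) = ν (ball y r))
    {U : Set X} (hU : IsOpen U) : μ Set.univ * ν U ≤ ν Set.univ * μ U := by
  rcases eq_or_ne μ 0 with rfl | hμ0
  · simp
  obtain ⟨x₀, hx₀⟩ : S.Nonempty := by
    by_contra hne
    rw [Set.not_nonempty_iff_eq_empty] at hne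
    refine hμ0 (Measure.measure_univ_eq_zero.1 ?_)
    have : μ Sᶜ = 0 := hμS
    simpa [hne] using this
  have key : ∀ k : ℕ, μ Set.univ * ν (thickening (1 / ((k : ℝ) + 1)) Uᶜ)ᶜ ≤
      ν Set.univ * μ U := by
    intro k
    set r : ℝ := 1 / ((k : ℝ) + 1)
    have hr : 0 < r := by positivity
    have hp := measure_ball_ne_zero_of_homogeneous hμ0 hS hμS hμ hx₀ hr
    have hp' : μ (ball x₀ r) ≠ ⊤ := measure_ne_top _ _
    have h1 : ν (thickening r Uᶜ)ᶜ * μ (ball x₀ r) ≤ ν (ball x₀ r) * μ U := by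
      refine measure_mul_le_of_forall_ball hμS hνS (fun x hx => hμ x hx x₀ hx₀ r)
        (fun x hx => hν x hx x₀ hx₀ r) hU.measurableSet isOpen_thickening.measurableSet.compl ?_
      intro x hx y hy
      by_contra hyU
      exact hx (mem_thickening_iff.2 ⟨y, hyU, by rwa [dist_comm]⟩)
    have h2 : μ Set.univ * ν (ball x₀ r) ≤ μ (ball x₀ r) * ν Set.univ :=
      measure_mul_le_of_forall_ball hνS hμS (fun x hx => hν x hx x₀ hx₀ r)
        (fun x hx => hμ x hx x₀ hx₀ r) .univ .univ (fun _ _ => Set.subset_univ _)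
    rw [← ENNReal.mul_le_mul_iff_right hp hp']
    calc μ (ball x₀ r) * (μ Set.univ * ν (thickening r Uᶜ)ᶜ)
        = μ Set.univ * (ν (thickening r Uᶜ)ᶜ * μ (ball x₀ r)) := by ring
      _ ≤ μ Set.univ * (ν (ball x₀ r) * μ U) := by gcongr
      _ = μ Set.univ * ν (ball x₀ r) * μ U := by ring
      _ ≤ μ (ball x₀ r) * ν Set.univ * μ U := by gcongr
      _ = μ (ball x₀ r) * (ν Set.univ * μ U) := by ring
  have hUn : U = ⋃ k : ℕ, (thickening (1 / ((k : ℝ) + 1)) Uᶜ)ᶜ := by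
    ext x
    simp only [Set.mem_iUnion, Set.mem_compl_iff]
    constructor
    · intro hx
      obtain ⟨δ, hδ, hδU⟩ := Metric.isOpen_iff.1 hU x hx
      obtain ⟨k, hk⟩ := exists_nat_one_div_lt hδ
      refine ⟨k, fun h => ?_⟩
      obtain ⟨y, hy, hxy⟩ := mem_thickening_iff.1 h
      exact hy (hδU (by rw [mem_ball, dist_comm]; linarith))
    · rintro ⟨k, hk⟩
      by_contra hx
      exact hk (self_subset_thickening (by positivity) _ hx)
  have hmono : Monotone fun k : ℕ => (thickening (1 / ((k : ℝ) + 1)) Uᶜ)ᶜ := fun i j hij =>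
    Set.compl_subset_compl.2 (thickening_mono (by gcongr) _)
  have hlim := tendsto_measure_iUnion_atTop (μ := ν) hmono
  rw [← hUn] at hlim
  exact le_of_tendsto (ENNReal.Tendsto.const_mul hlim (Or.inr (measure_ne_top _ _)))
    (Eventually.of_forall key)

/-- Two finite measures carried by a compact set on which the measure of a ball depends only on
its radius are proportional. -/
lemma smul_eq_smul_of_homogeneous [SecondCountableTopology X] {μ ν : Measure X}
    [IsFiniteMeasure μ] [IsFiniteMeasure ν] {S : Set X} (hS : IsCompact S)
    (hμS : ∀ᵐ x ∂μ, x ∈ S) (hνS : ∀ᵐ x ∂ν, x ∈ S)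
    (hμ : ∀ x ∈ S, ∀ y ∈ S, ∀ r, μ (ball x r) = μ (ball y r))
    (hν : ∀ x ∈ S, ∀ y ∈ S, ∀ r, ν (ball x r) = ν (ball y r)) :
    μ Set.univ • ν = ν Set.univ • μ := by
  have : IsFiniteMeasure (μ Set.univ • ν) := Measure.smul_finite _ (measure_ne_top _ _)
  refine ext_of_generate_finite _ BorelSpace.measurable_eq isPiSystem_isOpen ?_ ?_
  · intro U hU
    exact (mul_measure_le_of_homogeneous hS hμS hνS hμ hν hU).antisymm
      (mul_measure_le_of_homogeneous hS hνS hμS hν hμ hU)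
  · simp [mul_comm]

variable {E : Type*} [NormedAddCommGroup E] [InnerProductSpace ℝ E]

lemma exists_linearIsometryEquiv_apply_eq {x y : E} (h : ‖x‖ = ‖y‖) :
    ∃ g : E ≃ₗᵢ[ℝ] E, g x = y :=
  ⟨_, Submodule.reflection_sub h⟩

variable [MeasurableSpace E] [BorelSpace E]

lemma hausdorffMeasure_restrict_sphere_ball (d : ℝ) {x y : E} (hx : x ∈ sphere (0 : E) 1)
    (hy : y ∈ sphere (0 : E) 1) (r : ℝ) :
    (μH[d]).restrict (sphere (0 : E) 1) (ball x r) =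
      (μH[d]).restrict (sphere (0 : E) 1) (ball y r) := by
  rw [mem_sphere_zero_iff_norm] at hx hy
  obtain ⟨g, rfl⟩ := exists_linearIsometryEquiv_apply_eq (hx.trans hy.symm)
  rw [Measure.restrict_apply measurableSet_ball, Measure.restrict_apply measurableSet_ball,
    ← g.isometry.hausdorffMeasure_image (Or.inr g.surjective), Set.image_inter g.injective]
  congr 2
  · exact g.image_ball x r
  · simp

variable (E) in
/-- The image of Lebesgue measure on the unit ball under radial projection to the sphere. -/
noncomputable def coneMeasure [FiniteDimensional ℝ E] : Measure E :=
  ((volume : Measure E).restrict (ball 0 1)).map fun x => ‖x‖⁻¹ • x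

variable [FiniteDimensional ℝ E]

lemma measurable_inv_norm_smul : Measurable fun x : E => ‖x‖⁻¹ • x := by fun_prop

instance : IsFiniteMeasure (coneMeasure E) := by
  have : IsFiniteMeasure ((volume : Measure E).restrict (ball 0 1)) :=
    ⟨by simpa using measure_ball_lt_top⟩
  unfold coneMeasure; infer_instance

lemma coneMeasure_univ_ne_zero : coneMeasure E Set.univ ≠ 0 := by
  rw [coneMeasure, Measure.map_apply measurable_inv_norm_smul .univ]
  simpa using (measure_ball_pos volume (0 : E) one_pos).ne'

lemma ae_coneMeasure_mem_sphere [Nontrivial E] : ∀ᵐ z ∂coneMeasure E, z ∈ sphere (0 : E) 1 := by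
  refine (ae_map_iff (p := fun z => z ∈ sphere (0 : E) 1)
    measurable_inv_norm_smul.aemeasurable isClosed_sphere.measurableSet).2 ?_
  refine ae_restrict_of_ae ?_
  filter_upwards [compl_mem_ae_iff.2 (measure_singleton (0 : E))] with x hx
  have : x ≠ 0 := hx
  simp [norm_smul, this]

lemma coneMeasure_ball {x y : E} (hx : x ∈ sphere (0 : E) 1) (hy : y ∈ sphere (0 : E) 1) (r : ℝ) :
    coneMeasure E (ball x r) = coneMeasure E (ball y r) := by
  rw [mem_sphere_zero_iff_norm] at hx hy
  obtain ⟨g, rfl⟩ := exists_linearIsometryEquiv_apply_eq (hx.trans hy.symm)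
  have hm : ∀ z : E, MeasurableSet ((fun x : E => ‖x‖⁻¹ • x) ⁻¹' ball z r) :=
    fun z => measurable_inv_norm_smul measurableSet_ball
  symm
  rw [coneMeasure, Measure.map_apply measurable_inv_norm_smul measurableSet_ball,
    Measure.map_apply measurable_inv_norm_smul measurableSet_ball,
    Measure.restrict_apply (hm _), Measure.restrict_apply (hm _),
    ← g.measurePreserving.measure_preimage ((hm _).inter measurableSet_ball).nullMeasurableSet]
  congr 1
  ext z
  simp only [Set.mem_inter_iff, Set.mem_preimage, mem_ball, g.norm_map, ← map_smul, g.dist_map,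
    dist_zero_right]

lemma exists_hausdorffMeasure_restrict_sphere_eq_smul [Nontrivial E] (d : ℝ)
    {U : Set E} (hU : IsOpen U) (hne : (U ∩ sphere (0 : E) 1).Nonempty)
    (hfin : μH[d] (U ∩ sphere (0 : E) 1) ≠ ⊤) :
    ∃ c : ℝ≥0∞, (μH[d]).restrict (sphere (0 : E) 1) = c • coneMeasure E := by
  obtain ⟨x, hxU, hx⟩ := hne
  obtain ⟨r, hr, hrU⟩ := Metric.isOpen_iff.1 hU x hxU
  have hS : IsCompact (sphere (0 : E) 1) := isCompact_sphere 0 1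
  have hball := fun x hx y hy r =>
    hausdorffMeasure_restrict_sphere_ball (E := E) d (x := x) (y := y) hx hy r
  have hx_lt : (μH[d]).restrict (sphere (0 : E) 1) (ball x r) < ⊤ := by
    rw [Measure.restrict_apply measurableSet_ball]
    exact (measure_mono (Set.inter_subset_inter_left _ hrU)).trans_lt hfin.lt_top
  have : IsFiniteMeasure ((μH[d]).restrict (sphere (0 : E) 1)) := by
    refine ⟨?_⟩
    have := hS.measure_lt_top_of_nhdsWithin (μ := (μH[d]).restrict (sphere (0 : E) 1))
      fun y hy => ⟨ball y r, mem_nhdsWithin_of_mem_nhds (ball_mem_nhds y hr), by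
        rwa [hball y hy x hx]⟩
    simpa using this
  have h := smul_eq_smul_of_homogeneous hS (ae_restrict_mem isClosed_sphere.measurableSet)
    (ae_coneMeasure_mem_sphere (E := E)) hball (fun x hx y hy r => coneMeasure_ball hx hy r)
  refine ⟨(coneMeasure E Set.univ)⁻¹ * (μH[d]).restrict (sphere (0 : E) 1) Set.univ, ?_⟩
  rw [mul_smul, h, ← mul_smul, ENNReal.inv_mul_cancel coneMeasure_univ_ne_zero
    (measure_ne_top _ _), one_smul]

end SphereMeasure

section Polar

open Metric Measure

lemma lintegral_fun_norm_volume {E : Type*} [NormedAddCommGroup E] [InnerProductSpace ℝ E]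
    [MeasurableSpace E] [BorelSpace E] [FiniteDimensional ℝ E] [Nontrivial E]
    {f : ℝ → ℝ≥0∞} (hf : Measurable f) :
    ∫⁻ x : E, f ‖x‖ = (volume : Measure E).toSphere Set.univ *
      ∫⁻ r in Set.Ioi (0 : ℝ), ENNReal.ofReal (r ^ (Module.finrank ℝ E - 1)) * f r := by
  calc ∫⁻ x : E, f ‖x‖
      = ∫⁻ x : ({(0)}ᶜ : Set E), f ‖x.1‖ ∂((volume : Measure E).comap (↑)) := by
        rw [lintegral_subtype_comap (measurableSet_singleton _).compl fun x => f ‖x‖,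
          restrict_compl_singleton]
    _ = ∫⁻ p : sphere (0 : E) 1 × Set.Ioi (0 : ℝ), f p.2 ∂((volume : Measure E).toSphere.prod
          (.volumeIoiPow (Module.finrank ℝ E - 1))) := by
        simpa using (volume : Measure E).measurePreserving_homeomorphUnitSphereProd.lintegral_comp
          (f := fun p : sphere (0 : E) 1 × Set.Ioi (0 : ℝ) => f p.2) (by fun_prop)
    _ = (volume : Measure E).toSphere Set.univ *
          ∫⁻ x : Set.Ioi (0 : ℝ), f x ∂.volumeIoiPow (Module.finrank ℝ E - 1) := by
        rw [lintegral_prod _ (by fun_prop)]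
        simp only [lintegral_const, mul_comm]
    _ = _ := by
        rw [volumeIoiPow, lintegral_withDensity_eq_lintegral_mul _ (by fun_prop) (by fun_prop)]
        simp only [Pi.mul_apply]
        rw [lintegral_subtype_comap measurableSet_Ioi fun r : ℝ =>
          ENNReal.ofReal (r ^ (Module.finrank ℝ E - 1)) * f r]

lemma lintegral_apply_zero_norm (n : ℕ) {G : ℝ → ℝ → ℝ≥0∞}
    (hG : Measurable (Function.uncurry G)) :
    ∫⁻ x : EuclideanSpace ℝ (Fin (n + 1)), G (x 0) ‖x‖ =
      ∫⁻ s : ℝ, ∫⁻ y : EuclideanSpace ℝ (Fin n), G s (Real.sqrt (s ^ 2 + ‖y‖ ^ 2)) := by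
  have hG' : ∀ {α : Type} [MeasurableSpace α] {u v : α → ℝ}, Measurable u → Measurable v →
      Measurable fun x => G (u x) (v x) := fun hu hv => hG.comp (hu.prodMk hv)
  rw [← (PiLp.volume_preserving_toLp (Fin (n + 1))).lintegral_comp (hG' (by fun_prop) (by fun_prop)),
    ← (volume_preserving_piFinSuccAbove (fun _ => ℝ) (0 : Fin (n + 1))).symm.lintegral_comp
      (hG' (by fun_prop) (by fun_prop)),
    Measure.volume_eq_prod, lintegral_prod]
  · refine lintegral_congr fun s => ?_
    rw [← (PiLp.volume_preserving_toLp (Fin n)).lintegral_comp (hG' (by fun_prop) (by fun_prop))]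
    refine lintegral_congr fun y => ?_
    simp [EuclideanSpace.norm_eq, Fin.sum_univ_succ, MeasurableEquiv.piFinSuccAbove,
      Real.sq_sqrt (Finset.sum_nonneg fun i _ => sq_nonneg (y i))]
  · exact (hG' (by fun_prop) (by fun_prop)).aemeasurable

lemma lintegral_inner_norm (n : ℕ) {G : ℝ → ℝ → ℝ≥0∞}
    (hG : Measurable (Function.uncurry G)) {a : EuclideanSpace ℝ (Fin (n + 1))} (ha : ‖a‖ = 1) :
    ∫⁻ x : EuclideanSpace ℝ (Fin (n + 1)), G ⟪x, a⟫ ‖x‖ =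
      ∫⁻ s : ℝ, ∫⁻ y : EuclideanSpace ℝ (Fin n), G s (Real.sqrt (s ^ 2 + ‖y‖ ^ 2)) := by
  obtain ⟨g, rfl⟩ := exists_linearIsometryEquiv_apply_eq
    (x := EuclideanSpace.single (0 : Fin (n + 1)) (1 : ℝ)) (y := a) (by simp [ha])
  rw [← lintegral_apply_zero_norm n hG, ← g.measurePreserving.lintegral_comp]
  · simp [EuclideanSpace.inner_single_right]
  · exact hG.comp (Measurable.prodMk (by fun_prop) (by fun_prop))

lemma lintegral_Ioo_sin {F : ℝ → ℝ≥0∞} (k : ℕ) :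
    ∫⁻ θ in Set.Ioo 0 (Real.pi / 2), ENNReal.ofReal (Real.sin θ ^ k) * F (Real.sin θ) =
      ∫⁻ r in Set.Ioo (0 : ℝ) 1, ENNReal.ofReal (r ^ k / Real.sqrt (1 - r ^ 2)) * F r := by
  have himg : Real.sin '' Set.Ioo 0 (Real.pi / 2) = Set.Ioo 0 1 := by
    ext r
    constructor
    · rintro ⟨θ, hθ, rfl⟩
      refine ⟨Real.sin_pos_of_pos_of_lt_pi hθ.1 (by linarith [hθ.2, Real.pi_pos]), ?_⟩
      rw [← Real.sin_pi_div_two]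
      exact Real.sin_lt_sin_of_lt_of_le_pi_div_two (by linarith [hθ.1, Real.pi_pos]) le_rfl hθ.2
    · intro hr
      exact ⟨Real.arcsin r, ⟨Real.arcsin_pos.2 hr.1, Real.arcsin_lt_pi_div_two.2 hr.2⟩,
        Real.sin_arcsin (by linarith [hr.1]) hr.2.le⟩
  have hinj : Set.InjOn Real.sin (Set.Ioo 0 (Real.pi / 2)) :=
    Real.injOn_sin.mono fun θ (hθ : θ ∈ Set.Ioo 0 (Real.pi / 2)) =>
      Set.mem_Icc.2 ⟨by linarith [hθ.1, Real.pi_pos], hθ.2.le⟩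
  rw [← himg, lintegral_image_eq_lintegral_abs_deriv_mul measurableSet_Ioo
    (fun θ _ => (Real.hasDerivAt_sin θ).hasDerivWithinAt) hinj]
  refine setLIntegral_congr_fun measurableSet_Ioo fun θ hθ => ?_
  have hc : 0 < Real.cos θ :=
    Real.cos_pos_of_mem_Ioo ⟨by linarith [hθ.1, Real.pi_pos], hθ.2⟩
  rw [← mul_assoc, ← ENNReal.ofReal_mul (abs_nonneg _), abs_of_pos hc, ← Real.cos_sq',
    Real.sqrt_sq hc.le, mul_div_cancel₀ _ hc.ne']

lemma mem_Ioo_zero_pi_div_two_iff {θ : ℝ} (hθ : θ ∈ Set.Ioo (-Real.pi) Real.pi) :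
    θ ∈ Set.Ioo 0 (Real.pi / 2) ↔ 0 < Real.cos θ ∧ 0 < Real.sin θ := by
  constructor
  · intro h
    exact ⟨Real.cos_pos_of_mem_Ioo ⟨by linarith [h.1, Real.pi_pos], h.2⟩,
      Real.sin_pos_of_pos_of_lt_pi h.1 hθ.2⟩
  · rintro ⟨hc, hs⟩
    constructor
    · by_contra! h
      exact hs.not_ge (Real.sin_nonpos_of_nonpos_of_neg_pi_le h hθ.1.le)
    · by_contra! h
      exact hc.not_ge (Real.cos_nonpos_of_pi_div_two_le_of_le h
        (by linarith [hθ.2, Real.pi_pos]))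

lemma lintegral_half_disc (k : ℕ) {F : ℝ → ℝ≥0∞} (hF : Measurable F) :
    ∫⁻ s : ℝ, ∫⁻ R in Set.Ioi (0 : ℝ), ENNReal.ofReal (R ^ k) *
        (if 0 < s ∧ Real.sqrt (s ^ 2 + R ^ 2) < 1 then
          F (Real.sqrt (1 - (s / Real.sqrt (s ^ 2 + R ^ 2)) ^ 2)) else 0) =
      (∫⁻ q in Set.Ioo (0 : ℝ) 1, ENNReal.ofReal (q ^ (k + 1))) *
        ∫⁻ r in Set.Ioo (0 : ℝ) 1, ENNReal.ofReal (r ^ k / Real.sqrt (1 - r ^ 2)) * F r := by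
  classical
  let f : ℝ × ℝ → ℝ≥0∞ := fun p =>
    (Set.Ioi (0 : ℝ)).indicator (fun R => ENNReal.ofReal (R ^ k) *
        (if 0 < p.1 ∧ Real.sqrt (p.1 ^ 2 + R ^ 2) < 1 then
          F (Real.sqrt (1 - (p.1 / Real.sqrt (p.1 ^ 2 + R ^ 2)) ^ 2)) else 0)) p.2
  have hr : Measurable fun p : ℝ × ℝ => Real.sqrt (p.1 ^ 2 + p.2 ^ 2) := by fun_prop
  have hf : Measurable f := by
    have : f = (Prod.snd ⁻¹' Set.Ioi (0 : ℝ)).indicator (fun p : ℝ × ℝ => ENNReal.ofReal (p.2 ^ k) *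
        (if 0 < p.1 ∧ Real.sqrt (p.1 ^ 2 + p.2 ^ 2) < 1 then
          F (Real.sqrt (1 - (p.1 / Real.sqrt (p.1 ^ 2 + p.2 ^ 2)) ^ 2)) else 0)) := by
      ext p; simp [f, Set.indicator]
    rw [this]
    refine Measurable.indicator ?_ (measurable_snd measurableSet_Ioi)
    refine Measurable.mul (by fun_prop) (Measurable.ite ?_ (hF.comp ?_) measurable_const)
    · exact (measurableSet_lt measurable_const measurable_fst).inter
        (measurableSet_lt hr measurable_const)
    · exact Real.continuous_sqrt.measurable.comp (measurable_const.sub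
        ((measurable_fst.div hr).pow_const 2))
  have hpt : ∀ p ∈ polarCoord.target, ENNReal.ofReal p.1 • f (polarCoord.symm p) =
      (Set.Ioo (0 : ℝ) 1).indicator (fun q => ENNReal.ofReal (q ^ (k + 1))) p.1 *
      (Set.Ioo (0 : ℝ) (Real.pi / 2)).indicator
        (fun θ => ENNReal.ofReal (Real.sin θ ^ k) * F (Real.sin θ)) p.2 := by
    rintro ⟨q, θ⟩ ⟨hq, hθ⟩
    have hq : 0 < q := hq
    have hmem := mem_Ioo_zero_pi_div_two_iff hθ
    have hsq : Real.sqrt ((q * Real.cos θ) ^ 2 + (q * Real.sin θ) ^ 2) = q := by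
      rw [mul_pow, mul_pow, ← mul_add, Real.cos_sq_add_sin_sq, mul_one, Real.sqrt_sq hq.le]
    simp only [polarCoord_symm_apply, f, Set.indicator_apply, Set.mem_Ioi, hsq, hmem, smul_eq_mul,
      mul_pos_iff_of_pos_left hq, Set.mem_Ioo, hq, true_and]
    by_cases hs : 0 < Real.sin θ
    · by_cases hc : 0 < Real.cos θ
      · by_cases hq1 : q < 1
        · have h1 : Real.sqrt (1 - (q * Real.cos θ / q) ^ 2) = Real.sin θ := by
            rw [mul_div_cancel_left₀ _ hq.ne', ← Real.sin_sq, Real.sqrt_sq hs.le]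
          simp only [hs, hc, hq1, and_self, if_true, h1]
          rw [← mul_assoc, ← mul_assoc, ← ENNReal.ofReal_mul hq.le, ← ENNReal.ofReal_mul (by positivity)]
          congr 2; ring
        · simp [hq1]
      · simp [hc]
    · simp [hs]
  calc _ = ∫⁻ s : ℝ, ∫⁻ R : ℝ, f (s, R) := by
        refine lintegral_congr fun s => ?_
        rw [← lintegral_indicator measurableSet_Ioi]
    _ = ∫⁻ p : ℝ × ℝ, f p := by
        rw [Measure.volume_eq_prod, lintegral_prod _ hf.aemeasurable]
    _ = ∫⁻ p in polarCoord.target,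
          (Set.Ioo (0 : ℝ) 1).indicator (fun q => ENNReal.ofReal (q ^ (k + 1))) p.1 *
          (Set.Ioo (0 : ℝ) (Real.pi / 2)).indicator
            (fun θ => ENNReal.ofReal (Real.sin θ ^ k) * F (Real.sin θ)) p.2 := by
        rw [← lintegral_comp_polarCoord_symm]
        exact setLIntegral_congr_fun polarCoord.open_target.measurableSet hpt
    _ = (∫⁻ q in Set.Ioi (0 : ℝ),
          (Set.Ioo (0 : ℝ) 1).indicator (fun q => ENNReal.ofReal (q ^ (k + 1))) q) *
          ∫⁻ θ in Set.Ioo (-Real.pi) Real.pi, (Set.Ioo (0 : ℝ) (Real.pi / 2)).indicator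
            (fun θ => ENNReal.ofReal (Real.sin θ ^ k) * F (Real.sin θ)) θ := by
        rw [polarCoord_target, Measure.volume_eq_prod, ← Measure.prod_restrict]
        refine lintegral_prod_mul ?_ ?_
        · exact (Measurable.indicator (by fun_prop) measurableSet_Ioo).aemeasurable
        · exact (Measurable.indicator (by fun_prop) measurableSet_Ioo).aemeasurable
    _ = _ := by
        rw [setLIntegral_indicator measurableSet_Ioo, setLIntegral_indicator measurableSet_Ioo,
          Set.inter_eq_left.2 (Set.Ioo_subset_Ioi_self),
          Set.inter_eq_left.2 (Set.Ioo_subset_Ioo (by linarith [Real.pi_pos])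
            (by linarith [Real.pi_pos])), lintegral_Ioo_sin]

/-- On the open hemisphere around `a`, the sine of the angle to `a` is distributed under
`coneMeasure` with density proportional to `r ^ (n - 1) / √(1 - r ^ 2)` on `(0, 1)`. -/
lemma exists_setLIntegral_coneMeasure (n : ℕ) (hn : 1 ≤ n) {a : EuclideanSpace ℝ (Fin (n + 1))}
    (ha : ‖a‖ = 1) : ∃ K : ℝ≥0∞, ∀ F : ℝ → ℝ≥0∞, Measurable F →
      ∫⁻ z in {z | 0 < ⟪z, a⟫}, F (Real.sqrt (1 - ⟪z, a⟫ ^ 2)) ∂coneMeasure _ =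
        K * ∫⁻ r in Set.Ioo (0 : ℝ) 1,
          ENNReal.ofReal (r ^ (n - 1) / Real.sqrt (1 - r ^ 2)) * F r := by
  classical
  have : Nonempty (Fin n) := ⟨⟨0, hn⟩⟩
  refine ⟨(volume : Measure (EuclideanSpace ℝ (Fin n))).toSphere Set.univ *
    ∫⁻ q in Set.Ioo (0 : ℝ) 1, ENNReal.ofReal (q ^ (n - 1 + 1)), fun F hF => ?_⟩
  have hmeas : MeasurableSet {z : EuclideanSpace ℝ (Fin (n + 1)) | 0 < ⟪z, a⟫} :=
    measurableSet_lt measurable_const (by fun_prop)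
  have hFm : Measurable fun z : EuclideanSpace ℝ (Fin (n + 1)) =>
      F (Real.sqrt (1 - ⟪z, a⟫ ^ 2)) := hF.comp (by fun_prop)
  let G : ℝ → ℝ → ℝ≥0∞ := fun s q =>
    if 0 < s ∧ q < 1 then F (Real.sqrt (1 - (s / q) ^ 2)) else 0
  have hG : Measurable (Function.uncurry G) := by
    refine Measurable.ite ((measurableSet_lt measurable_const measurable_fst).inter
      (measurableSet_lt measurable_snd measurable_const)) (hF.comp ?_) measurable_const
    exact Real.continuous_sqrt.measurable.comp (measurable_const.sub
      ((measurable_fst.div measurable_snd).pow_const 2))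
  calc _ = ∫⁻ x : EuclideanSpace ℝ (Fin (n + 1)), G ⟪x, a⟫ ‖x‖ := by
        rw [← lintegral_indicator hmeas, coneMeasure, lintegral_map
          (hFm.indicator hmeas) measurable_inv_norm_smul,
          ← lintegral_indicator measurableSet_ball]
        refine lintegral_congr fun x => ?_
        rcases eq_or_ne x 0 with rfl | hx
        · simp [G]
        · have hx' : 0 < ‖x‖ := norm_pos_iff.2 hx
          simp only [Set.indicator_apply, mem_ball_zero_iff, Set.mem_ofPred_eq,
            real_inner_smul_left, G, ← ite_and,
            inv_mul_eq_div, div_pos_iff_of_pos_right hx', and_comm]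
    _ = _ := by
        rw [lintegral_inner_norm n hG ha, mul_assoc, ← lintegral_half_disc _ hF,
          ← lintegral_const_mul']
        · refine lintegral_congr fun s => ?_
          rw [lintegral_fun_norm_volume (f := fun R => G s (Real.sqrt (s ^ 2 + R ^ 2)))
            (hG.comp (Measurable.prodMk (by fun_prop) (by fun_prop))), finrank_euclideanSpace_fin]
        · exact measure_ne_top _ _

end Polar

lemma setLIntegral_rpow_div_sqrt {m ρ : ℝ} (hm : 0 < m) (h0 : 0 ≤ ρ) (h1 : ρ ≤ 1) :
    ∫⁻ r in Set.Ioo 0 ρ, ENNReal.ofReal (r ^ (m - 1) / Real.sqrt (1 - r ^ 2)) =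
      ENNReal.ofReal (Ifun m ρ) := by
  rw [Ifun, intervalIntegral.integral_of_le h0, restrict_Ioo_eq_restrict_Ioc,
    ofReal_integral_eq_lintegral_ofReal
      (intervalIntegrable_rpow_div_sqrt_of_le hm le_rfl h0 h1).1]
  filter_upwards [ae_restrict_mem measurableSet_Ioc] with r hr
  exact div_nonneg (Real.rpow_nonneg hr.1.le _) (Real.sqrt_nonneg _)

lemma cap_eq (n : ℕ) (a : EuclideanSpace ℝ (Fin (n + 1))) {σ : ℝ} (hσ : 0 < σ) :
    cap n a σ = ({z | 0 < ⟪z, a⟫} ∩ {z | Real.sqrt (1 - ⟪z, a⟫ ^ 2) < σ}) ∩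
      Metric.sphere (0 : EuclideanSpace ℝ (Fin (n + 1))) 1 := by
  ext z
  have key : Real.sqrt (1 - σ ^ 2) < ⟪z, a⟫ ↔
      0 < ⟪z, a⟫ ∧ Real.sqrt (1 - ⟪z, a⟫ ^ 2) < σ := by
    constructor
    · intro h
      have h0 := (Real.sqrt_nonneg _).trans_lt h
      rw [Real.sqrt_lt' h0] at h
      exact ⟨h0, (Real.sqrt_lt' hσ).2 (by linarith)⟩
    · rintro ⟨h0, h⟩
      rw [Real.sqrt_lt' hσ] at h
      exact (Real.sqrt_lt' h0).2 (by linarith)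
  simp only [cap, Set.mem_ofPred_eq, Set.mem_inter_iff, key]
  tauto

lemma nuMeasure_eq_zero_or (n : ℕ) (hn : 1 ≤ n) {a : EuclideanSpace ℝ (Fin (n + 1))}
    (ha : ‖a‖ = 1) {σ : ℝ} (hσ0 : 0 < σ) (hσ1 : σ ≤ 1) :
    nuMeasure n a σ = 0 ∨ nuMeasure n a σ Set.univ = 1 ∧
      ∀ F : ℝ → ℝ≥0∞, Measurable F →
        ENNReal.ofReal (Ifun n σ) *
          ∫⁻ z, F (Real.sqrt (1 - ⟪z, a⟫ ^ 2)) ∂nuMeasure n a σ =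
        ∫⁻ r in Set.Ioo 0 σ,
          ENNReal.ofReal (r ^ ((n : ℝ) - 1) / Real.sqrt (1 - r ^ 2)) * F r := by
  rcases eq_or_ne (μH[(n : ℝ)] (cap n a σ)) 0 with h0 | h0
  · left
    rw [nuMeasure, Measure.restrict_eq_zero.2 h0, smul_zero]
  rcases eq_or_ne (μH[(n : ℝ)] (cap n a σ)) ⊤ with htop | htop
  · left
    rw [nuMeasure, htop, ENNReal.inv_top, zero_smul]
  right
  have huniv : nuMeasure n a σ Set.univ = 1 := by
    simp [nuMeasure, ENNReal.inv_mul_cancel h0 htop]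
  refine ⟨huniv, ?_⟩
  have hA : MeasurableSet {z : EuclideanSpace ℝ (Fin (n + 1)) | 0 < ⟪z, a⟫} :=
    measurableSet_lt measurable_const (by fun_prop)
  have hA' : MeasurableSet
      {z : EuclideanSpace ℝ (Fin (n + 1)) | Real.sqrt (1 - ⟪z, a⟫ ^ 2) < σ} :=
    measurableSet_lt (by fun_prop) measurable_const
  have hopen : IsOpen ({z : EuclideanSpace ℝ (Fin (n + 1)) | 0 < ⟪z, a⟫} ∩
      {z | Real.sqrt (1 - ⟪z, a⟫ ^ 2) < σ}) :=
    (isOpen_lt continuous_const (by fun_prop)).inter (isOpen_lt (by fun_prop) continuous_const)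
  obtain ⟨c, hc⟩ := exists_hausdorffMeasure_restrict_sphere_eq_smul (n : ℝ) hopen
    (by
      rw [← cap_eq n a hσ0]
      exact nonempty_of_measure_ne_zero h0)
    (by rwa [← cap_eq n a hσ0])
  obtain ⟨K, hK⟩ := exists_setLIntegral_coneMeasure n hn ha
  obtain ⟨K', hK'⟩ : ∃ K' : ℝ≥0∞, ∀ F : ℝ → ℝ≥0∞, Measurable F →
      ∫⁻ z, F (Real.sqrt (1 - ⟪z, a⟫ ^ 2)) ∂nuMeasure n a σ =
        K' * ∫⁻ r in Set.Ioo 0 σ,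
          ENNReal.ofReal (r ^ ((n : ℝ) - 1) / Real.sqrt (1 - r ^ 2)) * F r := by
    refine ⟨(μH[(n : ℝ)] (cap n a σ))⁻¹ * (c * K), fun F hF => ?_⟩
    have hK := hK ((Set.Iio σ).indicator F) (hF.indicator measurableSet_Iio)
    rw [nuMeasure, lintegral_smul_measure, smul_eq_mul, mul_assoc]
    congr 1
    rw [cap_eq n a hσ0, ← Measure.restrict_restrict (hA.inter hA'), hc, Measure.restrict_smul,
      lintegral_smul_measure, smul_eq_mul, mul_assoc]
    congr 1
    calc _ = ∫⁻ z in {z | 0 < ⟪z, a⟫}, (Set.Iio σ).indicator F (Real.sqrt (1 - ⟪z, a⟫ ^ 2))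
          ∂coneMeasure _ := by
          rw [Set.inter_comm, ← setLIntegral_indicator hA']
          rfl
      _ = _ := hK
      _ = _ := by
          congr 1
          have hI : Set.Ioo (0 : ℝ) σ = Set.Iio σ ∩ Set.Ioo 0 1 := by
            ext r
            simp only [Set.mem_Ioo, Set.mem_inter_iff, Set.mem_Iio]
            exact ⟨fun h => ⟨h.2, h.1, h.2.trans_le hσ1⟩, fun h => ⟨h.2.1, h.1⟩⟩
          rw [hI, ← setLIntegral_indicator measurableSet_Iio]
          refine setLIntegral_congr_fun measurableSet_Ioo fun r hr => ?_
          have : r ^ ((n : ℝ) - 1) = r ^ (n - 1) := by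
            rw [← Nat.cast_pred hn, Real.rpow_natCast]
          by_cases hrσ : r < σ <;> simp [hrσ, this]
  have h1 := hK' (fun _ => 1) measurable_const
  simp only [lintegral_one, huniv, mul_one] at h1
  have hn' : (0 : ℝ) < n := by exact_mod_cast hn
  rw [setLIntegral_rpow_div_sqrt hn' hσ0.le hσ1] at h1
  intro F hF
  rw [hK' F hF, ← mul_assoc, mul_comm _ K', ← h1, one_mul]

lemma setLIntegral_le_setLIntegral_of_superlevel {α : Type*} [MeasurableSpace α] {ν : Measure α}
    [IsFiniteMeasure ν] {B D : Set α} (hB : MeasurableSet B) (hD : MeasurableSet D)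
    (hBD : ν B = ν D) {f : α → ℝ≥0∞} {k : ℝ≥0∞} (hk : ∀ᵐ z ∂ν, z ∉ D → f z ≤ k)
    (hkD : ∀ z ∈ D, k ≤ f z) : ∫⁻ z in B, f z ∂ν ≤ ∫⁻ z in D, f z ∂ν := by
  have hdiff : ν (B \ D) = ν (D \ B) :=
    measure_sdiff_symm hB.nullMeasurableSet hD.nullMeasurableSet hBD (measure_ne_top _ _)
  rw [← lintegral_inter_add_sdiff f B hD, ← lintegral_inter_add_sdiff f D hB, Set.inter_comm D B]
  gcongr 1
  calc ∫⁻ z in B \ D, f z ∂ν ≤ ∫⁻ _ in B \ D, k ∂ν := by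
        refine lintegral_mono_ae ?_
        filter_upwards [ae_restrict_of_ae hk, ae_restrict_mem (hB.diff hD)] with z hz hzD
        exact hz hzD.2
    _ = ∫⁻ _ in D \ B, k ∂ν := by simp [hdiff]
    _ ≤ ∫⁻ z in D \ B, f z ∂ν :=
        setLIntegral_mono' (hD.diff hB) fun z hz => hkD z hz.1

lemma mul_rpow_le_one {n : ℕ} (hn : 1 ≤ n) {σ H ε p T : ℝ} (hσ0 : 0 < σ) (hσ1 : σ ≤ 1)
    (hε : 0 < ε) (hp : 0 ≤ p) (hT0 : 0 ≤ T) (hT1 : T ≤ 1)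
    (hT : 1 < H → T ≤ Ifun n (σ *
      ((1 / H) * Real.sqrt (1 - (2 / (Real.pi * n)) ^ (p / (n * ε)))) ^ (1 / (ε * n)) *
      (Real.sqrt (2 / (Real.pi * n))) ^ (p / (ε * n))) / Ifun n σ) :
    H * T ^ ε ≤ 1 := by
  rcases le_or_gt H 1 with hH | hH
  · have := Real.rpow_le_one hT0 hT1 hε.le
    have := Real.rpow_nonneg hT0 ε
    nlinarith
  have hn' : (1 : ℝ) ≤ n := by exact_mod_cast hn
  have hπ := Real.pi_gt_three
  have hH0 : 0 < H := by linarith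
  have hy1 : Real.sqrt (2 / (Real.pi * n)) ≤ 1 := by
    rw [Real.sqrt_le_one, div_le_one (by positivity)]
    nlinarith
  have hs1 : Real.sqrt (1 - (2 / (Real.pi * n)) ^ (p / (n * ε))) ≤ 1 := by
    rw [Real.sqrt_le_one]
    have : (0 : ℝ) ≤ (2 / (Real.pi * n)) ^ (p / (n * ε)) := by positivity
    linarith
  have hT := hT hH
  set s := Real.sqrt (1 - (2 / (Real.pi * n)) ^ (p / (n * ε))) with hs
  set y := Real.sqrt (2 / (Real.pi * n)) with hy
  have hs0 : 0 ≤ s := Real.sqrt_nonneg _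
  have hy0 : 0 ≤ y := Real.sqrt_nonneg _
  have hc : (1 / H * s) ^ (1 / (ε * n)) * y ^ (p / (ε * n)) ≤ (1 / H) ^ (1 / (ε * n)) := by
    calc (1 / H * s) ^ (1 / (ε * n)) * y ^ (p / (ε * n))
        ≤ (1 / H * 1) ^ (1 / (ε * n)) * 1 := by
          gcongr
          exact Real.rpow_le_one hy0 hy1 (by positivity)
      _ = _ := by simp
  have hc1 : (1 / H) ^ (1 / (ε * n)) ≤ 1 :=
    Real.rpow_le_one (by positivity) ((div_le_one hH0).2 hH.le) (by positivity)
  have hTn : T ≤ ((1 / H) ^ (1 / (ε * n))) ^ (n : ℝ) := by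
    refine hT.trans ?_
    rw [div_le_iff₀ (Ifun_pos_s13 (by linarith) hσ0 hσ1), mul_assoc]
    refine (Ifun_mul_le (by linarith) (by positivity) (hc.trans hc1) hσ0.le hσ1).trans ?_
    have := Ifun_pos_s13 (m := (n : ℝ)) (by linarith) hσ0 hσ1
    gcongr
  have : T ^ ε ≤ 1 / H := by
    calc T ^ ε ≤ (((1 / H) ^ (1 / (ε * n))) ^ (n : ℝ)) ^ ε := by gcongr
      _ = 1 / H := by
        rw [← Real.rpow_mul (by positivity), ← Real.rpow_mul (by positivity)]
        rw [show 1 / (ε * n) * (n * ε) = (1 : ℝ) by field_simp, Real.rpow_one]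
  rwa [le_div_iff₀ hH0, mul_comm] at this

lemma ofReal_gFun_le (n : ℕ) {σ β r H : ℝ} {h : ℝ → ℝ} (hr : 0 ≤ r) (hhr : h r ≤ H)
    (hC : 0 ≤ Ifun n σ / Ifun ((n : ℝ) - β) σ) :
    ENNReal.ofReal (gFun n σ β h r) ≤
      ENNReal.ofReal (Ifun n σ / Ifun ((n : ℝ) - β) σ * H) * ENNReal.ofReal (r ^ (-β)) := by
  have hrβ : 0 ≤ r ^ (-β) := Real.rpow_nonneg hr _
  rw [← ENNReal.ofReal_mul' hrβ, mul_right_comm]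
  exact ENNReal.ofReal_le_ofReal (mul_le_mul_of_nonneg_left hhr (mul_nonneg hC hrβ))

lemma rpow_neg_le_rpow_neg_of_notMem_Ioo {β ρ r : ℝ} (hβ : 0 ≤ β) (hρ : 0 < ρ) (hρ1 : ρ ≤ 1)
    (hr : 0 ≤ r) (hrD : r ∉ Set.Ioo 0 ρ) : r ^ (-β) ≤ ρ ^ (-β) := by
  rcases hr.eq_or_lt with rfl | hr
  · exact Real.zero_rpow_le_one _ |>.trans
      (Real.one_le_rpow_of_pos_of_le_one_of_nonpos hρ hρ1 (by linarith))
  · exact Real.rpow_le_rpow_of_nonpos hρ (not_lt.1 fun h => hrD ⟨hr, h⟩) (by linarith)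

lemma exists_Ifun_eq_mul {m σ T : ℝ} (hm : 0 < m) (hσ0 : 0 < σ) (hσ1 : σ ≤ 1) (hT0 : 0 < T)
    (hT1 : T ≤ 1) : ∃ ρ ∈ Set.Ioc 0 σ, Ifun m ρ = T * Ifun m σ := by
  have hI := Ifun_pos_s13 hm hσ0 hσ1
  have hcont := (continuousOn_Ifun hm).mono (Set.Icc_subset_Icc_right hσ1)
  obtain ⟨ρ, hρ, hρI⟩ := intermediate_value_Icc hσ0.le hcont
    (show T * Ifun m σ ∈ Set.Icc (Ifun m 0) (Ifun m σ) by
      rw [Ifun_zero]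
      exact ⟨by positivity, by nlinarith⟩)
  refine ⟨ρ, ⟨hρ.1.lt_of_ne ?_, hρ.2⟩, hρI⟩
  rintro rfl
  rw [Ifun_zero] at hρI
  exact (mul_pos hT0 hI).ne hρI

/-- Among sets of given measure, the integral of `(sin θ)^{-β}` is largest on concentric caps. -/
lemma ofReal_Ifun_mul_setLIntegral_rpow_le (n : ℕ) (hn : 1 ≤ n)
    {a : EuclideanSpace ℝ (Fin (n + 1))} {ν : Measure (EuclideanSpace ℝ (Fin (n + 1)))}
    [IsFiniteMeasure ν] {σ β ρ : ℝ} (hσ0 : 0 < σ) (hσ1 : σ ≤ 1) (hβ0 : 0 ≤ β) (hβn : β < n)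
    (hρ : ρ ∈ Set.Ioc 0 σ)
    (hν : ∀ F : ℝ → ℝ≥0∞, Measurable F →
      ENNReal.ofReal (Ifun n σ) * ∫⁻ z, F (Real.sqrt (1 - ⟪z, a⟫ ^ 2)) ∂ν =
        ∫⁻ r in Set.Ioo 0 σ,
          ENNReal.ofReal (r ^ ((n : ℝ) - 1) / Real.sqrt (1 - r ^ 2)) * F r)
    {B : Set (EuclideanSpace ℝ (Fin (n + 1)))} (hB : MeasurableSet B)
    (hBρ : ENNReal.ofReal (Ifun n σ) * ν B = ENNReal.ofReal (Ifun n ρ)) :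
    ENNReal.ofReal (Ifun n σ) *
        ∫⁻ z in B, ENNReal.ofReal (Real.sqrt (1 - ⟪z, a⟫ ^ 2) ^ (-β)) ∂ν ≤
      ENNReal.ofReal (Ifun ((n : ℝ) - β) ρ) := by
  have hn' : (0 : ℝ) < n := by exact_mod_cast hn
  have hIσ : 0 < Ifun n σ := Ifun_pos_s13 hn' hσ0 hσ1
  have hρ1 : ρ ≤ 1 := hρ.2.trans hσ1
  have hD : MeasurableSet {z : EuclideanSpace ℝ (Fin (n + 1)) |
      Real.sqrt (1 - ⟪z, a⟫ ^ 2) ∈ Set.Ioo 0 ρ} :=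
    (show Measurable fun z : EuclideanSpace ℝ (Fin (n + 1)) => Real.sqrt (1 - ⟪z, a⟫ ^ 2) by
      fun_prop) measurableSet_Ioo
  set D := {z : EuclideanSpace ℝ (Fin (n + 1)) | Real.sqrt (1 - ⟪z, a⟫ ^ 2) ∈ Set.Ioo 0 ρ}
  have hνD : ∀ F : ℝ → ℝ≥0∞, Measurable F →
      ENNReal.ofReal (Ifun n σ) * ∫⁻ z in D, F (Real.sqrt (1 - ⟪z, a⟫ ^ 2)) ∂ν =
        ∫⁻ r in Set.Ioo 0 ρ,
          ENNReal.ofReal (r ^ ((n : ℝ) - 1) / Real.sqrt (1 - r ^ 2)) * F r := by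
    intro F hF
    have := hν ((Set.Ioo 0 ρ).indicator F) (hF.indicator measurableSet_Ioo)
    rw [← lintegral_indicator hD]
    refine Eq.trans ?_ (this.trans ?_)
    · rfl
    · have hF' : ∀ r, ENNReal.ofReal (r ^ ((n : ℝ) - 1) / Real.sqrt (1 - r ^ 2)) *
          (Set.Ioo 0 ρ).indicator F r = (Set.Ioo 0 ρ).indicator (fun r =>
            ENNReal.ofReal (r ^ ((n : ℝ) - 1) / Real.sqrt (1 - r ^ 2)) * F r) r :=
        fun r => (Set.indicator_mul_right _ (fun r => ENNReal.ofReal (r ^ ((n : ℝ) - 1) /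
          Real.sqrt (1 - r ^ 2))) F).symm
      simp only [hF']
      rw [setLIntegral_indicator measurableSet_Ioo,
        Set.inter_eq_left.2 (Set.Ioo_subset_Ioo_right hρ.2)]
  have hBD : ν B = ν D := by
    have h1 := hνD (fun _ => 1) measurable_const
    simp only [lintegral_one, Measure.restrict_apply_univ, mul_one] at h1
    rw [setLIntegral_rpow_div_sqrt hn' hρ.1.le hρ1, ← hBρ] at h1
    exact ((ENNReal.mul_right_inj (by simpa using hIσ) ENNReal.ofReal_ne_top).1 h1).symm
  calc _ ≤ ENNReal.ofReal (Ifun n σ) *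
        ∫⁻ z in D, ENNReal.ofReal (Real.sqrt (1 - ⟪z, a⟫ ^ 2) ^ (-β)) ∂ν := by
        gcongr 1
        refine setLIntegral_le_setLIntegral_of_superlevel hB hD hBD
          (k := ENNReal.ofReal (ρ ^ (-β))) (.of_forall fun z hz => ?_) fun z hz => ?_
        · exact ENNReal.ofReal_le_ofReal
            (rpow_neg_le_rpow_neg_of_notMem_Ioo hβ0 hρ.1 hρ1 (Real.sqrt_nonneg _) hz)
        · exact ENNReal.ofReal_le_ofReal
            (Real.rpow_le_rpow_of_nonpos hz.1 hz.2.le (by linarith))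
    _ = ∫⁻ r in Set.Ioo 0 ρ, ENNReal.ofReal (r ^ ((n : ℝ) - β - 1) / Real.sqrt (1 - r ^ 2)) := by
        rw [hνD (fun r => ENNReal.ofReal (r ^ (-β))) (by fun_prop)]
        refine setLIntegral_congr_fun measurableSet_Ioo fun r hr => ?_
        rw [← ENNReal.ofReal_mul' (Real.rpow_nonneg hr.1.le _), div_mul_eq_mul_div,
          ← Real.rpow_add hr.1]
        ring_nf
    _ = _ := setLIntegral_rpow_div_sqrt (by linarith) hρ.1.le hρ1

lemma ae_nuMeasure_sqrt_lt (n : ℕ) (a : EuclideanSpace ℝ (Fin (n + 1))) {σ : ℝ} (hσ : 0 < σ) :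
    ∀ᵐ z ∂nuMeasure n a σ, Real.sqrt (1 - ⟪z, a⟫ ^ 2) < σ := by
  refine Measure.ae_smul_measure ?_ _
  have hcap : MeasurableSet (cap n a σ) := by
    rw [cap_eq n a hσ]
    exact ((measurableSet_lt measurable_const (by fun_prop)).inter
      (measurableSet_lt (by fun_prop) measurable_const)).inter Metric.isClosed_sphere.measurableSet
  filter_upwards [ae_restrict_mem hcap] with z hz
  rw [cap_eq n a hσ] at hz
  exact hz.1.2

/-- Let `ε ∈ (0, 1-β/n)`. Every Borel set `B ⊆ Sⁿ` with `ν_{a,σ}(B) ≤ δ_ε`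
satisfies `μ(B) ≤ (ν_{a,σ}(B))^{1-β/n-ε}`. -/
theorem stmt13 (n : ℕ) (hn : 1 ≤ n)
    (a : EuclideanSpace ℝ (Fin (n + 1)))
    (ha : a ∈ Metric.sphere (0 : EuclideanSpace ℝ (Fin (n + 1))) 1)
    (σ : ℝ) (hσ : σ ∈ Set.Ioc (0:ℝ) 1)
    (β : ℝ) (hβ0 : 0 ≤ β) (hβn : β < n)
    (h : ℝ → ℝ) (hcont : ContinuousOn h (Set.Icc 0 σ))
    (hpos : ∀ r ∈ Set.Icc (0:ℝ) σ, 0 < h r)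
    (hint : (∫ r in (0:ℝ)..σ, h r * (r ^ ((n : ℝ) - β - 1) / Real.sqrt (1 - r ^ 2)))
      = Ifun ((n : ℝ) - β) σ)
    (hmono : AntitoneOn (gFun n σ β h) (Set.Ioc 0 σ))
    (H : ℝ) (hH : H = sSup (h '' Set.Icc 0 σ))
    (ε : ℝ) (hε : ε ∈ Set.Ioo 0 (1 - β / n))
    (ρε : ℝ) (hρε : ρε = σ *
      ((1 / H) * Real.sqrt (1 - (2 / (Real.pi * n)) ^ ((1 - β / n - ε) / (n * ε))))
        ^ (1 / (ε * n)) *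
      (Real.sqrt (2 / (Real.pi * n))) ^ ((1 - β / n - ε) / (ε * n)))
    (δε : ℝ) (hδε : δε = Ifun n ρε / Ifun n σ)
    (B : Set (EuclideanSpace ℝ (Fin (n + 1)))) (hB : MeasurableSet B)
    (hBsub : B ⊆ Metric.sphere (0 : EuclideanSpace ℝ (Fin (n + 1))) 1)
    (hBδ : nuMeasure n a σ B ≤ ENNReal.ofReal δε) :
    advMeasure n a σ β h B ≤ nuMeasure n a σ B ^ (1 - β / n - ε) := by
  obtain ⟨hσ0, hσ1⟩ := hσ
  have hn' : (0 : ℝ) < n := by exact_mod_cast hn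
  have hβ : 0 < (n : ℝ) - β := by linarith
  have hp : 0 < 1 - β / n - ε := by linarith [hε.2]
  rcases eq_or_ne (nuMeasure n a σ B) 0 with ht0 | ht0
  · have : advMeasure n a σ β h B = 0 := withDensity_absolutelyContinuous _ _ ht0
    simp [this]
  obtain hν | ⟨huniv, hν⟩ := nuMeasure_eq_zero_or n hn (mem_sphere_zero_iff_norm.1 ha) hσ0 hσ1
  · simp [hν] at ht0
  have : IsProbabilityMeasure (nuMeasure n a σ) := ⟨huniv⟩
  have hIσ : 0 < Ifun n σ := Ifun_pos_s13 hn' hσ0 hσ1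
  have hJσ : 0 < Ifun ((n : ℝ) - β) σ := Ifun_pos_s13 hβ hσ0 hσ1
  have hhH : ∀ r ∈ Set.Icc 0 σ, h r ≤ H := fun r hr => hH ▸
    le_csSup (isCompact_Icc.image_of_continuousOn hcont).bddAbove (Set.mem_image_of_mem h hr)
  have hH0 : 0 < H :=
    (hpos 0 (Set.left_mem_Icc.2 hσ0.le)).trans_le (hhH 0 (Set.left_mem_Icc.2 hσ0.le))
  obtain ⟨T, hT⟩ : ∃ T, T = (nuMeasure n a σ B).toReal := ⟨_, rfl⟩
  have htT : nuMeasure n a σ B = ENNReal.ofReal T := by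
    rw [hT, ENNReal.ofReal_toReal (measure_ne_top _ _)]
  have hT0 : 0 < T := hT ▸ ENNReal.toReal_pos ht0 (measure_ne_top _ _)
  have hT1 : T ≤ 1 := by
    rw [← ENNReal.ofReal_le_one, ← htT]
    exact prob_le_one
  have hTδ : T ≤ δε := by
    rw [htT] at hBδ
    exact (ENNReal.ofReal_le_ofReal_iff'.1 hBδ).resolve_right hT0.not_ge
  have hHT : H * T ^ ε ≤ 1 :=
    mul_rpow_le_one hn hσ0 hσ1 hε.1 hp.le hT0.le hT1 fun _ => by rwa [← hρε, ← hδε]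
  obtain ⟨ρ, hρ, hρT⟩ := exists_Ifun_eq_mul hn' hσ0 hσ1 hT0 hT1
  have hbath := ofReal_Ifun_mul_setLIntegral_rpow_le n hn hσ0 hσ1 hβ0 hβn hρ hν hB
    (by rw [htT, ← ENNReal.ofReal_mul hIσ.le, hρT, mul_comm])
  calc advMeasure n a σ β h B
      = ∫⁻ z in B, ENNReal.ofReal (gFun n σ β h (Real.sqrt (1 - ⟪z, a⟫ ^ 2)))
          ∂nuMeasure n a σ := withDensity_apply _ hB
    _ ≤ ∫⁻ z in B, ENNReal.ofReal (Ifun n σ / Ifun ((n : ℝ) - β) σ * H) *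
          ENNReal.ofReal (Real.sqrt (1 - ⟪z, a⟫ ^ 2) ^ (-β)) ∂nuMeasure n a σ := by
        refine lintegral_mono_ae ?_
        filter_upwards [ae_restrict_of_ae (ae_nuMeasure_sqrt_lt n a hσ0)] with z hz
        exact ofReal_gFun_le n (Real.sqrt_nonneg _) (hhH _ ⟨Real.sqrt_nonneg _, hz.le⟩)
          (by positivity)
    _ = ENNReal.ofReal (H / Ifun ((n : ℝ) - β) σ) * (ENNReal.ofReal (Ifun n σ) *
          ∫⁻ z in B, ENNReal.ofReal (Real.sqrt (1 - ⟪z, a⟫ ^ 2) ^ (-β)) ∂nuMeasure n a σ) := by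
        rw [lintegral_const_mul' _ _ ENNReal.ofReal_ne_top, ← mul_assoc,
          ← ENNReal.ofReal_mul (by positivity)]
        congr 2
        ring
    _ ≤ ENNReal.ofReal (H / Ifun ((n : ℝ) - β) σ) *
          ENNReal.ofReal (Ifun ((n : ℝ) - β) ρ) := by gcongr
    _ ≤ ENNReal.ofReal (T ^ (1 - β / n - ε)) := by
        rw [← ENNReal.ofReal_mul (by positivity)]
        refine ENNReal.ofReal_le_ofReal ?_
        have hratio := Ifun_div_le_rpow (n := n) hβ (by linarith) hρ.1 hρ.2 hσ1
        rw [hρT, mul_div_cancel_right₀ _ hIσ.ne',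
          show ((n : ℝ) - β) / n = ε + (1 - β / n - ε) by field_simp; ring,
          Real.rpow_add hT0] at hratio
        calc H / Ifun ((n : ℝ) - β) σ * Ifun ((n : ℝ) - β) ρ
            = H * (Ifun ((n : ℝ) - β) ρ / Ifun ((n : ℝ) - β) σ) := by ring
          _ ≤ H * (T ^ ε * T ^ (1 - β / n - ε)) := by gcongr
          _ = H * T ^ ε * T ^ (1 - β / n - ε) := by ring
          _ ≤ 1 * T ^ (1 - β / n - ε) := by gcongr
          _ = T ^ (1 - β / n - ε) := one_mul _
    _ = nuMeasure n a σ B ^ (1 - β / n - ε) := by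
        rw [htT, ENNReal.ofReal_rpow_of_pos hT0]
end
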